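/- arXiv:2502.09576 — 4 statements merged into one kernel-verified Lean document; each statement's English description precedes it below -/
import Mathlib

section
/- Theorem 1.5 (bounded VC-dimension): For every integer k ≥ 2 and every ε > 0, there exists n_0 such that the following holds for all n ≥ n_0. If G is an n-vertex maximal C_{2k−1}-free graph with minimum degree δ(G) ≥ (1/(2k−1) + ε)·n, then the VC-dimension of G is at most (2k−1)^3·binomial(2k−2, k−1)·2^{(2k−1)^{2k−2}}; equivalently, every shattered set of vertices of G has size at most this bound. -/
open SimpleGraph

/-- A set `S` of vertices of a graph `G` is shattered if every subset of `S` is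
a trace of a vertex neighborhood on `S`. -/
def Shattered {V : Type*} (G : SimpleGraph V) (S : Set V) : Prop :=
  ∀ S' ⊆ S, ∃ v : V, G.neighborSet v ∩ S = S'

/-- `G` contains a cycle of length `ℓ`. -/
def HasCycleOfLength {V : Type*} (G : SimpleGraph V) (ℓ : ℕ) : Prop :=
  ∃ (v : V) (w : G.Walk v v), w.IsCycle ∧ w.length = ℓ

/-- `G` is maximal `C_ℓ`-free: it has no cycle of length `ℓ`, and adding any edge
between two non-adjacent vertices creates a cycle of length `ℓ`. -/
def MaximalCLFree {V : Type*} (G : SimpleGraph V) (ℓ : ℕ) : Prop :=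
  ¬ HasCycleOfLength G ℓ ∧
    ∀ u v : V, u ≠ v → ¬ G.Adj u v →
      HasCycleOfLength (G ⊔ SimpleGraph.fromEdgeSet {s(u, v)}) ℓ

/-- There is a path of length `m` from `x` to `y` with all vertices in `A`. -/
def PathIn {V : Type*} (G : SimpleGraph V) (x y : V) (m : ℕ) (A : Set V) : Prop :=
  ∃ w : G.Walk x y, w.IsPath ∧ w.length = m ∧ ∀ z ∈ w.support, z ∈ A

namespace PathIn

variable {V : Type*} {G : SimpleGraph V} {x y z t : V} {m m' : ℕ} {A B : Set V}

lemma single (x : V) : PathIn G x x 0 {x} := ⟨.nil, by simp⟩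

lemma mono (h : PathIn G x y m A) (hAB : A ⊆ B) : PathIn G x y m B := by
  obtain ⟨w, h1, h2, h3⟩ := h
  exact ⟨w, h1, h2, fun z hz => hAB (h3 z hz)⟩

lemma symm (h : PathIn G x y m A) : PathIn G y x m A := by
  obtain ⟨w, h1, h2, h3⟩ := h
  exact ⟨w.reverse, h1.reverse, by simpa using h2, by simpa using h3⟩

lemma join (h₁ : PathIn G x y m A) (e : G.Adj y z) (h₂ : PathIn G z t m' B)
    (hAB : Disjoint A B) : PathIn G x t (m + m' + 1) (A ∪ B) := by
  obtain ⟨w, h1, h2, h3⟩ := h₁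
  obtain ⟨w', h1', h2', h3'⟩ := h₂
  refine ⟨w.append (.cons e w'), ?_, ?_, ?_⟩
  · rw [Walk.isPath_def, Walk.support_append, Walk.support_cons, List.tail_cons,
      List.nodup_append']
    refine ⟨h1.support_nodup, h1'.support_nodup, ?_⟩
    intro a ha ha'
    exact Set.disjoint_left.1 hAB (h3 a ha) (h3' a ha')
  · simp [Walk.length_append]; omega
  · intro a ha
    rw [Walk.support_append, Walk.support_cons, List.tail_cons, List.mem_append] at ha
    exact ha.imp (h3 a) (h3' a)

lemma hasCycle (h : PathIn G x y m A) (hm : 2 ≤ m) (e : G.Adj y x) :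
    HasCycleOfLength G (m + 1) := by
  obtain ⟨w, h1, h2, h3⟩ := h
  refine ⟨y, .cons e w, ?_, by simp [h2]⟩
  rw [Walk.cons_isCycle_iff]
  refine ⟨h1, fun hmem => ?_⟩
  have := h1.length_eq_one_of_mem_edges (Sym2.eq_swap ▸ hmem)
  omega

/-- The vertex set of a path can be taken to be finite of size one more than the length. -/
lemma exists_finset [DecidableEq V] (h : PathIn G x y m A) :
    ∃ F : Finset V, F.card = m + 1 ∧ x ∈ F ∧ y ∈ F ∧ (F : Set V) ⊆ A ∧ PathIn G x y m F := by
  obtain ⟨w, h1, h2, h3⟩ := h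
  refine ⟨w.support.toFinset, ?_, by simp, by simp, ?_, w, h1, h2, by simp⟩
  · rw [List.toFinset_card_of_nodup h1.support_nodup]; simp [h2]
  · intro z hz; exact h3 z (by simpa using hz)

/-- Consecutively adjacent pairwise distinct vertices form a path. -/
lemma of_seq (p : ℕ → V) (a d : ℕ) (hadj : ∀ c, a ≤ c → c < a + d → G.Adj (p c) (p (c + 1)))
    (hinj : Set.InjOn p (Set.Icc a (a + d))) :
    PathIn G (p a) (p (a + d)) d (p '' Set.Icc a (a + d)) := by
  induction d with
  | zero => exact (single (p a)).mono (by simp)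
  | succ d ih =>
    have h1 := ih (fun c hc hc' => hadj c hc (by omega))
      (hinj.mono (Set.Icc_subset_Icc_right (by omega)))
    have h2 := h1.join (hadj (a + d) (by omega) (by omega)) (single (p (a + d + 1))) ?_
    · refine h2.mono ?_
      rintro v (⟨c, hc, rfl⟩ | hv)
      · exact ⟨c, ⟨hc.1, by have := hc.2; omega⟩, rfl⟩
      · exact ⟨a + d + 1, ⟨by omega, by omega⟩, hv.symm⟩
    · rw [Set.disjoint_singleton_right]
      rintro ⟨c, hc, hcd⟩
      have := hinj ⟨hc.1, by have := hc.2; omega⟩ ⟨by omega, by omega⟩ hcd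
      have := hc.2
      omega

end PathIn

lemma path_of_cycle_snd {V : Type*} {G : SimpleGraph V} {u v : V} {ℓ : ℕ}
    (c : (G ⊔ SimpleGraph.fromEdgeSet {s(u, v)}).Walk u u) (hc : c.IsCycle) (hl : c.length = ℓ)
    (hs : c.snd = v) : PathIn G v u (ℓ - 1) Set.univ := by
  cases c with
  | nil => simp at hc
  | cons h q =>
    rw [Walk.snd_cons] at hs
    subst hs
    rw [Walk.cons_isCycle_iff] at hc
    have hG : ∀ e ∈ q.edges, e ∈ G.edgeSet := by
      intro e he
      have := q.edges_subset_edgeSet he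
      rw [edgeSet_sup, edgeSet_fromEdgeSet] at this
      rcases this with h' | h'
      · exact h'
      · exact absurd (h'.1 ▸ he) hc.2
    refine ⟨q.transfer G hG, hc.1.transfer hG, ?_, by simp⟩
    simp at hl ⊢; omega

lemma exists_path_of_hasCycle_sup {V : Type*} {G : SimpleGraph V} {u v : V} {ℓ : ℕ}
    (hfree : ¬ HasCycleOfLength G ℓ)
    (h : HasCycleOfLength (G ⊔ SimpleGraph.fromEdgeSet {s(u, v)}) ℓ) :
    PathIn G v u (ℓ - 1) Set.univ := by
  classical
  obtain ⟨x, c, hc, hl⟩ := h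
  by_cases hmem : s(u, v) ∈ c.edges
  · have hu : u ∈ c.support := Walk.fst_mem_support_of_mem_edges c hmem
    have hc' := hc.rotate hu
    have hl' : (c.rotate u hu).length = ℓ := by simpa using hl
    have hmem' : s(u, v) ∈ (c.rotate u hu).edges := (c.rotate_edges u hu).perm.mem_iff.2 hmem
    generalize c.rotate u hu = c' at hc' hl' hmem'
    by_cases hs : c'.snd = v
    · exact path_of_cycle_snd c' hc' hl' hs
    · refine path_of_cycle_snd c'.reverse hc'.reverse (by simpa using hl') ?_
      cases c' with
      | nil => simp at hc'
      | cons h q =>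
        rw [Walk.snd_cons] at hs
        have hq := (Walk.cons_isCycle_iff _ _).1 hc'
        rw [Walk.edges_cons, List.mem_cons] at hmem'
        have : s(u, v) ∈ q.edges := by
          refine hmem'.resolve_left fun h' => hs ?_
          simpa using (Sym2.congr_right.1 h').symm
        have h1 := hq.1.eq_penultimate_of_mem_edges this
        rw [Walk.snd_reverse]
        exact (Walk.penultimate_cons_of_not_nil _ _ (Walk.not_nil_of_isCycle_cons hc')).trans
          h1.symm
  · exfalso
    apply hfree
    have hG : ∀ e ∈ c.edges, e ∈ G.edgeSet := by
      intro e he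
      have := c.edges_subset_edgeSet he
      rw [edgeSet_sup, edgeSet_fromEdgeSet] at this
      rcases this with h' | h'
      · exact h'
      · exact absurd (h'.1 ▸ he) hmem
    exact ⟨x, c.transfer G hG, hc.transfer hG, by simpa using hl⟩

section Finite

variable {V : Type*} [Fintype V] [DecidableEq V] {G : SimpleGraph V} [DecidableRel G.Adj]

lemma exists_alternating_path {ℓ C : ℕ} (hℓ : 0 < ℓ)
    (hmin : ∀ (v : V) (F : Finset V), F.card ≤ C →
      Fintype.card V ≤ 2 * ℓ * (G.neighborFinset v \ F).card) (r : ℕ) (A F : Finset V)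
    (hA : (4 * ℓ) ^ r ≤ A.card) (hF : F.card + 2 * r ≤ C) (hAF : Disjoint A F) :
    ∃ a ∈ A, ∃ b ∈ A, PathIn G a b (2 * r) (F : Set V)ᶜ := by
  induction r generalizing A F with
  | zero =>
    obtain ⟨a, ha⟩ : A.Nonempty := Finset.card_pos.1 (by simpa using hA)
    refine ⟨a, ha, a, ha, (PathIn.single a).mono ?_⟩
    simpa using Finset.disjoint_left.1 hAF ha
  | succ r ih =>
    obtain ⟨b, hbF, hb⟩ : ∃ b ∉ F, (4 * ℓ) ^ r + 1 ≤ (A ∩ G.neighborFinset b).card := by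
      by_contra! hcon
      have h1 : ∑ a ∈ A, (G.neighborFinset a \ F).card =
          ∑ b ∈ Finset.univ \ F, (A ∩ G.neighborFinset b).card := by
        have := Finset.sum_card_bipartiteAbove_eq_sum_card_bipartiteBelow (s := A)
          (t := Finset.univ \ F) G.Adj
        convert this using 3 with a ha b hb
        · ext z; simp [Finset.mem_bipartiteAbove, and_comm]
        · ext z; simp [Finset.mem_bipartiteBelow, G.adj_comm]
      have h2 : ∑ b ∈ Finset.univ \ F, (A ∩ G.neighborFinset b).card ≤
          Fintype.card V * (4 * ℓ) ^ r := by
        refine (Finset.sum_le_card_nsmul _ _ ((4 * ℓ) ^ r) fun b hb => ?_).trans ?_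
        · have := hcon b (by simpa using hb)
          omega
        · rw [smul_eq_mul]
          exact Nat.mul_le_mul_right _ (Finset.card_le_univ _)
      have h3 : A.card * Fintype.card V ≤ 2 * ℓ * ∑ a ∈ A, (G.neighborFinset a \ F).card := by
        rw [Finset.mul_sum, ← smul_eq_mul]
        exact Finset.card_nsmul_le_sum _ _ _ fun a _ => hmin a F (by omega)
      have hn : 0 < Fintype.card V := by
        obtain ⟨a, -⟩ : A.Nonempty := Finset.card_pos.1 (lt_of_lt_of_le (by positivity) hA)
        exact Fintype.card_pos_iff.2 ⟨a⟩
      have h4 : (4 * ℓ) ^ (r + 1) * Fintype.card V ≤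
          2 * ℓ * (Fintype.card V * (4 * ℓ) ^ r) :=
        (Nat.mul_le_mul_right _ hA).trans (h3.trans (Nat.mul_le_mul_left _ (h1 ▸ h2)))
      have h5 : 0 < ℓ * (Fintype.card V * (4 * ℓ) ^ r) := by positivity
      rw [pow_succ] at h4
      nlinarith
    obtain ⟨c, hc⟩ : (A ∩ G.neighborFinset b).Nonempty := Finset.card_pos.1 (by omega)
    have hcA := (Finset.mem_inter.1 hc).1
    have hbc : G.Adj b c := by simpa using (Finset.mem_inter.1 hc).2
    have hcF : c ∉ F := Finset.disjoint_left.1 hAF hcA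
    obtain ⟨a, ha, a', ha', hp⟩ := ih ((A ∩ G.neighborFinset b).erase c) (insert b (insert c F))
      (by rw [Finset.card_erase_of_mem hc]; omega)
      (by
        have h1 := Finset.card_insert_le b (insert c F)
        have h2 := Finset.card_insert_le c F
        omega)
      (by
        rw [Finset.disjoint_left]
        intro z hz hz'
        simp only [Finset.mem_erase, Finset.mem_inter, mem_neighborFinset] at hz
        simp only [Finset.mem_insert] at hz'
        rcases hz' with rfl | rfl | hz'
        · exact hz.2.2.ne rfl
        · exact hz.1 rfl
        · exact Finset.disjoint_left.1 hAF hz.2.1 hz')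
    simp only [Finset.mem_erase, Finset.mem_inter, mem_neighborFinset] at ha ha'
    have hbc' : PathIn G b c 1 ({b} ∪ {c}) :=
      (PathIn.single b).join hbc (PathIn.single c) (by simpa using hbc.ne)
    refine ⟨a, ha.2.1, c, hcA, ?_⟩
    have := hp.join ha'.2.2.symm hbc' ?_
    · rw [show 2 * (r + 1) = 2 * r + 1 + 1 by ring]
      refine this.mono ?_
      rintro z (hz | hz)
      · simp at hz ⊢; tauto
      · rintro hzF
        rcases hz with rfl | rfl
        · exact hbF hzF
        · exact hcF hzF
    · rw [Set.disjoint_left]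
      intro z hz hz'
      simp at hz hz'
      tauto

lemma codegree_lt_of_odd_path {t m : ℕ} (ht : 1 ≤ t)
    (hfree : ¬ HasCycleOfLength G (2 * t + 1))
    (hmin : ∀ (v : V) (F : Finset V), F.card ≤ 2 * t →
      Fintype.card V ≤ 2 * (2 * t + 1) * (G.neighborFinset v \ F).card)
    {x y : V} {A : Set V} (h : PathIn G x y m A) (hodd : Odd m) (hm : m + 1 ≤ 2 * t) :
    (G.neighborFinset x ∩ G.neighborFinset y).card < (4 * (2 * t + 1)) ^ t + 2 * t := by
  by_contra! hcon
  obtain ⟨F, hFc, hxF, hyF, -, hp⟩ := h.exists_finset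
  obtain ⟨s, rfl⟩ := hodd
  obtain ⟨r, rfl⟩ : ∃ r, t = r + s + 1 := ⟨t - s - 1, by omega⟩
  obtain ⟨a, ha, b, hb, hq⟩ := exists_alternating_path (C := 2 * (r + s + 1)) (by omega) hmin r
    ((G.neighborFinset x ∩ G.neighborFinset y) \ F) F
    (by
      have h1 := Finset.le_card_sdiff F (G.neighborFinset x ∩ G.neighborFinset y)
      have h2 : (4 * (2 * (r + s + 1) + 1)) ^ r ≤ (4 * (2 * (r + s + 1) + 1)) ^ (r + s + 1) :=
        Nat.pow_le_pow_right (by omega) (by omega)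
      omega) (by omega) Finset.sdiff_disjoint
  simp only [Finset.mem_sdiff, Finset.mem_inter, mem_neighborFinset] at ha hb
  have := (hp.join ha.1.2 hq (by
    rw [Set.disjoint_left]; intro z hz hz'; exact hz' hz)).hasCycle (by omega) hb.1.1.symm
  apply hfree
  convert this using 1
  omega

end Finite

/-- A family of vertex-disjoint paths `p i 0, …, p i (2 * t)`, indexed by `i ∈ J`, in which the
first vertex of each path is adjacent to the last vertex of every other path. -/
structure IsCrown {V ι : Type*} (G : SimpleGraph V) (t : ℕ) (J : Finset ι) (p : ι → ℕ → V) :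
    Prop where
  adj : ∀ i ∈ J, ∀ a < 2 * t, G.Adj (p i a) (p i (a + 1))
  inj : ∀ i ∈ J, ∀ j ∈ J, ∀ a ≤ 2 * t, ∀ b ≤ 2 * t, p i a = p j b → i = j ∧ a = b
  cross : ∀ i ∈ J, ∀ j ∈ J, i ≠ j → G.Adj (p i 0) (p j (2 * t))

namespace IsCrown

variable {V ι : Type*} {G : SimpleGraph V} {t : ℕ} {J J' : Finset ι} {p : ι → ℕ → V}

lemma mono (h : IsCrown G t J p) (hJ : J' ⊆ J) : IsCrown G t J' p :=
  ⟨fun i hi => h.adj i (hJ hi), fun i hi j hj => h.inj i (hJ hi) j (hJ hj),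
    fun i hi j hj => h.cross i (hJ hi) j (hJ hj)⟩

lemma segment (h : IsCrown G t J p) {i : ι} (hi : i ∈ J) {a b : ℕ} (hab : a ≤ b)
    (hb : b ≤ 2 * t) : PathIn G (p i a) (p i b) (b - a) (p i '' Set.Icc a b) := by
  obtain ⟨d, rfl⟩ := Nat.exists_eq_add_of_le hab
  rw [Nat.add_sub_cancel_left]
  refine PathIn.of_seq (p i) a d (fun c _ hc => h.adj i hi c (by omega)) ?_
  intro c hc c' hc' hcc
  exact (h.inj i hi i hi c (by have := hc.2; omega) c' (by have := hc'.2; omega) hcc).2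

lemma disjoint_segments (h : IsCrown G t J p) {i j : ι} (hi : i ∈ J) (hj : j ∈ J) (hij : i ≠ j)
    {a b a' b' : ℕ} (hb : b ≤ 2 * t) (hb' : b' ≤ 2 * t) :
    Disjoint (p i '' Set.Icc a b) (p j '' Set.Icc a' b') := by
  rw [Set.disjoint_left]
  rintro _ ⟨c, hc, rfl⟩ ⟨c', hc', hcc⟩
  exact hij (h.inj j hj i hi c' (hc'.2.trans hb') c (hc.2.trans hb) hcc).1.symm

lemma disjoint_segment_singleton (h : IsCrown G t J p) {i j : ι} (hi : i ∈ J) (hj : j ∈ J)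
    (hij : i ≠ j) {a b c : ℕ} (hb : b ≤ 2 * t) (hc : c ≤ 2 * t) :
    Disjoint (p i '' Set.Icc a b) {p j c} := by
  simpa using h.disjoint_segments hi hj hij (a := a) (a' := c) hb hc

lemma update [DecidableEq ι] (h : IsCrown G t J p) {i : ι} (hi : i ∈ J) {c : ℕ} (hc : c + 1 < 2 * t)
    {u : V} (hu : G.Adj u (p i c)) (hu' : G.Adj u (p i (c + 2)))
    (hnew : ∀ j ∈ J, ∀ a ≤ 2 * t, p j a ≠ u) :
    IsCrown G t J (Function.update p i (Function.update (p i) (c + 1) u)) := by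
  refine ⟨fun j hj a ha => ?_, fun j hj j' hj' a ha b hb => ?_, fun j hj j' hj' hjj => ?_⟩
  · by_cases hji : j = i
    · subst hji
      rw [Function.update_self]
      by_cases h1 : a = c
      · subst h1
        simpa using hu.symm
      · by_cases h2 : a = c + 1
        · subst h2
          simpa using hu'
        · simpa [h1, h2] using h.adj j hj a ha
    · simpa [hji] using h.adj j hj a ha
  · have h1 := h.inj j hj j' hj' a ha b hb
    have h2 := hnew j hj a ha
    have h3 := hnew j' hj' b hb
    simp only [Function.update_apply]
    grind
  · have h1 := h.cross j hj j' hj' hjj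
    simp only [Function.update_apply]
    grind

variable {D : V → V → Prop}

lemma same_parity (h : IsCrown G t J p)
    (hD : ∀ x y m A, PathIn G x y m A → Odd m → m + 1 ≤ 2 * t → ¬ D x y)
    {i : ι} (hi : i ∈ J) {a b : ℕ} (hab : a ≤ b) (hb : b ≤ 2 * t) (hd : D (p i a) (p i b)) :
    a % 2 = b % 2 := by
  by_contra hne
  refine hD _ _ _ _ (h.segment hi hab hb) ?_ ?_ hd
  · rw [Nat.odd_iff]; omega
  · omega

lemma level_eq (h : IsCrown G t J p)
    (hD : ∀ x y m A, PathIn G x y m A → Odd m → m + 1 ≤ 2 * t → ¬ D x y)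
    (hDs : ∀ x y, D x y → D y x)
    {i j : ι} (hi : i ∈ J) (hj : j ∈ J) (hij : i ≠ j) {a b : ℕ} (ha : a ≤ 2 * t)
    (hb : b ≤ 2 * t) (hd : D (p i a) (p j b)) (hab : a % 2 = b % 2) : a = b := by
  wlog hlt : a ≤ b generalizing i j a b
  · exact (this hj hi hij.symm hb ha (hDs _ _ hd) hab.symm (by omega)).symm
  by_contra hne
  have h1 := (h.segment hi (Nat.zero_le a) ha).symm.join (h.cross i hi j hj hij)
    (h.segment hj hb le_rfl).symm (h.disjoint_segments hi hj hij ha le_rfl)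
  refine hD _ _ _ _ h1 ?_ ?_ hd
  · rw [Nat.odd_iff]; omega
  · omega

lemma level_add (h : IsCrown G t J p)
    (hD : ∀ x y m A, PathIn G x y m A → Odd m → m + 1 ≤ 2 * t → ¬ D x y)
    (hJ : 3 ≤ J.card) {i j : ι} (hi : i ∈ J) (hj : j ∈ J) (hij : i ≠ j) {a b : ℕ}
    (ha : a ≤ 2 * t) (hb : b ≤ 2 * t) (hd : D (p i a) (p j b)) (hab : a % 2 ≠ b % 2) :
    a + b + 1 = 2 * t ∨ a + b = 2 * t + 1 := by
  classical
  obtain ⟨l, hl, hli, hlj⟩ : ∃ l ∈ J, l ≠ i ∧ l ≠ j := by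
    have : ({i, j} : Finset ι).card < J.card := (Finset.card_le_two).trans_lt hJ
    obtain ⟨l, hl, hl'⟩ := Finset.exists_mem_notMem_of_card_lt_card this
    simp only [Finset.mem_insert, Finset.mem_singleton, not_or] at hl'
    exact ⟨l, hl, hl'⟩
  by_contra! hne
  rcases Nat.lt_or_ge (a + b) (2 * t) with hlt | hge
  · have h1 := ((PathIn.single (p l (2 * t))).join (h.cross j hj l hl hlj.symm).symm
      (h.segment hj (Nat.zero_le b) hb)
      (h.disjoint_segment_singleton hj hl hlj.symm hb le_rfl).symm)
    have h2 := (h.segment hi (Nat.zero_le a) ha).symm.join (h.cross i hi l hl hli.symm) h1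
      (Set.disjoint_union_right.2 ⟨h.disjoint_segment_singleton hi hl hli.symm ha le_rfl,
        h.disjoint_segments hi hj hij ha hb⟩)
    refine hD _ _ _ _ h2 ?_ ?_ hd
    · rw [Nat.odd_iff]; omega
    · omega
  · have h1 := ((PathIn.single (p l 0)).join (h.cross l hl j hj hlj)
      (h.segment hj hb le_rfl).symm
      (h.disjoint_segment_singleton hj hl hlj.symm le_rfl (Nat.zero_le _)).symm)
    have h2 := (h.segment hi ha le_rfl).join (h.cross l hl i hi hli).symm h1
      (Set.disjoint_union_right.2
        ⟨h.disjoint_segment_singleton hi hl hli.symm le_rfl (Nat.zero_le _),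
        h.disjoint_segments hi hj hij le_rfl le_rfl⟩)
    refine hD _ _ _ _ h2 ?_ ?_ hd
    · rw [Nat.odd_iff]; omega
    · omega

end IsCrown

/-- A set of labelled levels whose labels and levels are compatible, and which is larger than the
number of labels, contains two levels of one label and exactly one level of every other label. -/
lemma exists_label_two_levels {ι : Type*} [DecidableEq ι] {t : ℕ} {J : Finset ι}
    {N : Finset (ι × ℕ)} (hJ : t + 1 ≤ J.card) (hN : ∀ q ∈ N, q.1 ∈ J ∧ q.2 ≤ 2 * t)
    (h₁ : ∀ i a b, (i, a) ∈ N → (i, b) ∈ N → a % 2 = b % 2)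
    (h₂ : ∀ i j a b, (i, a) ∈ N → (j, b) ∈ N → i ≠ j → a % 2 = b % 2 → a = b)
    (h₃ : ∀ i j a b, (i, a) ∈ N → (j, b) ∈ N → i ≠ j → a % 2 ≠ b % 2 →
      a + b + 1 = 2 * t ∨ a + b = 2 * t + 1)
    (hcard : J.card < N.card) :
    ∃ i ∈ J, ∃ a, a + 2 ≤ 2 * t ∧ (i, a) ∈ N ∧ (i, a + 2) ∈ N ∧
      ∀ j ∈ J, j ≠ i → (j, 2 * t - 1 - a) ∈ N := by
  obtain ⟨i, a, b, ha, hb, hab⟩ : ∃ i a b, (i, a) ∈ N ∧ (i, b) ∈ N ∧ a < b := by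
    obtain ⟨⟨i, a⟩, ha, ⟨j, b⟩, hb, hne, hij⟩ :=
      Finset.exists_ne_map_eq_of_card_lt_of_maps_to hcard (f := Prod.fst)
        (fun q hq => (hN q hq).1)
    obtain rfl : i = j := hij
    rcases lt_trichotomy a b with h | rfl | h
    · exact ⟨i, a, b, ha, hb, h⟩
    · exact absurd rfl hne
    · exact ⟨i, b, a, hb, ha, h⟩
  have hpar := h₁ i a b ha hb
  by_cases hex : ∃ j c, (j, c) ∈ N ∧ j ≠ i
  · obtain ⟨j, c, hc, hji⟩ := hex
    have key : ∀ j c, (j, c) ∈ N → j ≠ i → c = 2 * t - 1 - a ∧ b = a + 2 ∧ a + c + 1 = 2 * t := by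
      intro j c hc hji
      have e1 := h₂ i j a c ha hc hji.symm
      have e2 := h₂ i j b c hb hc hji.symm
      have e3 := h₃ i j a c ha hc hji.symm
      have e4 := h₃ i j b c hb hc hji.symm
      omega
    obtain ⟨hc1, hb2, hc3⟩ := key j c hc hji
    have hsub : N ⊆ insert (i, a) (insert (i, a + 2)
        ((J.erase i).image fun j => (j, 2 * t - 1 - a))) := by
      rintro ⟨j', e⟩ he
      by_cases hj' : j' = i
      · subst hj'
        have e1 := h₁ j' a e ha he
        have e2 := h₂ j' j e c he hc hji.symm
        have e3 := h₃ j' j e c he hc hji.symm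
        have : e = a ∨ e = a + 2 := by omega
        rcases this with rfl | rfl <;> simp
      · have := (key j' e he hj').1
        simp [this, hj', (hN _ he).1]
    have hle : (insert (i, a) (insert (i, a + 2)
        ((J.erase i).image fun j => (j, 2 * t - 1 - a)))).card ≤ N.card := by
      have e1 := Finset.card_insert_le (i, a) (insert (i, a + 2)
        ((J.erase i).image fun j => (j, 2 * t - 1 - a)))
      have e2 := Finset.card_insert_le (i, a + 2)
        ((J.erase i).image fun j => (j, 2 * t - 1 - a))
      have e3 := Finset.card_image_le (s := J.erase i) (f := fun j => (j, 2 * t - 1 - a))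
      have hi : i ∈ J := (hN _ ha).1
      have e4 := Finset.card_erase_of_mem hi
      have e5 := Finset.card_pos.2 ⟨i, hi⟩
      omega
    have heq := Finset.eq_of_subset_of_card_le hsub hle
    subst hb2
    refine ⟨i, (hN _ ha).1, a, (hN _ hb).2, ha, hb, fun j' hj' hne => ?_⟩
    rw [heq]
    simp [hj', hne]
  · push Not at hex
    have hsub : N ⊆ (Finset.range (t + 1)).image fun e => (i, 2 * e + a % 2) := by
      rintro ⟨j, e⟩ he
      obtain rfl := hex j e he
      have e1 := h₁ j a e ha he
      have e2 := (hN _ he).2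
      rw [Finset.mem_image]
      refine ⟨e / 2, Finset.mem_range.2 (by simp only at e2; omega), ?_⟩
      rw [Prod.mk.injEq]
      exact ⟨rfl, by omega⟩
    have := (Finset.card_le_card hsub).trans Finset.card_image_le
    rw [Finset.card_range] at this
    omega

section Bypass

variable {V ι : Type*} [Fintype V] [DecidableEq V] [DecidableEq ι] {G : SimpleGraph V}
  [DecidableRel G.Adj] {t : ℕ} {J J' : Finset ι} {p : ι → ℕ → V}

/-- The vertices that can replace `p i (a + 1)` on the path `p i` and that are moreover adjacent to
the vertex on level `2 * t - 1 - a` of every other path. -/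
def bypassSet (G : SimpleGraph V) [DecidableRel G.Adj] (t : ℕ) (J : Finset ι) (p : ι → ℕ → V)
    (i : ι) (a : ℕ) : Finset V :=
  Finset.univ.filter fun u => G.Adj u (p i a) ∧ G.Adj u (p i (a + 2)) ∧
    ∀ j ∈ J, j ≠ i → G.Adj u (p j (2 * t - 1 - a))

lemma le_codegree_of_le_card_bypassSet {M i a j l} (h : M ≤ (bypassSet G t J p i a).card)
    (hj : j ∈ J) (hji : j ≠ i) (hl : l ∈ J) (hli : l ≠ i) :
    M ≤ (G.neighborFinset (p j (2 * t - 1 - a)) ∩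
      G.neighborFinset (p l (2 * t - 1 - a))).card := by
  refine h.trans (Finset.card_le_card fun u hu => ?_)
  obtain ⟨-, -, hu⟩ := (Finset.mem_filter.1 hu).2
  simpa using ⟨(hu j hj hji).symm, (hu l hl hli).symm⟩

lemma IsCrown.exists_large_bypassSet {M M' B L : ℕ} (h : IsCrown G t J p)
    (hD : ∀ x y m A, PathIn G x y m A → Odd m → m + 1 ≤ 2 * t →
      ¬ M ≤ (G.neighborFinset x ∩ G.neighborFinset y).card)
    (hdeg : ∀ v, Fintype.card V + B ≤ (2 * t + 1) * G.degree v)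
    (hJ : t + 2 ≤ J.card) (ht : 1 ≤ t) (hL : J.card * (2 * t + 1) ≤ L)
    (hB : (2 * t + 1) * (L * L * M + L * M') < B) :
    ∃ i ∈ J, ∃ a, a + 2 ≤ 2 * t ∧ M' ≤ (bypassSet G t J p i a).card := by
  by_contra! hcon
  set X := J ×ˢ Finset.range (2 * t + 1) with hX
  have hXc : X.card = J.card * (2 * t + 1) := by simp [hX]
  let bad : Finset V := (X ×ˢ X).biUnion fun q =>
    if (G.neighborFinset (p q.1.1 q.1.2) ∩ G.neighborFinset (p q.2.1 q.2.2)).card < M then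
      G.neighborFinset (p q.1.1 q.1.2) ∩ G.neighborFinset (p q.2.1 q.2.2) else ∅
  let exc : Finset V := X.biUnion fun q =>
    if q.2 + 2 ≤ 2 * t then bypassSet G t J p q.1 q.2 else ∅
  let N : V → Finset (ι × ℕ) := fun u => X.filter fun q => G.Adj (p q.1 q.2) u
  have hbad : bad.card ≤ L * L * M := by
    refine (Finset.card_biUnion_le_card_mul _ _ M fun q _ => ?_).trans ?_
    · split_ifs with hq
      · exact hq.le
      · simp
    · rw [Finset.card_product, hXc]
      exact Nat.mul_le_mul_right _ (Nat.mul_le_mul hL hL)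
  have hexc : exc.card ≤ L * M' := by
    refine (Finset.card_biUnion_le_card_mul _ _ M' fun q hq => ?_).trans ?_
    · split_ifs with hq'
      · exact (hcon q.1 (Finset.mem_product.1 hq).1 q.2 hq').le
      · simp
    · rw [hXc]
      exact Nat.mul_le_mul_right _ hL
  have hgood : ∀ u, u ∉ bad ∪ exc → (N u).card ≤ J.card := by
    intro u hu
    rw [Finset.mem_union, not_or] at hu
    by_contra! hlt
    have hmem : ∀ i a, (i, a) ∈ N u ↔ (i ∈ J ∧ a ≤ 2 * t) ∧ G.Adj (p i a) u := by
      intro i a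
      simp [N, hX]
    have hd : ∀ i a j b, (i, a) ∈ N u → (j, b) ∈ N u →
        M ≤ (G.neighborFinset (p i a) ∩ G.neighborFinset (p j b)).card := by
      intro i a j b ha hb
      by_contra! hlt'
      refine hu.1 (Finset.mem_biUnion.2 ⟨((i, a), (j, b)), Finset.mem_product.2
        ⟨(Finset.mem_filter.1 ha).1, (Finset.mem_filter.1 hb).1⟩, ?_⟩)
      rw [if_pos hlt']
      simpa using ⟨((hmem i a).1 ha).2, ((hmem j b).1 hb).2⟩
    obtain ⟨i, hi, a, hat, ha, ha2, hoth⟩ := exists_label_two_levels (N := N u) (t := t) (J := J)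
      (by omega) (fun q hq => ((hmem q.1 q.2).1 hq).1)
      (fun i a b ha hb => by
        wlog hab : a ≤ b generalizing a b
        · exact (this b a hb ha (by omega)).symm
        · exact h.same_parity (D := fun x y => M ≤
            (G.neighborFinset x ∩ G.neighborFinset y).card) hD ((hmem i a).1 ha).1.1 hab
            ((hmem i b).1 hb).1.2 (hd i a i b ha hb))
      (fun i j a b ha hb hij hab => h.level_eq (D := fun x y => M ≤
            (G.neighborFinset x ∩ G.neighborFinset y).card) hD
            (fun x y hxy => by rwa [Finset.inter_comm]) ((hmem i a).1 ha).1.1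
            ((hmem j b).1 hb).1.1 hij ((hmem i a).1 ha).1.2 ((hmem j b).1 hb).1.2
            (hd i a j b ha hb) hab)
      (fun i j a b ha hb hij hab => h.level_add (D := fun x y => M ≤
            (G.neighborFinset x ∩ G.neighborFinset y).card) hD (by omega) ((hmem i a).1 ha).1.1
            ((hmem j b).1 hb).1.1 hij ((hmem i a).1 ha).1.2 ((hmem j b).1 hb).1.2
            (hd i a j b ha hb) hab) hlt
    refine hu.2 (Finset.mem_biUnion.2 ⟨(i, a), (Finset.mem_filter.1 ha).1, ?_⟩)
    rw [if_pos hat]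
    exact Finset.mem_filter.2 ⟨Finset.mem_univ _, ((hmem _ _).1 ha).2.symm,
      ((hmem _ _).1 ha2).2.symm, fun j hj hji => ((hmem _ _).1 (hoth j hj hji)).2.symm⟩
  have hsum : ∑ q ∈ X, G.degree (p q.1 q.2) = ∑ u, (N u).card := by
    have := Finset.sum_card_bipartiteAbove_eq_sum_card_bipartiteBelow (s := X)
      (t := (Finset.univ : Finset V)) (fun q u => G.Adj (p q.1 q.2) u)
    refine Eq.trans (Finset.sum_congr rfl fun q _ => ?_) this
    rw [← card_neighborFinset_eq_degree]
    congr 1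
    ext u
    simp [Finset.mem_bipartiteAbove]
  have hupper : ∑ u, (N u).card ≤ J.card * Fintype.card V + X.card * (L * L * M + L * M') := by
    have h1 : ∀ u, (N u).card ≤ J.card + if u ∈ bad ∪ exc then X.card else 0 := by
      intro u
      split_ifs with hu
      · exact (Finset.card_filter_le _ _).trans (Nat.le_add_left _ _)
      · exact hgood u hu
    refine (Finset.sum_le_sum fun u _ => h1 u).trans ?_
    rw [Finset.sum_add_distrib, Finset.sum_const, Finset.sum_ite_mem, Finset.univ_inter,
      Finset.sum_const, smul_eq_mul, smul_eq_mul, Finset.card_univ,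
      mul_comm (Fintype.card V), mul_comm _ X.card]
    have h2 := Finset.card_union_le bad exc
    exact Nat.add_le_add_left (Nat.mul_le_mul_left _ (by omega)) _
  have hlower : X.card * (Fintype.card V + B) ≤ (2 * t + 1) * ∑ q ∈ X, G.degree (p q.1 q.2) := by
    rw [Finset.mul_sum, ← smul_eq_mul]
    exact Finset.card_nsmul_le_sum _ _ _ fun q _ => hdeg _
  have hpos : 0 < X.card := by rw [hXc]; exact Nat.mul_pos (by omega) (by omega)
  rw [hsum] at hlower
  have h1 := hlower.trans (Nat.mul_le_mul_left _ hupper)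
  have h2 : X.card * B ≤ X.card * ((2 * t + 1) * (L * L * M + L * M')) := by
    have h3 : X.card * Fintype.card V = (2 * t + 1) * (J.card * Fintype.card V) := by
      rw [hXc]; ring
    have h4 : (2 * t + 1) * (X.card * (L * L * M + L * M')) =
      X.card * ((2 * t + 1) * (L * L * M + L * M')) := by ring
    rw [mul_add, mul_add, h3, h4] at h1
    exact Nat.le_of_add_le_add_left h1
  exact absurd (Nat.le_of_mul_le_mul_left h2 hpos) (not_le.2 hB)

lemma IsCrown.codegree_lt_of_le_card_bypassSet {M M' i j a} (h : IsCrown G t J p)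
    (hD : ∀ x y m A, PathIn G x y m A → Odd m → m + 1 ≤ 2 * t →
      ¬ M ≤ (G.neighborFinset x ∩ G.neighborFinset y).card)
    (hM' : 2 * (2 * t + 1) < M') (hi : i ∈ J) (hj : j ∈ J) (hji : j ≠ i) (ha : a + 2 ≤ 2 * t)
    (hat : a ≠ t - 1) (hlarge : M' ≤ (bypassSet G t J p i a).card) :
    ¬ M ≤ (G.neighborFinset (p j (2 * t - 1 - a)) ∩
      G.neighborFinset (p i (2 * t - 1 - a))).card := by
  obtain ⟨u, hu, hnew⟩ : ∃ u ∈ bypassSet G t J p i a,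
      u ∉ ({i, j} ×ˢ Finset.range (2 * t + 1)).image fun q : ι × ℕ => p q.1 q.2 := by
    refine Finset.exists_mem_notMem_of_card_lt_card (lt_of_le_of_lt ?_ (hM'.trans_le hlarge))
    refine Finset.card_image_le.trans ?_
    rw [Finset.card_product, Finset.card_range]
    exact Nat.mul_le_mul_right _ Finset.card_le_two
  have hui : ∀ c ≤ 2 * t, p i c ≠ u := fun c hc hcu => hnew (Finset.mem_image.2
    ⟨(i, c), by simpa [Nat.lt_succ_iff] using hc, hcu⟩)
  have huj : p j (2 * t - 1 - a) ≠ u := fun hcu => hnew (Finset.mem_image.2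
    ⟨(j, 2 * t - 1 - a), by simp; omega, hcu⟩)
  obtain ⟨hu1, hu2, hu3⟩ := (Finset.mem_filter.1 hu).2
  have h1 := (PathIn.single (p j (2 * t - 1 - a))).join (hu3 j hj hji).symm (PathIn.single u)
    (by simpa using huj)
  have hdisj : ∀ b b', b' ≤ 2 * t →
      Disjoint ({p j (2 * t - 1 - a)} ∪ {u}) (p i '' Set.Icc b b') := by
    intro b b' hb'
    refine Set.disjoint_union_left.2 ⟨(h.disjoint_segment_singleton hi hj hji.symm hb'
      (by omega)).symm, ?_⟩
    rw [Set.disjoint_singleton_left]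
    rintro ⟨c, hc, hcu⟩
    exact hui c (hc.2.trans hb') hcu
  rcases Nat.lt_or_ge (2 * t - 1 - a) (a + 2) with hlt | hge
  · refine hD _ _ _ _ (h1.join hu1 (h.segment hi (a := 2 * t - 1 - a) (b := a) (by omega)
      (by omega)).symm (hdisj _ _ (by omega))) ?_ ?_
    · rw [Nat.odd_iff]; omega
    · omega
  · refine hD _ _ _ _ (h1.join hu2 (h.segment hi (a := a + 2) hge (by omega))
      (hdisj _ _ (by omega))) ?_ ?_
    · rw [Nat.odd_iff]; omega
    · omega

/-- A level can be bypassed on a large part of a crown only if it is the middle level, up to few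
exceptions. -/
lemma IsCrown.exists_middle_bypassSet {M M' d : ℕ} (h : IsCrown G t J p)
    (hD : ∀ x y m A, PathIn G x y m A → Odd m → m + 1 ≤ 2 * t →
      ¬ M ≤ (G.neighborFinset x ∩ G.neighborFinset y).card)
    (hexc : ∀ J' ⊆ J, t + 2 ≤ J'.card → ∃ i ∈ J', ∃ a, a + 2 ≤ 2 * t ∧
      M' ≤ (bypassSet G t J' p i a).card)
    (hM : M ≤ M') (hM' : 2 * (2 * t + 1) < M')
    (T : Finset ℕ) (hT : ∀ a ∈ T, ∀ i ∈ J, ∀ j ∈ J, j ≠ i →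
      M ≤ (G.neighborFinset (p j (2 * t - 1 - a)) ∩
        G.neighborFinset (p i (2 * t - 1 - a))).card)
    (hs : (((Finset.range (2 * t - 1)).erase (t - 1)) \ T).card = d)
    (hJ : t + 2 + d ≤ J.card) :
    ∃ J' ⊆ J, J.card ≤ J'.card + d ∧ ∃ i ∈ J', M' ≤ (bypassSet G t J' p i (t - 1)).card := by
  induction d generalizing J T with
  | zero =>
    obtain ⟨i, hi, a, ha, hlarge⟩ := hexc J subset_rfl (by omega)
    refine ⟨J, subset_rfl, le_rfl, i, hi, ?_⟩
    by_cases hat : a = t - 1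
    · exact hat ▸ hlarge
    have haT : a ∈ T := by
      rw [Finset.card_eq_zero, Finset.sdiff_eq_empty_iff_subset] at hs
      exact hs (by simp; omega)
    obtain ⟨j, hj, hji⟩ := Finset.exists_mem_ne (by omega : 1 < J.card) i
    exact absurd (hT a haT i hi j hj hji)
      (h.codegree_lt_of_le_card_bypassSet hD hM' hi hj hji ha hat hlarge)
  | succ d ih =>
    obtain ⟨i, hi, a, ha, hlarge⟩ := hexc J subset_rfl (by omega)
    by_cases hat : a = t - 1
    · exact ⟨J, subset_rfl, by omega, i, hi, hat ▸ hlarge⟩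
    have haT : a ∉ T := by
      intro haT
      obtain ⟨j, hj, hji⟩ := Finset.exists_mem_ne (by omega : 1 < J.card) i
      exact h.codegree_lt_of_le_card_bypassSet hD hM' hi hj hji ha hat hlarge
        (hT a haT i hi j hj hji)
    have hcard := Finset.card_erase_of_mem hi
    have hmem : a ∈ ((Finset.range (2 * t - 1)).erase (t - 1)) \ T := by
      simp [hat, haT]
      omega
    have hT' : ∀ b ∈ insert a T, ∀ l ∈ J.erase i, ∀ j ∈ J.erase i, j ≠ l →
        M ≤ (G.neighborFinset (p j (2 * t - 1 - b)) ∩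
          G.neighborFinset (p l (2 * t - 1 - b))).card := by
      intro b hb l hl j hj hjl
      rw [Finset.mem_erase] at hl hj
      rcases Finset.mem_insert.1 hb with rfl | hb
      · exact le_codegree_of_le_card_bypassSet (hM.trans hlarge) hj.2 hj.1 hl.2 hl.1
      · exact hT b hb l hl.2 j hj.2 hjl
    obtain ⟨J', hJ', hc, i', hi', hl'⟩ := ih (J := J.erase i) (h.mono (Finset.erase_subset _ _))
      (fun J' hJ' => hexc J' (hJ'.trans (Finset.erase_subset _ _))) (insert a T) hT'
      (by rw [Finset.sdiff_insert, Finset.card_erase_of_mem hmem, hs, Nat.add_sub_cancel])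
      (by omega)
    exact ⟨J', hJ'.trans (Finset.erase_subset _ _), by omega, i', hi', hl'⟩

end Bypass

section NoCrown

variable {V ι : Type*} [Fintype V] [DecidableEq V] [DecidableEq ι] {G : SimpleGraph V}
  [DecidableRel G.Adj] {t M M' C : ℕ}

lemma IsCrown.exists_middle {J : Finset ι} {p : ι → ℕ → V} (h : IsCrown G t J p)
    (hD : ∀ x y m A, PathIn G x y m A → Odd m → m + 1 ≤ 2 * t →
      ¬ M ≤ (G.neighborFinset x ∩ G.neighborFinset y).card)
    (hexc : ∀ (J : Finset ι) (p : ι → ℕ → V), IsCrown G t J p → t + 2 ≤ J.card → J.card ≤ C →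
      ∃ i ∈ J, ∃ a, a + 2 ≤ 2 * t ∧ M' ≤ (bypassSet G t J p i a).card)
    (hM : M ≤ M') (hM' : 2 * (2 * t + 1) < M') (ht : 1 ≤ t)
    (hJ : 3 * t ≤ J.card) (hJC : J.card ≤ C) :
    ∃ J' ⊆ J, J.card ≤ J'.card + (2 * t - 2) ∧
      ∃ i ∈ J', M' ≤ (bypassSet G t J' p i (t - 1)).card := by
  refine h.exists_middle_bypassSet hD
    (fun J' hJ' hc => hexc J' p (h.mono hJ') hc ((Finset.card_le_card hJ').trans hJC))
    hM hM' ∅ (by simp) ?_ (by omega)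
  rw [Finset.sdiff_empty, Finset.card_erase_of_mem (by simp; omega), Finset.card_range]
  omega

/-- In a large crown, the middle levels can be modified so that many of them become adjacent to
many others. -/
lemma IsCrown.exists_middle_join {J : Finset ι} {p : ι → ℕ → V} (h : IsCrown G t J p)
    (hD : ∀ x y m A, PathIn G x y m A → Odd m → m + 1 ≤ 2 * t →
      ¬ M ≤ (G.neighborFinset x ∩ G.neighborFinset y).card)
    (hexc : ∀ (J : Finset ι) (p : ι → ℕ → V), IsCrown G t J p → t + 2 ≤ J.card → J.card ≤ C →
      ∃ i ∈ J, ∃ a, a + 2 ≤ 2 * t ∧ M' ≤ (bypassSet G t J p i a).card)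
    (hM : M ≤ M') (hM' : C * (2 * t + 1) < M') (hC : 2 ≤ C) (ht : 1 ≤ t) (hJC : J.card ≤ C)
    (m : ℕ) (hm : m * (2 * t - 1) + 3 * t ≤ J.card) :
    ∃ (I₁ J₁ : Finset ι) (q : ι → ℕ → V), Disjoint I₁ J₁ ∧ I₁ ∪ J₁ ⊆ J ∧ I₁.card = m ∧
      J.card ≤ J₁.card + m * (2 * t - 1) ∧ IsCrown G t (I₁ ∪ J₁) q ∧
      ∀ i ∈ I₁, ∀ j ∈ J₁, G.Adj (q i t) (q j t) := by
  induction m with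
  | zero => exact ⟨∅, J, p, by simp, by simp, rfl, by simp, by simpa using h, by simp⟩
  | succ m ih =>
    rw [Nat.succ_mul] at hm ⊢
    obtain ⟨I₁, J₁, q, hdis, hsub, hI, hJ₁, hq, hadj⟩ := ih (by omega)
    have hM2 : 2 * (2 * t + 1) < M' := (Nat.mul_le_mul_right _ hC).trans_lt hM'
    have hJ₁C : J₁.card ≤ C :=
      (Finset.card_le_card (Finset.subset_union_right.trans hsub)).trans hJC
    obtain ⟨J', hJ', hc, i, hi, hl⟩ := (hq.mono Finset.subset_union_right).exists_middle hD hexc hM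
      hM2 ht (by omega) hJ₁C
    obtain ⟨u, hu, hnew⟩ : ∃ u ∈ bypassSet G t J' q i (t - 1),
        u ∉ ((I₁ ∪ J₁) ×ˢ Finset.range (2 * t + 1)).image fun q' : ι × ℕ => q q'.1 q'.2 := by
      refine Finset.exists_mem_notMem_of_card_lt_card (lt_of_le_of_lt ?_ (hM'.trans_le hl))
      refine Finset.card_image_le.trans ?_
      rw [Finset.card_product, Finset.card_range]
      exact Nat.mul_le_mul_right _ ((Finset.card_le_card hsub).trans hJC)
    obtain ⟨hu1, hu2, hu3⟩ := (Finset.mem_filter.1 hu).2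
    have hiJ : i ∈ J₁ := hJ' hi
    have hiI : i ∉ I₁ := Finset.disjoint_right.1 hdis hiJ
    have hcrown := hq.update (Finset.mem_union_right _ hiJ) (c := t - 1) (by omega) hu1 hu2
      (fun j hj a ha hau => hnew (Finset.mem_image.2
        ⟨(j, a), Finset.mem_product.2 ⟨hj, by simp; omega⟩, hau⟩))
    rw [Nat.sub_add_cancel ht] at hcrown
    have hsub' : insert i I₁ ∪ J'.erase i ⊆ I₁ ∪ J₁ := by
      intro x hx
      simp only [Finset.mem_union, Finset.mem_insert, Finset.mem_erase] at hx ⊢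
      rcases hx with (rfl | hx) | hx
      · exact Or.inr hiJ
      · exact Or.inl hx
      · exact Or.inr (hJ' hx.2)
    refine ⟨insert i I₁, J'.erase i, _, ?_, hsub'.trans hsub, by
      rw [Finset.card_insert_of_notMem hiI, hI], ?_, hcrown.mono hsub', ?_⟩
    · rw [Finset.disjoint_insert_left]
      exact ⟨Finset.notMem_erase _ _,
        hdis.mono_right ((Finset.erase_subset _ _).trans hJ')⟩
    · rw [Finset.card_erase_of_mem hi]
      omega
    · intro i' hi' j hj
      rw [Finset.mem_erase] at hj
      rw [Function.update_of_ne hj.1]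
      rcases Finset.mem_insert.1 hi' with rfl | hmem
      · have := hu3 j hj.2 hj.1
        rw [show 2 * t - 1 - (t - 1) = t by omega] at this
        simpa using this
      · rw [Function.update_of_ne (by rintro rfl; exact hiI hmem)]
        exact hadj i' hmem j (hJ' hj.2)

lemma IsCrown.card_lt {J : Finset ι} {p : ι → ℕ → V} (h : IsCrown G t J p)
    (hD : ∀ x y m A, PathIn G x y m A → Odd m → m + 1 ≤ 2 * t →
      ¬ M ≤ (G.neighborFinset x ∩ G.neighborFinset y).card)
    (hexc : ∀ (J : Finset ι) (p : ι → ℕ → V), IsCrown G t J p → t + 2 ≤ J.card →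
      J.card ≤ 4 * t ^ 2 + t + 2 →
      ∃ i ∈ J, ∃ a, a + 2 ≤ 2 * t ∧ M' ≤ (bypassSet G t J p i a).card)
    (hM : M ≤ M') (hM' : (4 * t ^ 2 + t + 2) * (2 * t + 1) < M') (ht : 1 ≤ t) :
    J.card < 4 * t ^ 2 + t + 2 := by
  by_contra! hlt
  obtain ⟨J₀, hJ₀, hJ₀c⟩ := Finset.exists_subset_card_eq hlt
  have hC : 2 * t * (2 * t - 1) + 3 * t + 2 = 4 * t ^ 2 + t + 2 := by
    obtain ⟨s, rfl⟩ := Nat.exists_eq_add_of_le' ht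
    rw [show 2 * (s + 1) - 1 = 2 * s + 1 by omega]
    ring
  obtain ⟨I₁, J₁, q, hdis, hsub, hI, hJ₁, hq, hadj⟩ := (h.mono hJ₀).exists_middle_join hD hexc hM
    hM' (by omega) ht hJ₀c.le (2 * t) (by omega)
  have hcard := Finset.card_union_of_disjoint hdis
  obtain ⟨J', hJ', hc, i, hi, hl⟩ := hq.exists_middle hD hexc hM
    ((Nat.mul_le_mul_right _ (by omega)).trans_lt hM') ht (by omega)
    ((Finset.card_le_card hsub).trans hJ₀c.le)
  have hsd : ((I₁ ∪ J₁) \ J').card ≤ 2 * t - 2 := by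
    rw [Finset.card_sdiff_of_subset hJ']
    omega
  have key : ∀ K ⊆ I₁ ∪ J₁, 2 * t ≤ K.card → ∃ j ∈ K, j ∈ J' ∧ j ≠ i := by
    intro K hK hKc
    have h1 : (insert i ((I₁ ∪ J₁) \ J')).card < K.card :=
      (Finset.card_insert_le _ _).trans_lt (by omega)
    obtain ⟨j, hj, hj'⟩ := Finset.exists_mem_notMem_of_card_lt_card h1
    simp only [Finset.mem_insert, Finset.mem_sdiff, not_or, not_and, not_not] at hj'
    exact ⟨j, hj, hj'.2 (hK hj), hj'.1⟩
  obtain ⟨j, hj, hjJ, hji⟩ := key I₁ Finset.subset_union_left hI.ge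
  obtain ⟨l, hl1, hlJ, hli⟩ := key J₁ Finset.subset_union_right (by omega)
  have hd := le_codegree_of_le_card_bypassSet (hM.trans hl) hjJ hji hlJ hli
  rw [show 2 * t - 1 - (t - 1) = t by omega] at hd
  have hp := (PathIn.single (q j t)).join (hadj j hj l hl1) (PathIn.single (q l t))
    (by simpa using (hadj j hj l hl1).ne)
  exact hD _ _ _ _ hp (by decide) (by omega) hd

end NoCrown

/-- Pairs of disjoint sets of bounded total size which cross pairwise are few. -/
lemma card_le_two_pow_of_cross_intersecting {V ι : Type*} [Fintype V] [DecidableEq V]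
    {T : Finset ι} {X Y : ι → Finset V} {m : ℕ} (hdis : ∀ i ∈ T, Disjoint (X i) (Y i))
    (hcross : ∀ i ∈ T, ∀ j ∈ T, i ≠ j → ¬ Disjoint (X i) (Y j))
    (hcard : ∀ i ∈ T, (X i).card + (Y i).card ≤ m) : T.card ≤ 2 ^ m := by
  have hE : ∀ i ∈ T, 2 ^ Fintype.card V ≤ 2 ^ m * (Finset.Icc (X i) (Y i)ᶜ).card := by
    intro i hi
    have hsub : X i ⊆ (Y i)ᶜ := Finset.subset_compl_iff_disjoint_right.2 (hdis i hi)
    rw [Finset.card_Icc_finset hsub, Finset.card_compl, ← pow_add]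
    refine Nat.pow_le_pow_right (by norm_num) ?_
    have := hcard i hi
    omega
  have hpd : (T : Set ι).PairwiseDisjoint fun i => Finset.Icc (X i) (Y i)ᶜ := by
    intro i hi j hj hij
    rw [Function.onFun, Finset.disjoint_left]
    intro R hR hR'
    rw [Finset.mem_Icc] at hR hR'
    exact hcross i hi j hj hij (Finset.subset_compl_iff_disjoint_right.1 (hR.1.trans hR'.2))
  have hle : ∑ i ∈ T, (Finset.Icc (X i) (Y i)ᶜ).card ≤ 2 ^ Fintype.card V := by
    rw [← Finset.card_biUnion hpd, ← Fintype.card_finset]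
    exact Finset.card_le_univ _
  have h1 := Finset.card_nsmul_le_sum T _ _ hE
  rw [← Finset.mul_sum, smul_eq_mul] at h1
  exact Nat.le_of_mul_le_mul_right (h1.trans (Nat.mul_le_mul_left _ hle)) (by positivity)

section Selection

variable {V ι : Type*} {G : SimpleGraph V} {t : ℕ} {p : ι → ℕ → V}

/-- Paths of length `2 * t` which all have the same vertex on a given level, and such that the
first vertex of each is adjacent to the last vertex of every other one, are few. -/
lemma card_le_of_common_vertex [Fintype V] [DecidableEq V] {T : Finset ι} (ht : 1 ≤ t)
    (hfree : ¬ HasCycleOfLength G (2 * t + 1))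
    (hadj : ∀ i ∈ T, ∀ a < 2 * t, G.Adj (p i a) (p i (a + 1)))
    (hinj : ∀ i ∈ T, Set.InjOn (p i) (Set.Iic (2 * t)))
    (hcross : ∀ i ∈ T, ∀ j ∈ T, i ≠ j → G.Adj (p i 0) (p j (2 * t)))
    {a : ℕ} (ha : a ≤ 2 * t) {y : V} (hy : ∀ i ∈ T, p i a = y) : T.card ≤ 2 ^ (2 * t) := by
  refine card_le_two_pow_of_cross_intersecting (X := fun i => (Finset.range a).image (p i))
    (Y := fun i => (Finset.Ioc a (2 * t)).image (p i)) ?_ ?_ ?_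
  · intro i hi
    rw [Finset.disjoint_left]
    intro v hv hv'
    obtain ⟨c, hc, rfl⟩ := Finset.mem_image.1 hv
    obtain ⟨e, he, hce⟩ := Finset.mem_image.1 hv'
    rw [Finset.mem_range] at hc
    rw [Finset.mem_Ioc] at he
    have := hinj i hi (by simpa using he.2) (by simp; omega) hce
    omega
  · intro i hi j hj hij hdis
    have h1 := PathIn.of_seq (p i) 0 a (fun c _ hc => hadj i hi c (by omega))
      ((hinj i hi).mono fun c hc => by have := hc.2; simp; omega)
    rw [Nat.zero_add] at h1
    rcases ha.eq_or_lt with rfl | hlt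
    · rw [hy i hi, ← hy j hj] at h1
      exact hfree (h1.hasCycle (by omega) (hcross i hi j hj hij).symm)
    · obtain ⟨d, hd⟩ := Nat.exists_eq_add_of_lt hlt
      have h2 := PathIn.of_seq (p j) (a + 1) d (fun c _ hc => hadj j hj c (by omega))
        ((hinj j hj).mono fun c hc => by have := hc.2; simp; omega)
      have e : G.Adj (p i a) (p j (a + 1)) := by
        rw [hy i hi, ← hy j hj]
        exact hadj j hj a hlt
      have h3 := h1.join e h2 ?_
      · rw [show a + 1 + d = 2 * t by omega, show a + d + 1 = 2 * t by omega] at h3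
        exact hfree (h3.hasCycle (by omega) (hcross i hi j hj hij).symm)
      · rw [Set.disjoint_left]
        rintro _ ⟨c, hc, rfl⟩ ⟨e, he, hce⟩
        have he1 := he.1
        have he2 := he.2
        rcases hc.2.eq_or_lt with rfl | hc'
        · rw [hy i hi, ← hy j hj] at hce
          have := hinj j hj (by simp; omega) (by simp; omega) hce
          omega
        · refine Finset.disjoint_left.1 hdis (Finset.mem_image_of_mem _ (Finset.mem_range.2 hc'))
            (Finset.mem_image.2 ⟨e, Finset.mem_Ioc.2 ⟨by omega, by omega⟩, hce⟩)
  · intro i _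
    have h1 := Finset.card_image_le (s := Finset.range a) (f := p i)
    have h2 := Finset.card_image_le (s := Finset.Ioc a (2 * t)) (f := p i)
    rw [Finset.card_range] at h1
    rw [Nat.card_Ioc] at h2
    omega

lemma card_le_of_isCrown_card_le [Fintype V] [DecidableEq V] [DecidableEq ι] {I : Finset ι}
    {C : ℕ} (ht : 1 ≤ t) (hfree : ¬ HasCycleOfLength G (2 * t + 1))
    (hadj : ∀ i ∈ I, ∀ a < 2 * t, G.Adj (p i a) (p i (a + 1)))
    (hinj : ∀ i ∈ I, Set.InjOn (p i) (Set.Iic (2 * t)))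
    (hcross : ∀ i ∈ I, ∀ j ∈ I, i ≠ j → G.Adj (p i 0) (p j (2 * t)))
    (hC : ∀ J : Finset ι, IsCrown G t J p → J.card ≤ C) :
    I.card ≤ 2 ^ (2 * t) * (C * (2 * t + 1) * (2 * t + 1)) := by
  classical
  obtain ⟨J, hJ, hmax⟩ := (I.powerset.filter fun J => IsCrown G t J p).exists_max_image Finset.card
    ⟨∅, by simpa using ⟨by simp, by simp, by simp⟩⟩
  rw [Finset.mem_filter, Finset.mem_powerset] at hJ
  have hex : ∀ i ∈ I, ∃ q ∈ (J ×ˢ Finset.range (2 * t + 1)) ×ˢ Finset.range (2 * t + 1),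
      p i q.2 = p q.1.1 q.1.2 := by
    intro i hi
    by_contra! hcon
    have hcon' : ∀ j ∈ J, ∀ a ≤ 2 * t, ∀ b ≤ 2 * t, p i a ≠ p j b := fun j hj a ha b hb =>
      hcon ((j, b), a) (by simp [hj]; omega)
    have hiJ : i ∉ J := fun hiJ => hcon' i hiJ 0 (Nat.zero_le _) 0 (Nat.zero_le _) rfl
    have hsub : insert i J ⊆ I := Finset.insert_subset hi hJ.1
    have := hmax (insert i J) (Finset.mem_filter.2 ⟨Finset.mem_powerset.2 hsub,
      fun j hj => hadj j (hsub hj), ?_, fun j hj l hl => hcross j (hsub hj) l (hsub hl)⟩)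
    · rw [Finset.card_insert_of_notMem hiJ] at this
      omega
    · intro j hj l hl a ha b hb hab
      rcases Finset.mem_insert.1 hj with rfl | hj <;> rcases Finset.mem_insert.1 hl with rfl | hl
      · exact ⟨rfl, hinj _ hi ha hb hab⟩
      · exact absurd hab (hcon' l hl a ha b hb)
      · exact absurd hab.symm (hcon' j (by assumption) b hb a ha)
      · exact hJ.2.inj j (by assumption) l (by assumption) a ha b hb hab
  choose! f hf hfp using hex
  have hle := Finset.card_le_mul_card_image_of_maps_to hf (2 ^ (2 * t)) (fun q hq => by
    have hsub : ∀ i ∈ I.filter (fun i => f i = q), i ∈ I := fun i hi => (Finset.mem_filter.1 hi).1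
    refine card_le_of_common_vertex (p := p) (a := q.2) (y := p q.1.1 q.1.2) ht hfree
      (fun i hi => hadj i (hsub i hi)) (fun i hi => hinj i (hsub i hi))
      (fun i hi j hj => hcross i (hsub i hi) j (hsub j hj)) ?_ ?_
    · have := (Finset.mem_product.1 hq).2
      rw [Finset.mem_range] at this
      omega
    · intro i hi
      have h1 := hfp i (hsub i hi)
      rwa [(Finset.mem_filter.1 hi).2] at h1)
  rw [Finset.card_product, Finset.card_product, Finset.card_range] at hle
  refine hle.trans (Nat.mul_le_mul_left _ ?_)
  exact Nat.mul_le_mul_right _ (Nat.mul_le_mul_right _ (hC J hJ.2))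

lemma exists_adjacent_except_one {S : Set V} (hS : Shattered G S) {x₀ x : V} (hx₀ : x₀ ∈ S)
    (hx : x ∈ S) (hne : x ≠ x₀) :
    ∃ v, v ≠ x ∧ ¬ G.Adj x v ∧ ∀ y ∈ S, y ≠ x₀ → y ≠ x → G.Adj v y := by
  obtain ⟨v, hv⟩ := hS (S \ {x}) Set.sdiff_subset
  obtain ⟨w, hw⟩ := hS (S \ {x, x₀}) Set.sdiff_subset
  simp only [Set.ext_iff, Set.mem_inter_iff, mem_neighborSet, Set.mem_sdiff, Set.mem_insert_iff,
    Set.mem_singleton_iff] at hv hw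
  by_cases hvx : v = x
  · refine ⟨w, ?_, ?_, ?_⟩
    · rintro rfl
      have h1 := hv x₀
      have h2 := hw x₀
      subst hvx
      simp_all [eq_comm]
    · intro h
      have := hw x
      simp_all [G.adj_comm]
    · intro y hy h1 h2
      have := hw y
      simp_all
  · refine ⟨v, hvx, ?_, ?_⟩
    · intro h
      have := hv x
      simp_all [G.adj_comm]
    · intro y hy h1 h2
      have := hv y
      simp_all

lemma PathIn.exists_seq {x y : V} {m : ℕ} {A : Set V} (h : PathIn G x y m A) :
    ∃ q : ℕ → V, q 0 = x ∧ q m = y ∧ (∀ a < m, G.Adj (q a) (q (a + 1))) ∧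
      Set.InjOn q (Set.Iic m) := by
  obtain ⟨w, h1, rfl, -⟩ := h
  exact ⟨w.getVert, w.getVert_zero, w.getVert_length, fun a ha => w.adj_getVert_succ ha,
    h1.getVert_injOn⟩

lemma Shattered.ncard_le [Fintype V] {S : Set V} {C : ℕ} (hS : Shattered G S) (ht : 1 ≤ t)
    (hG : MaximalCLFree G (2 * t + 1))
    (hC : ∀ (J : Finset V) (p : V → ℕ → V), IsCrown G t J p → J.card ≤ C) :
    S.ncard ≤ 2 ^ (2 * t) * (C * (2 * t + 1) * (2 * t + 1)) + 1 := by
  classical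
  rcases S.eq_empty_or_nonempty with rfl | ⟨x₀, hx₀⟩
  · simp
  have hex : ∀ x ∈ S \ {x₀}, ∃ q : ℕ → V, (∀ a < 2 * t, G.Adj (q a) (q (a + 1))) ∧
      Set.InjOn q (Set.Iic (2 * t)) ∧ q (2 * t) = x ∧
      ∀ y ∈ S \ {x₀}, x ≠ y → G.Adj (q 0) y := by
    intro x hx
    obtain ⟨v, hvx, hxv, hv⟩ := exists_adjacent_except_one hS hx₀ hx.1 hx.2
    have h1 := exists_path_of_hasCycle_sup hG.1 (hG.2 x v hvx.symm hxv)
    rw [Nat.add_sub_cancel] at h1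
    obtain ⟨q, rfl, hq1, hq2, hq3⟩ := h1.exists_seq
    exact ⟨q, hq2, hq3, hq1, fun y hy hxy => hv y hy.1 hy.2 hxy.symm⟩
  choose! p hadj hinj hend hcross using hex
  have hfin : S.Finite := S.toFinite
  have h1 := card_le_of_isCrown_card_le (I := (hfin.sdiff (t := {x₀})).toFinset) (p := p) ht hG.1
    (fun i hi => hadj i (by simpa using hi)) (fun i hi => hinj i (by simpa using hi))
    (fun i hi j hj hij => by
      rw [hend j (by simpa using hj)]
      exact hcross i (by simpa using hi) j (by simpa using hj) hij) (fun J => hC J p)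
  rw [← Set.ncard_eq_toFinset_card _ hfin.sdiff, Set.ncard_sdiff_singleton_of_mem hx₀] at h1
  omega

end Selection

lemma IsCrown.card_lt_of_degree {V ι : Type*} [Fintype V] [DecidableEq V] [DecidableEq ι]
    {G : SimpleGraph V} [DecidableRel G.Adj] {t : ℕ} {J : Finset ι} {p : ι → ℕ → V}
    (h : IsCrown G t J p) (ht : 1 ≤ t) (hfree : ¬ HasCycleOfLength G (2 * t + 1))
    {M L B : ℕ} (hM : M = (4 * (2 * t + 1)) ^ t + 2 * t)
    (hL : L = (4 * t ^ 2 + t + 2) * (2 * t + 1))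
    (hB : (2 * t + 1) * (L * L * M + L * (M + L + 1)) < B) (hB' : (2 * t + 1) * (2 * t) ≤ B)
    (hdeg : ∀ v, Fintype.card V + B ≤ (2 * t + 1) * G.degree v) :
    J.card < 4 * t ^ 2 + t + 2 := by
  have hmin : ∀ (v : V) (F : Finset V), F.card ≤ 2 * t →
      Fintype.card V ≤ 2 * (2 * t + 1) * (G.neighborFinset v \ F).card := by
    intro v F hF
    have h1 := Finset.le_card_sdiff F (G.neighborFinset v)
    rw [card_neighborFinset_eq_degree] at h1
    have h2 : G.degree v ≤ (G.neighborFinset v \ F).card + 2 * t := by omega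
    have h3 := Nat.mul_le_mul_left (2 * t + 1) h2
    have h4 := hdeg v
    rw [mul_add] at h3
    rw [mul_assoc]
    omega
  have hD : ∀ x y m A, PathIn G x y m A → Odd m → m + 1 ≤ 2 * t →
      ¬ M ≤ (G.neighborFinset x ∩ G.neighborFinset y).card := by
    intro x y m A hp hodd hm
    rw [hM, not_le]
    exact codegree_lt_of_odd_path ht hfree hmin hp hodd hm
  exact h.card_lt (M' := M + L + 1) hD (fun J p hJ hc hc' =>
    hJ.exists_large_bypassSet hD hdeg hc ht (hL ▸ Nat.mul_le_mul_right _ hc') hB)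
    (by omega) (by omega) ht

lemma crown_bound_le {t : ℕ} (ht : 1 ≤ t) :
    2 ^ (2 * t) * ((4 * t ^ 2 + t + 1) * (2 * t + 1) * (2 * t + 1)) + 1 ≤
      (2 * t + 1) ^ 3 * Nat.choose (2 * t) t * 2 ^ ((2 * t + 1) ^ (2 * t)) := by
  have h1 : 4 * t ^ 2 + t + 2 ≤ (2 * t + 1) ^ 2 := by nlinarith
  have h2 : 2 * t + (2 * t + 1) ≤ (2 * t + 1) ^ (2 * t) :=
    le_trans (by nlinarith) (Nat.pow_le_pow_right (by omega) (by omega : 2 ≤ 2 * t))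
  have h3 : 2 * t + 1 ≤ 2 ^ (2 * t + 1) := Nat.lt_two_pow_self.le
  have h4 : 1 ≤ Nat.choose (2 * t) t := Nat.choose_pos (by omega)
  have h5 : 1 ≤ 2 ^ (2 * t) * ((2 * t + 1) * (2 * t + 1)) :=
    Nat.one_le_iff_ne_zero.2 (by positivity)
  calc 2 ^ (2 * t) * ((4 * t ^ 2 + t + 1) * (2 * t + 1) * (2 * t + 1)) + 1
      ≤ 2 ^ (2 * t) * ((4 * t ^ 2 + t + 1) * (2 * t + 1) * (2 * t + 1)) +
        2 ^ (2 * t) * ((2 * t + 1) * (2 * t + 1)) := Nat.add_le_add_left h5 _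
    _ = 2 ^ (2 * t) * (2 * t + 1) ^ 2 * (4 * t ^ 2 + t + 2) := by ring
    _ ≤ 2 ^ (2 * t) * (2 * t + 1) ^ 2 * (2 * t + 1) ^ 2 := Nat.mul_le_mul_left _ h1
    _ = (2 * t + 1) ^ 3 * (2 ^ (2 * t) * (2 * t + 1)) := by ring
    _ ≤ (2 * t + 1) ^ 3 * (2 ^ (2 * t) * 2 ^ (2 * t + 1)) := by gcongr
    _ = (2 * t + 1) ^ 3 * 1 * 2 ^ (2 * t + (2 * t + 1)) := by rw [pow_add 2 (2 * t)]; ring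
    _ ≤ _ := by gcongr; norm_num

lemma card_add_le_of_le_degree {t n B d : ℕ} {ε : ℝ} (hε : 0 < ε) (hn : ⌈(B : ℝ) / ε⌉₊ ≤ n)
    (hd : ((1 : ℝ) / (2 * ((t + 1 : ℕ) : ℝ) - 1) + ε) * n ≤ d) : n + B ≤ (2 * t + 1) * d := by
  have h1 : (B : ℝ) ≤ n * ε := (div_le_iff₀ hε).1 (Nat.ceil_le.1 hn)
  have h2 : (2 * ((t + 1 : ℕ) : ℝ) - 1) = 2 * t + 1 := by push_cast; ring
  rw [h2] at hd
  have h3 : (0 : ℝ) < 2 * t + 1 := by positivity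
  have h4 := mul_le_mul_of_nonneg_left hd h3.le
  have h5 : (2 * (t : ℝ) + 1) * ((1 / (2 * t + 1) + ε) * n) = n + (2 * t + 1) * (n * ε) := by
    field_simp
  have h6 : (0 : ℝ) ≤ 2 * t * (n * ε) := by positivity
  have : (n : ℝ) + B ≤ (2 * t + 1) * d := by linarith
  exact_mod_cast this

/-- Theorem 1.5: for `k ≥ 2` and `ε > 0`, every sufficiently large `n`-vertex
maximal `C_{2k−1}`-free graph with minimum degree at least `(1/(2k−1) + ε)·n`
has VC-dimension at most `(2k−1)³·C(2k−2,k−1)·2^{(2k−1)^{2k−2}}`: every shattered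
set of vertices has size at most this bound. -/
theorem bounded_vc_dimension (k : ℕ) (hk : 2 ≤ k) (ε : ℝ) (hε : 0 < ε) :
    ∃ n₀ : ℕ, ∀ (V : Type) [Fintype V], n₀ ≤ Nat.card V →
      ∀ G : SimpleGraph V, MaximalCLFree G (2 * k - 1) →
        (∀ v : V,
          ((1 : ℝ) / (2 * (k : ℝ) - 1) + ε) * (Nat.card V) ≤ (G.neighborSet v).ncard) →
        ∀ S : Set V, Shattered G S →
          S.ncard ≤
            (2 * k - 1) ^ 3 * Nat.choose (2 * k - 2) (k - 1) *
              2 ^ ((2 * k - 1) ^ (2 * k - 2)) := by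
  obtain ⟨t, rfl⟩ := Nat.exists_eq_add_of_le' (by omega : 1 ≤ k)
  have ht : 1 ≤ t := by omega
  obtain ⟨M, hM⟩ : ∃ M, M = (4 * (2 * t + 1)) ^ t + 2 * t := ⟨_, rfl⟩
  obtain ⟨L, hL⟩ : ∃ L, L = (4 * t ^ 2 + t + 2) * (2 * t + 1) := ⟨_, rfl⟩
  obtain ⟨B, hB⟩ : ∃ B, B = (2 * t + 1) * (L * L * M + L * (M + L + 1)) + 1 +
    (2 * t + 1) * (2 * t) := ⟨_, rfl⟩
  refine ⟨⌈(B : ℝ) / ε⌉₊, fun V _ hn G hG hdeg S hS => ?_⟩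
  classical
  rw [show 2 * (t + 1) - 1 = 2 * t + 1 by omega] at hG ⊢
  rw [show 2 * (t + 1) - 2 = 2 * t by omega, Nat.add_sub_cancel]
  have hdeg' : ∀ v, Fintype.card V + B ≤ (2 * t + 1) * G.degree v := by
    intro v
    have h1 := card_add_le_of_le_degree hε hn (hdeg v)
    rwa [Nat.card_eq_fintype_card, Set.ncard_eq_toFinset_card', Set.toFinset_card,
      card_neighborSet_eq_degree] at h1
  exact (hS.ncard_le ht hG fun J p hJ => Nat.le_of_lt_succ
    (hJ.card_lt_of_degree ht hG.1 hM hL (by omega) (by omega) hdeg')).trans (crown_bound_le ht)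
end

section
/- Theorem 4.2 (C_5 warm-up): For every ε > 0 there exists n_0 such that the following holds for all n ≥ n_0. If G is an n-vertex maximal C_5-free graph with minimum degree δ(G) ≥ (1/5 + ε)·n, then G is a blowup of some graph H with at most 2^{(1000/ε)^2} vertices. -/
open SimpleGraph

/-- `G` is a blowup of `H`: there is a surjection `f` from the vertices of `G` onto
the vertices of `H` such that distinct `u, v` are adjacent in `G` iff their images
are adjacent in `H`. -/
def IsBlowupOf {V W : Type*} (G : SimpleGraph V) (H : SimpleGraph W) : Prop :=
  ∃ f : V → W, Function.Surjective f ∧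
    ∀ u v : V, u ≠ v → (G.Adj u v ↔ H.Adj (f u) (f v))

theorem hasCycleOfLength_five_iff {V : Type*} (G : SimpleGraph V) :
    HasCycleOfLength G 5 ↔ ∃ a b c d e : V, [a, b, c, d, e].Nodup ∧
      G.Adj a b ∧ G.Adj b c ∧ G.Adj c d ∧ G.Adj d e ∧ G.Adj e a := by
  constructor
  · rintro ⟨a, w, hw, hl⟩
    match w, hw, hl with
    | .cons (v := b) hab (.cons (v := c) hbc (.cons (v := d) hcd (.cons (v := e) hde
        (.cons hea .nil)))), hw, _ =>
      refine ⟨a, b, c, d, e, ?_, hab, hbc, hcd, hde, hea⟩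
      have := hw.support_nodup
      simp only [Walk.support_cons, Walk.support_nil, List.tail_cons] at this
      simp only [List.nodup_cons, List.mem_cons, List.not_mem_nil, List.nodup_nil] at this ⊢
      grind
  · rintro ⟨a, b, c, d, e, hn, hab, hbc, hcd, hde, hea⟩
    refine ⟨a, .cons hab (.cons hbc (.cons hcd (.cons hde (.cons hea .nil)))), ?_, rfl⟩
    simp only [List.nodup_cons, List.mem_cons, List.not_mem_nil, List.nodup_nil] at hn
    simp [Walk.isCycle_def, Walk.isTrail_def]
    grind

theorem exists_four_walk {V : Type*} {G : SimpleGraph V} {u v : V}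
    (hG : ¬ HasCycleOfLength G 5)
    (h : HasCycleOfLength (G ⊔ SimpleGraph.fromEdgeSet {s(u, v)}) 5) :
    ∃ a b c, G.Adj u a ∧ G.Adj a b ∧ G.Adj b c ∧ G.Adj c v := by
  rw [hasCycleOfLength_five_iff] at hG h
  obtain ⟨a, b, c, d, e, hn, h1, h2, h3, h4, h5⟩ := h
  have hG' := hG
  simp only [not_exists] at hG'
  specialize hG' a b c d e
  simp only [sup_adj, fromEdgeSet_adj, Set.mem_singleton_iff, Sym2.eq_iff] at h1 h2 h3 h4 h5
  simp only [List.nodup_cons, List.mem_cons, List.not_mem_nil, List.nodup_nil] at hn hG'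
  clear hG
  have key : ∀ p q x y z : V, (p = u ∧ q = v ∨ p = v ∧ q = u) → G.Adj q x → G.Adj x y →
      G.Adj y z → G.Adj z p → ∃ a b c, G.Adj u a ∧ G.Adj a b ∧ G.Adj b c ∧ G.Adj c v := by
    rintro p q x y z (⟨rfl, rfl⟩ | ⟨rfl, rfl⟩) h1 h2 h3 h4
    · exact ⟨z, y, x, h4.symm, h3.symm, h2.symm, h1.symm⟩
    · exact ⟨x, y, z, h1, h2, h3, h4⟩
  by_cases e1 : a = u ∧ b = v ∨ a = v ∧ b = u
  · exact key a b c d e e1 (by grind) (by grind) (by grind) (by grind)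
  by_cases e2 : b = u ∧ c = v ∨ b = v ∧ c = u
  · exact key b c d e a e2 (by grind) (by grind) (by grind) (by grind)
  by_cases e3 : c = u ∧ d = v ∨ c = v ∧ d = u
  · exact key c d e a b e3 (by grind) (by grind) (by grind) (by grind)
  by_cases e4 : d = u ∧ e = v ∨ d = v ∧ e = u
  · exact key d e a b c e4 (by grind) (by grind) (by grind) (by grind)
  by_cases e5 : e = u ∧ a = v ∨ e = v ∧ a = u
  · exact key e a b c d e5 (by grind) (by grind) (by grind) (by grind)
  grind


section

open Finset

/-- An `ε`-net theorem: if every member of `𝓡` is missed by few blocks of `r` points, and `𝓡`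
leaves few traces on any `2 * k * r` points, then some `k` blocks together meet all of `𝓡`. -/
theorem exists_blocks_hitting {V : Type*} [Fintype V] [DecidableEq V] [Nonempty V]
    (𝓡 : Finset (Finset V)) (k r N : ℕ)
    (hmiss : ∀ R ∈ 𝓡, 2 * k * #Rᶜ ^ r ≤ Fintype.card V ^ r)
    (htrace : ∀ z : Fin k × Bool × Fin r → V,
      #(𝓡.image fun R => ({j | z j ∈ R} : Finset (Fin k × Bool × Fin r))) ≤ N)
    (hN : 2 * N < 2 ^ k) :
    ∃ X : Fin k × Fin r → V, ∀ R ∈ 𝓡, ∃ j, X j ∈ R := by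
  classical
  by_contra! hcon
  choose F hF𝓡 hF using hcon
  set n := Fintype.card V ^ r with hn
  have hn0 : 0 < n := pow_pos Fintype.card_pos _
  let E : Finset (Fin k → Bool → Fin r → V) :=
    {p | ∃ R ∈ 𝓡, ∀ i, (∀ j, p i false j ∉ R) ∧ ∃ j, p i true j ∈ R}
  let sw (σ : Fin k → Bool) (p : Fin k → Bool → Fin r → V) : Fin k → Bool → Fin r → V :=
    fun i b => p i (xor b (σ i))
  have hsw (σ) : Function.Involutive (sw σ) := by
    intro p; funext i b; simp [sw]
  have upper : 2 ^ k * #E ≤ (n ^ 2) ^ k * N := by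
    have h1 : ∑ σ : Fin k → Bool, #{p | sw σ p ∈ E} = 2 ^ k * #E := by
      have (σ : Fin k → Bool) : #{p | sw σ p ∈ E} = #E := by
        refine Finset.card_bij (fun p _ => sw σ p) (by simp)
          (fun _ _ _ _ h => (hsw σ).injective h) fun p hp => ⟨sw σ p, ?_, hsw σ p⟩
        simpa [hsw σ p] using hp
      simp [this]
    have h2 : ∑ σ : Fin k → Bool, #{p | sw σ p ∈ E} = ∑ p, #{σ | sw σ p ∈ E} := by
      simp only [Finset.card_filter]
      exact Finset.sum_comm
    have h3 (p : Fin k → Bool → Fin r → V) : #{σ | sw σ p ∈ E} ≤ N := by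
      refine le_trans ?_ (htrace fun j => p j.1 j.2.1 j.2.2)
      have hex : ∀ σ : Fin k → Bool, ∃ R, sw σ p ∈ E → R ∈ 𝓡 ∧
          ∀ i, (∀ j, sw σ p i false j ∉ R) ∧ ∃ j, sw σ p i true j ∈ R := by
        intro σ
        by_cases h : sw σ p ∈ E
        · obtain ⟨R, hR⟩ := (Finset.mem_filter.1 h).2
          exact ⟨R, fun _ => hR⟩
        · exact ⟨∅, fun h' => absurd h' h⟩
      choose R hR using hex
      have hσ (σ : Fin k → Bool) (h : sw σ p ∈ E) (i : Fin k) :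
          σ i = true ↔ ∃ j, p i false j ∈ R σ := by
        obtain ⟨h1, h2⟩ := (hR σ h).2 i
        cases hs : σ i <;> simp_all [sw]
      refine Finset.card_le_card_of_injOn (fun σ => ({j | p j.1 j.2.1 j.2.2 ∈ R σ} :
          Finset (Fin k × Bool × Fin r))) ?_ ?_
      · intro σ h
        simp only [Finset.coe_filter, Finset.mem_univ, true_and, Set.mem_ofPred_eq] at h
        exact Finset.mem_coe.2 (Finset.mem_image.2 ⟨R σ, (hR σ h).1, rfl⟩)
      · intro σ h τ h' heq
        simp only [Finset.coe_filter, Finset.mem_univ, true_and, Set.mem_ofPred_eq] at h h'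
        funext i
        rw [Bool.eq_iff_iff, hσ σ h, hσ τ h']
        refine exists_congr fun j => ?_
        have := congrArg (fun S => (i, false, j) ∈ S) heq
        simpa using this
    rw [← h1, h2]
    refine (Finset.sum_le_card_nsmul _ _ N fun p _ => h3 p).trans (le_of_eq ?_)
    simp [hn]
  have lower : n ^ k * n ^ k ≤ 2 * #E := by
    let hit (R : Finset V) : Finset (Fin r → V) := (Fintype.piFinset fun _ => Rᶜ)ᶜ
    have hhit (R) (hR : R ∈ 𝓡) : n ^ k ≤ 2 * #(hit R) ^ k := by
      have hc : #(hit R) = n - #Rᶜ ^ r := by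
        simp [hit, Finset.card_compl, hn]
      have hle : #Rᶜ ^ r ≤ n := Nat.pow_le_pow_left (Finset.card_le_univ _) _
      have h2 := hmiss R hR
      set q := #Rᶜ ^ r
      rw [hc]
      have hnR : (0 : ℝ) < n := by exact_mod_cast hn0
      have hqn : (q : ℝ) / n ≤ 1 := by
        rw [div_le_one hnR]; exact_mod_cast hle
      have hb := one_add_mul_le_pow (a := -((q : ℝ) / n)) (by linarith) k
      have h2' : 2 * (k : ℝ) * q ≤ n := by exact_mod_cast h2
      have h4 : (k : ℝ) * (q / n) ≤ 1 / 2 := by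
        rw [← mul_div_assoc, div_le_iff₀ hnR]; linarith
      have h5 : (1 : ℝ) ≤ 2 * (1 + -((q : ℝ) / n)) ^ k := by linarith
      have h6 : ((n - q : ℕ) : ℝ) = n * (1 + -((q : ℝ) / n)) := by
        rw [Nat.cast_sub hle]; field_simp; ring
      have h7 : (n : ℝ) ^ k ≤ 2 * ((n - q : ℕ) : ℝ) ^ k := by
        rw [h6, mul_pow]
        nlinarith [pow_pos hnR k]
      exact_mod_cast h7
    have hs : #(Finset.univ.sigma fun X : Fin k → Fin r → V =>
        Fintype.piFinset fun _ : Fin k => hit (F fun j => X j.1 j.2)) ≤ #E := by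
      refine Finset.card_le_card_of_injOn
        (fun q i b => if b then q.2 i else q.1 i) ?_ ?_
      · rintro ⟨X, Y⟩ h
        simp only [Finset.mem_coe, Finset.mem_sigma, Finset.mem_univ, true_and,
          Fintype.mem_piFinset, hit, Finset.mem_compl, not_forall, not_not] at h
        simp only [E, Finset.coe_filter, Finset.mem_univ, true_and, Set.mem_ofPred_eq]
        refine ⟨_, hF𝓡 fun j => X j.1 j.2, fun i => ⟨fun j => ?_, ?_⟩⟩
        · simpa using hF (fun j => X j.1 j.2) (i, j)
        · simpa using h i
      · rintro ⟨X, Y⟩ _ ⟨X', Y'⟩ _ h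
        have hX : X = X' := by
          funext i
          simpa using congrFun (congrFun h i) false
        have hY : Y = Y' := by
          funext i
          simpa using congrFun (congrFun h i) true
        rw [hX, hY]
    rw [Finset.card_sigma] at hs
    calc n ^ k * n ^ k = ∑ X : Fin k → Fin r → V, n ^ k := by simp [hn]
      _ ≤ ∑ X : Fin k → Fin r → V, 2 * #(Fintype.piFinset fun _ : Fin k =>
            hit (F fun j => X j.1 j.2)) := by
          refine Finset.sum_le_sum fun X _ => ?_
          simpa using hhit _ (hF𝓡 fun j => X j.1 j.2)
      _ ≤ 2 * #E := by rw [← Finset.mul_sum]; omega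
  have hpos : 0 < n ^ k * n ^ k := by positivity
  have : (n ^ 2) ^ k = n ^ k * n ^ k := by ring
  rw [this] at upper
  nlinarith

theorem sum_range_pow_le_succ_pow (n d : ℕ) : ∑ k ∈ range (d + 1), n ^ k ≤ (n + 1) ^ d := by
  induction d with
  | zero => simp
  | succ d ih =>
    rw [Finset.sum_range_succ]
    have := Nat.mul_le_mul_left n (Nat.pow_le_pow_left (Nat.le_succ n) d)
    calc _ ≤ (n + 1) ^ d + n * (n + 1) ^ d := by
          gcongr
          simpa [pow_succ'] using this
      _ = (n + 1) ^ (d + 1) := by ring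

theorem card_le_of_forall_shatters {α : Type*} [Fintype α] [DecidableEq α]
    (𝒜 : Finset (Finset α)) (d : ℕ) (h : ∀ S, 𝒜.Shatters S → #S ≤ d) :
    #𝒜 ≤ (Fintype.card α + 1) ^ d := by
  have hd : 𝒜.vcDim ≤ d := Finset.sup_le fun S hS => h S (mem_shatterer.1 hS)
  calc #𝒜 ≤ ∑ k ∈ Iic 𝒜.vcDim, (Fintype.card α).choose k :=
        (card_le_card_shatterer 𝒜).trans card_shatterer_le_sum_vcDim
    _ ≤ ∑ k ∈ range (d + 1), (Fintype.card α) ^ k := by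
        refine (Finset.sum_le_sum_of_subset fun k hk => ?_).trans
          (Finset.sum_le_sum fun k _ => Nat.choose_le_pow _ _)
        simp only [mem_Iic, mem_range] at hk ⊢
        omega
    _ ≤ _ := sum_range_pow_le_succ_pow _ _

theorem card_le_card_union_add_card_inter_of_five {V : Type*} [Fintype V] [DecidableEq V]
    (A B C D E : Finset V) :
    #A + #B + #C + #D + #E ≤ Fintype.card V +
      (#(A ∩ B) + #(A ∩ C) + #(A ∩ D) + #(A ∩ E) + #(B ∩ C) + #(B ∩ D) + #(B ∩ E) +
        #(C ∩ D) + #(C ∩ E) + #(D ∩ E)) := by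
  have h1 := card_union_add_card_inter A B
  have h2 := card_union_add_card_inter (A ∪ B) C
  have h3 := card_union_add_card_inter (A ∪ B ∪ C) D
  have h4 := card_union_add_card_inter (A ∪ B ∪ C ∪ D) E
  have h5 := card_le_univ (A ∪ B ∪ C ∪ D ∪ E)
  simp only [union_inter_distrib_right] at h2 h3 h4
  have g1 := card_union_le (A ∩ C) (B ∩ C)
  have g2 := card_union_le (A ∩ D ∪ B ∩ D) (C ∩ D)
  have g3 := card_union_le (A ∩ D) (B ∩ D)
  have g4 := card_union_le (A ∩ E ∪ B ∩ E ∪ C ∩ E) (D ∩ E)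
  have g5 := card_union_le (A ∩ E ∪ B ∩ E) (C ∩ E)
  have g6 := card_union_le (A ∩ E) (B ∩ E)
  omega

theorem no_closed_five_walk {V : Type*} {G : SimpleGraph V}
    (h5 : ∀ a b c d e, [a, b, c, d, e].Nodup → G.Adj a b → G.Adj b c → G.Adj c d → G.Adj d e →
      ¬ G.Adj e a)
    (h3 : ∀ a b c, G.Adj a b → G.Adj b c → ¬ G.Adj a c) (a b c d e : V)
    (hab : G.Adj a b) (hbc : G.Adj b c) (hcd : G.Adj c d) (hde : G.Adj d e) : ¬ G.Adj e a := by
  intro hea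
  have := hab.ne
  have := hbc.ne
  have := hcd.ne
  have := hde.ne
  have := hea.ne
  by_cases ac : a = c
  · subst ac; exact h3 _ _ _ hcd hde hea.symm
  by_cases bd : b = d
  · subst bd; exact h3 _ _ _ hde hea hab.symm
  by_cases ce : c = e
  · subst ce; exact h3 _ _ _ hea hab hbc.symm
  by_cases da : d = a
  · subst da; exact h3 _ _ _ hab hbc hcd.symm
  by_cases eb : e = b
  · subst eb; exact h3 _ _ _ hbc hcd hde.symm
  refine h5 a b c d e ?_ hab hbc hcd hde hea
  simp only [List.nodup_cons, List.mem_cons, List.not_mem_nil, List.nodup_nil]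
  grind

variable {V : Type*} [Fintype V] [DecidableEq V] {G : SimpleGraph V} [DecidableRel G.Adj] {ε : ℝ}

theorem five_mul_le_sum_card_inter_neighborFinset
    (hd : ∀ v, (1 / 5 + ε) * Fintype.card V ≤ #(G.neighborFinset v)) (a b c d e : V) :
    5 * ε * Fintype.card V ≤
      (#(G.neighborFinset a ∩ G.neighborFinset b) + #(G.neighborFinset a ∩ G.neighborFinset c)
      + #(G.neighborFinset a ∩ G.neighborFinset d) + #(G.neighborFinset a ∩ G.neighborFinset e)
      + #(G.neighborFinset b ∩ G.neighborFinset c) + #(G.neighborFinset b ∩ G.neighborFinset d)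
      + #(G.neighborFinset b ∩ G.neighborFinset e) + #(G.neighborFinset c ∩ G.neighborFinset d)
      + #(G.neighborFinset c ∩ G.neighborFinset e)
      + #(G.neighborFinset d ∩ G.neighborFinset e) : ℕ) := by
  have h := card_le_card_union_add_card_inter_of_five (G.neighborFinset a) (G.neighborFinset b)
    (G.neighborFinset c) (G.neighborFinset d) (G.neighborFinset e)
  have h' := (Nat.cast_le (α := ℝ)).2 h
  rw [Nat.cast_add (Fintype.card V)] at h'
  push_cast at h' ⊢
  linarith [hd a, hd b, hd c, hd d, hd e]

theorem card_inter_neighborFinset_le_two {a b p q : V}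
    (h : ∀ w, G.Adj a w → G.Adj b w → w = p ∨ w = q) :
    #(G.neighborFinset a ∩ G.neighborFinset b) ≤ 2 := by
  refine (card_le_card (t := {p, q}) fun w hw => ?_).trans card_le_two
  simp only [mem_inter, mem_neighborFinset] at hw
  simpa using h w hw.1 hw.2

theorem card_inter_neighborFinset_eq_zero {a b : V} (h : ∀ w, G.Adj a w → ¬ G.Adj b w) :
    #(G.neighborFinset a ∩ G.neighborFinset b) = 0 := by
  rw [card_eq_zero, eq_empty_iff_forall_notMem]
  intro w hw
  simp only [mem_inter, mem_neighborFinset] at hw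
  exact h w hw.1 hw.2

theorem card_inter_neighborFinset_le_four_of_adj
    (h5 : ∀ a b c d e, [a, b, c, d, e].Nodup → G.Adj a b → G.Adj b c → G.Adj c d → G.Adj d e →
      ¬ G.Adj e a)
    (hd : ∀ v, (1 / 5 + ε) * Fintype.card V ≤ #(G.neighborFinset v))
    (hn : 100 ≤ ε * Fintype.card V) {x y : V} (hxy : G.Adj x y) :
    #(G.neighborFinset x ∩ G.neighborFinset y) ≤ 4 := by
  by_contra! hcard
  obtain ⟨T, hT, hT5⟩ := exists_subset_card_eq (Nat.succ_le_of_lt hcard)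
  obtain ⟨a, b, c, d, e, hn⟩ : ∃ a b c d e, [a, b, c, d, e].Nodup ∧ T = {a, b, c, d, e} := by
    have hl := T.length_toList
    rw [hT5] at hl
    have hnd := T.nodup_toList
    have hT' := T.toList_toFinset
    match T.toList, hl, hnd, hT' with
    | [a, b, c, d, e], _, hnd, hT' => exact ⟨a, b, c, d, e, hnd, by simpa using hT'.symm⟩
  obtain ⟨hnd, rfl⟩ := hn
  have hadj (s) (hs : s ∈ ({a, b, c, d, e} : Finset V)) : G.Adj x s ∧ G.Adj y s := by
    simpa using hT hs
  have key (s t) (hs : s ∈ ({a, b, c, d, e} : Finset V))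
      (ht : t ∈ ({a, b, c, d, e} : Finset V)) (hst : s ≠ t) :
      #(G.neighborFinset s ∩ G.neighborFinset t) ≤ 2 := by
    refine card_inter_neighborFinset_le_two (p := x) (q := y) fun w hsw htw => ?_
    by_contra! hw
    have h1 := hadj s hs
    have h2 := hadj t ht
    refine h5 s w t x y ?_ hsw htw.symm h2.1.symm hxy h1.2
    have := hxy.ne
    have := h1.1.ne
    have := h1.2.ne
    have := h2.1.ne
    have := h2.2.ne
    have := hsw.ne
    have := htw.ne
    simp only [List.nodup_cons, List.mem_cons, List.not_mem_nil, List.nodup_nil]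
    grind
  have hsum := five_mul_le_sum_card_inter_neighborFinset hd a b c d e
  simp only [List.nodup_cons, List.mem_cons, List.not_mem_nil, List.nodup_nil, or_false,
    not_or] at hnd
  obtain ⟨⟨ab, ac, ad, ae⟩, ⟨bc, bd, be⟩, ⟨cd, ce⟩, de, -⟩ := hnd
  have k1 := key a b (by simp) (by simp) ab
  have k2 := key a c (by simp) (by simp) ac
  have k3 := key a d (by simp) (by simp) ad
  have k4 := key a e (by simp) (by simp) ae
  have k5 := key b c (by simp) (by simp) bc
  have k6 := key b d (by simp) (by simp) bd
  have k7 := key b e (by simp) (by simp) be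
  have k8 := key c d (by simp) (by simp) cd
  have k9 := key c e (by simp) (by simp) ce
  have k10 := key d e (by simp) (by simp) de
  have : (100 : ℝ) < (20 : ℕ) := by
    refine lt_of_lt_of_le ?_ (hsum.trans (Nat.cast_le.2 ?_))
    · linarith
    · omega
  norm_num at this

theorem triangle_free_of_five_cycle_free
    (h5 : ∀ a b c d e, [a, b, c, d, e].Nodup → G.Adj a b → G.Adj b c → G.Adj c d → G.Adj d e →
      ¬ G.Adj e a)
    (hd : ∀ v, (1 / 5 + ε) * Fintype.card V ≤ #(G.neighborFinset v))
    (hn : 100 ≤ ε * Fintype.card V) (x y z : V) (hxy : G.Adj x y) (hyz : G.Adj y z) :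
    ¬ G.Adj x z := by
  intro hxz
  have hlarge (v : V) : 3 < #(G.neighborFinset v) := by
    have := hd v
    have h0 : (0 : ℝ) ≤ Fintype.card V := by positivity
    have : (3 : ℝ) < #(G.neighborFinset v) := by linarith
    exact_mod_cast this
  have hpick (v : V) (S : Finset V) (hS : #S ≤ 3) : ∃ a, G.Adj v a ∧ a ∉ S := by
    obtain ⟨a, ha, ha'⟩ := exists_mem_notMem_of_card_lt_card (hS.trans_lt (hlarge v))
    exact ⟨a, by simpa using ha, ha'⟩
  obtain ⟨a, hxa, ha⟩ := hpick x {y, z} (card_le_two.trans (by norm_num))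
  obtain ⟨b, hyb, hb⟩ := hpick y {x, z, a} card_le_three
  simp only [mem_insert, mem_singleton, not_or] at ha hb
  have h4 {p q} (hpq : G.Adj p q) := card_inter_neighborFinset_le_four_of_adj h5 hd hn hpq
  have n1 := hxy.ne
  have n2 := hyz.ne
  have n3 := hxz.ne
  have n4 := hxa.ne
  have n5 := hyb.ne
  have xb : #(G.neighborFinset x ∩ G.neighborFinset b) ≤ 2 := by
    refine card_inter_neighborFinset_le_two (p := y) (q := z) fun w h1 h2 => ?_
    have := h1.ne
    have := h2.ne
    by_contra! hw
    refine h5 x w b y z ?_ h1 h2.symm hyb.symm hyz hxz.symm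
    simp only [List.nodup_cons, List.mem_cons, List.not_mem_nil, List.nodup_nil]
    grind
  have ya : #(G.neighborFinset y ∩ G.neighborFinset a) ≤ 2 := by
    refine card_inter_neighborFinset_le_two (p := x) (q := z) fun w h1 h2 => ?_
    have := h1.ne
    have := h2.ne
    by_contra! hw
    refine h5 y w a x z ?_ h1 h2.symm hxa.symm hxz hyz.symm
    simp only [List.nodup_cons, List.mem_cons, List.not_mem_nil, List.nodup_nil]
    grind
  have za : #(G.neighborFinset z ∩ G.neighborFinset a) ≤ 2 := by
    refine card_inter_neighborFinset_le_two (p := x) (q := y) fun w h1 h2 => ?_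
    have := h1.ne
    have := h2.ne
    by_contra! hw
    refine h5 z w a x y ?_ h1 h2.symm hxa.symm hxy hyz
    simp only [List.nodup_cons, List.mem_cons, List.not_mem_nil, List.nodup_nil]
    grind
  have zb : #(G.neighborFinset z ∩ G.neighborFinset b) ≤ 2 := by
    refine card_inter_neighborFinset_le_two (p := x) (q := y) fun w h1 h2 => ?_
    have := h1.ne
    have := h2.ne
    by_contra! hw
    refine h5 z w b y x ?_ h1 h2.symm hyb.symm hxy.symm hxz
    simp only [List.nodup_cons, List.mem_cons, List.not_mem_nil, List.nodup_nil]
    grind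
  have ab : #(G.neighborFinset a ∩ G.neighborFinset b) ≤ 2 := by
    refine card_inter_neighborFinset_le_two (p := x) (q := y) fun w h1 h2 => ?_
    have := h1.ne
    have := h2.ne
    by_contra! hw
    refine h5 x a w b y ?_ hxa h1 h2.symm hyb.symm hxy.symm
    simp only [List.nodup_cons, List.mem_cons, List.not_mem_nil, List.nodup_nil]
    grind
  have k1 := h4 hxy
  have k2 := h4 hxz
  have k3 := h4 hyz
  have k4 := h4 hxa
  have k5 := h4 hyb
  have hsum := five_mul_le_sum_card_inter_neighborFinset hd x y z a b
  have : (100 : ℝ) < (30 : ℕ) := by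
    refine lt_of_lt_of_le ?_ (hsum.trans (Nat.cast_le.2 ?_))
    · linarith
    · omega
  norm_num at this

theorem card_le_four_of_disjoint_neighborFinset [Nonempty V] (hε : 0 < ε)
    (hd : ∀ v, (1 / 5 + ε) * Fintype.card V ≤ #(G.neighborFinset v)) {ι : Type*} (J : Finset ι)
    (b : ι → V) (h : ∀ i ∈ J, ∀ j ∈ J, i ≠ j → ∀ y, G.Adj (b i) y → ¬ G.Adj (b j) y) :
    #J ≤ 4 := by
  have hdisj : (J : Set ι).PairwiseDisjoint fun i => G.neighborFinset (b i) := by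
    intro i hi j hj hij
    rw [Function.onFun, Finset.disjoint_left]
    intro y hy hy'
    rw [mem_neighborFinset] at hy hy'
    exact h i hi j hj hij y hy hy'
  have h1 : (∑ i ∈ J, #(G.neighborFinset (b i)) : ℝ) ≤ Fintype.card V := by
    have := card_le_univ (J.biUnion fun i => G.neighborFinset (b i))
    rw [card_biUnion hdisj] at this
    exact_mod_cast this
  have h2 : #J * ((1 / 5 + ε) * Fintype.card V) ≤ (∑ i ∈ J, #(G.neighborFinset (b i)) : ℝ) := by
    rw [← nsmul_eq_mul]
    exact card_nsmul_le_sum _ _ _ fun i _ => hd (b i)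
  by_contra! hJ
  have hJ' : (5 : ℝ) ≤ #J := by exact_mod_cast hJ
  have hV : (0 : ℝ) < Fintype.card V := by exact_mod_cast Fintype.card_pos
  have := mul_le_mul_of_nonneg_right hJ' (by positivity : 0 ≤ (1 / 5 + ε) * Fintype.card V)
  nlinarith [mul_pos hε hV]

/-- Under the hypotheses satisfied by dense maximal `C₅`-free graphs, an induced crown
(a complete bipartite pattern minus a perfect matching) has at most eight pairs. -/
theorem card_le_eight_of_crown [Nonempty V] (hε : 0 < ε)
    (hd : ∀ v, (1 / 5 + ε) * Fintype.card V ≤ #(G.neighborFinset v))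
    (h5 : ∀ a b c d e, G.Adj a b → G.Adj b c → G.Adj c d → G.Adj d e → ¬ G.Adj e a)
    (hmax : ∀ u v, ¬ G.Adj u v → ∃ a b c, G.Adj u a ∧ G.Adj a b ∧ G.Adj b c ∧ G.Adj c v)
    {ι : Type*} [Fintype ι] [DecidableEq ι] (s x : ι → V)
    (hsx : ∀ i j, G.Adj (s i) (x j) ↔ i ≠ j) : Fintype.card ι ≤ 8 := by
  classical
  by_contra! hι
  choose a b c hsa hab hbc hcx using fun i => hmax (s i) (x i) (by simp [hsx])
  let I (i j : ι) : Prop := ∃ y, G.Adj (b i) y ∧ G.Adj (b j) y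
  have hI {i j} (h : I i j) : I j i := h.imp fun _ => And.symm
  obtain ⟨i, r, t, hir, hit, hrt, hIr, hIt⟩ :
      ∃ i r t, i ≠ r ∧ i ≠ t ∧ r ≠ t ∧ I i r ∧ I i t := by
    obtain ⟨J, hJ, hJmax⟩ := exists_max_image
      ({J | ∀ i ∈ J, ∀ j ∈ J, i ≠ j → ¬ I i j} : Finset (Finset ι)) card ⟨∅, by simp⟩
    simp only [mem_filter, mem_univ, true_and] at hJ hJmax
    have hJ4 : #J ≤ 4 := card_le_four_of_disjoint_neighborFinset hε hd J b
      fun i hi j hj hij y h1 h2 => hJ i hi j hj hij ⟨y, h1, h2⟩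
    have hout : ∀ j ∈ Jᶜ, ∃ i ∈ J, I i j := by
      intro j hj
      by_contra! hno
      rw [mem_compl] at hj
      have := hJmax (insert j J) (by
        intro p hp q hq hpq hpqI
        rw [mem_insert] at hp hq
        rcases hp with rfl | hp <;> rcases hq with rfl | hq
        · exact hpq rfl
        · exact hno q hq (hI hpqI)
        · exact hno p hp hpqI
        · exact hJ p hp q hq hpq hpqI)
      rw [card_insert_of_notMem hj] at this
      omega
    choose! f hfJ hf using hout
    have hlt : #J < #Jᶜ := by
      rw [card_compl]
      omega
    obtain ⟨r, hr, t, ht, hrt, hfrt⟩ := exists_ne_map_eq_of_card_lt_of_maps_to hlt hfJ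
    refine ⟨f r, r, t, ?_, ?_, hrt, hf r hr, hfrt ▸ hf t ht⟩
    · exact fun h => mem_compl.1 hr (h ▸ hfJ r hr)
    · exact fun h => mem_compl.1 ht (h ▸ hfrt ▸ hfJ r hr)
  have walk {p q} (h : ∃ y z, G.Adj p y ∧ G.Adj y z ∧ G.Adj z q) :
      ∀ w, G.Adj p w → ¬ G.Adj q w := by
    obtain ⟨y, z, h1, h2, h3⟩ := h
    exact fun w hw hw' => h5 _ _ _ _ _ h1 h2 h3 hw' hw.symm
  have adj {i j} (h : i ≠ j) : G.Adj (s i) (x j) := (hsx i j).2 h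
  have e1 : ∀ w, G.Adj (s t) w → ¬ G.Adj (x r) w :=
    walk ⟨x r, s t, adj hrt.symm, (adj hrt.symm).symm, adj hrt.symm⟩
  have e2 : ∀ w, G.Adj (s t) w → ¬ G.Adj (a r) w :=
    walk ⟨x i, s r, adj hit.symm, (adj hir.symm).symm, hsa r⟩
  have e3 : ∀ w, G.Adj (s t) w → ¬ G.Adj (c t) w := walk ⟨a t, b t, hsa t, hab t, hbc t⟩
  have e4 : ∀ w, G.Adj (s t) w → ¬ G.Adj (b i) w :=
    walk ⟨x i, c i, adj hit.symm, (hcx i).symm, (hbc i).symm⟩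
  have e5 : ∀ w, G.Adj (x r) w → ¬ G.Adj (a r) w :=
    walk ⟨c r, b r, (hcx r).symm, (hbc r).symm, (hab r).symm⟩
  have e6 : ∀ w, G.Adj (x r) w → ¬ G.Adj (c t) w :=
    walk ⟨s i, x t, (adj hir).symm, adj hit, (hcx t).symm⟩
  have e7 : ∀ w, G.Adj (x r) w → ¬ G.Adj (b i) w :=
    walk ⟨s i, a i, (adj hir).symm, hsa i, hab i⟩
  have e8 : ∀ w, G.Adj (a r) w → ¬ G.Adj (c t) w :=
    walk ⟨s r, x t, (hsa r).symm, adj hrt, (hcx t).symm⟩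
  have e9 : ∀ w, G.Adj (a r) w → ¬ G.Adj (b i) w := by
    intro w h1 h2
    obtain ⟨y, hy, hy'⟩ := hIr
    exact walk ⟨w, a r, h2, h1.symm, hab r⟩ y hy hy'
  have e10 : ∀ w, G.Adj (c t) w → ¬ G.Adj (b i) w := by
    intro w h1 h2
    obtain ⟨y, hy, hy'⟩ := hIt
    exact walk ⟨w, c t, h2, h1.symm, (hbc t).symm⟩ y hy hy'
  have hsum := five_mul_le_sum_card_inter_neighborFinset hd (s t) (x r) (a r) (c t) (b i)
  rw [card_inter_neighborFinset_eq_zero e1, card_inter_neighborFinset_eq_zero e2,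
    card_inter_neighborFinset_eq_zero e3, card_inter_neighborFinset_eq_zero e4,
    card_inter_neighborFinset_eq_zero e5, card_inter_neighborFinset_eq_zero e6,
    card_inter_neighborFinset_eq_zero e7, card_inter_neighborFinset_eq_zero e8,
    card_inter_neighborFinset_eq_zero e9, card_inter_neighborFinset_eq_zero e10] at hsum
  have hV : (0 : ℝ) < Fintype.card V := by exact_mod_cast Fintype.card_pos
  norm_num at hsum
  nlinarith [mul_pos hε hV]

theorem card_image_neighbor_traces_le [Nonempty V] (hε : 0 < ε)
    (hd : ∀ v, (1 / 5 + ε) * Fintype.card V ≤ #(G.neighborFinset v))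
    (h5 : ∀ a b c d e, G.Adj a b → G.Adj b c → G.Adj c d → G.Adj d e → ¬ G.Adj e a)
    (hmax : ∀ u v, ¬ G.Adj u v → ∃ a b c, G.Adj u a ∧ G.Adj a b ∧ G.Adj b c ∧ G.Adj c v)
    {α : Type*} [Fintype α] [DecidableEq α] (z : α → V) :
    #(univ.image fun v => ({j | G.Adj v (z j)} : Finset α)) ≤ (Fintype.card α + 1) ^ 8 := by
  refine card_le_of_forall_shatters _ _ fun S hS => ?_
  have hx (i : S) : ∃ v, ∀ j : S, G.Adj v (z j) ↔ j ≠ i := by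
    obtain ⟨u, hu, hu'⟩ := hS (erase_subset (i : α) S)
    obtain ⟨v, -, rfl⟩ := mem_image.1 hu
    refine ⟨v, fun j => ?_⟩
    have := congrArg (fun T => (j : α) ∈ T) hu'
    simp only [mem_inter, mem_filter, mem_univ, true_and, mem_erase, j.2, and_true] at this
    rw [Ne, Subtype.ext_iff, this]
  choose x hx using hx
  simpa using card_le_eight_of_crown hε hd h5 hmax (fun i : S => z i) x
    fun i j => by rw [G.adj_comm, hx]

theorem exists_net_inter_neighborFinset [Nonempty V] (hε : 0 < ε) (hε1 : ε ≤ 1)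
    (hd : ∀ v, (1 / 5 + ε) * Fintype.card V ≤ #(G.neighborFinset v))
    (h5 : ∀ a b c d e, G.Adj a b → G.Adj b c → G.Adj c d → G.Adj d e → ¬ G.Adj e a)
    (hmax : ∀ u v, ¬ G.Adj u v → ∃ a b c, G.Adj u a ∧ G.Adj a b ∧ G.Adj b c ∧ G.Adj c v)
    {k r : ℕ} (hkr : 2 * k ≤ r * ε) (hk : 2 * ((k * (2 * r) + 1) ^ 8) ^ 2 < 2 ^ k) :
    ∃ X : Fin k × Fin r → V, ∀ p q,
      ε * Fintype.card V ≤ #(G.neighborFinset p ∩ G.neighborFinset q) →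
        ∃ j, G.Adj p (X j) ∧ G.Adj q (X j) := by
  let 𝓡 : Finset (Finset V) := {R ∈ univ.image fun p : V × V =>
    G.neighborFinset p.1 ∩ G.neighborFinset p.2 | ε * Fintype.card V ≤ #R}
  suffices ∃ X : Fin k × Fin r → V, ∀ R ∈ 𝓡, ∃ j, X j ∈ R by
    obtain ⟨X, hX⟩ := this
    refine ⟨X, fun p q hpq => ?_⟩
    obtain ⟨j, hj⟩ := hX (G.neighborFinset p ∩ G.neighborFinset q)
      (mem_filter.2 ⟨mem_image.2 ⟨(p, q), mem_univ _, rfl⟩, hpq⟩)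
    exact ⟨j, by simpa using hj⟩
  refine exists_blocks_hitting 𝓡 k r _ ?_ ?_ hk
  · intro R hR
    have hR := (mem_filter.1 hR).2
    have hc : (#Rᶜ : ℝ) ≤ (1 - ε) * Fintype.card V := by
      rw [card_compl, Nat.cast_sub (card_le_univ R)]
      linarith
    have h1 : (1 - ε) ^ r * (1 + r * ε) ≤ 1 := by
      calc (1 - ε) ^ r * (1 + r * ε) ≤ (1 - ε) ^ r * (1 + ε) ^ r := by
            gcongr
            exact one_add_mul_le_pow (by linarith) r
        _ = (1 - ε ^ 2) ^ r := by rw [← mul_pow]; ring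
        _ ≤ 1 := pow_le_one₀ (by nlinarith) (by nlinarith)
    have h2 : 2 * k * (1 - ε) ^ r ≤ 1 := by
      have := pow_nonneg (sub_nonneg.2 hε1) r
      nlinarith
    have h3 : 2 * (k : ℝ) * (#Rᶜ : ℝ) ^ r ≤ (Fintype.card V : ℝ) ^ r := by
      calc 2 * (k : ℝ) * (#Rᶜ : ℝ) ^ r ≤ 2 * k * ((1 - ε) * Fintype.card V) ^ r := by gcongr
        _ = 2 * k * (1 - ε) ^ r * (Fintype.card V : ℝ) ^ r := by rw [mul_pow]; ring
        _ ≤ 1 * (Fintype.card V : ℝ) ^ r := by gcongr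
        _ = _ := one_mul _
    exact_mod_cast h3
  · intro z
    have ht := card_image_neighbor_traces_le hε hd h5 hmax z
    set T := univ.image fun v => ({j | G.Adj v (z j)} : Finset (Fin k × Bool × Fin r)) with hT
    have hcard : Fintype.card (Fin k × Bool × Fin r) = k * (2 * r) := by simp
    rw [hcard] at ht
    calc _ ≤ #((T ×ˢ T).image fun t => t.1 ∩ t.2) := by
          refine card_le_card fun S hS => ?_
          obtain ⟨R, hR, rfl⟩ := mem_image.1 hS
          obtain ⟨⟨p, q⟩, -, rfl⟩ := mem_image.1 (mem_filter.1 hR).1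
          refine mem_image.2 ⟨(({j | G.Adj p (z j)} : Finset _), ({j | G.Adj q (z j)} : Finset _)), ?_, ?_⟩
          · exact mem_product.2 ⟨mem_image_of_mem _ (mem_univ p), mem_image_of_mem _ (mem_univ q)⟩
          · ext j
            simp
      _ ≤ #T * #T := card_image_le.trans (card_product _ _).le
      _ ≤ _ := by rw [sq]; exact Nat.mul_le_mul ht ht

/-- Two vertices with the same neighbours, second and third neighbours inside a net for the
common neighbourhoods are twins. -/
theorem adj_of_forall_net_iff [Nonempty V] (hε : 0 < ε)
    (hd : ∀ v, (1 / 5 + ε) * Fintype.card V ≤ #(G.neighborFinset v))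
    (h3 : ∀ a b c, G.Adj a b → G.Adj b c → ¬ G.Adj a c)
    (h5 : ∀ a b c d e, G.Adj a b → G.Adj b c → G.Adj c d → G.Adj d e → ¬ G.Adj e a)
    (hmax : ∀ u v, ¬ G.Adj u v → ∃ a b c, G.Adj u a ∧ G.Adj a b ∧ G.Adj b c ∧ G.Adj c v)
    {α : Type*} {X : α → V}
    (hX : ∀ p q, ε * Fintype.card V ≤ #(G.neighborFinset p ∩ G.neighborFinset q) →
        ∃ j, G.Adj p (X j) ∧ G.Adj q (X j))
    {u v : V} (h1 : ∀ j, G.Adj v (X j) → G.Adj u (X j))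
    (h2 : ∀ j, (∃ a, G.Adj v a ∧ G.Adj a (X j)) → ∃ a, G.Adj u a ∧ G.Adj a (X j))
    (h3' : ∀ j, (∃ a b, G.Adj v a ∧ G.Adj a b ∧ G.Adj b (X j)) →
      ∃ a b, G.Adj u a ∧ G.Adj a b ∧ G.Adj b (X j))
    {w : V} (huw : G.Adj u w) : G.Adj v w := by
  by_contra hvw
  obtain ⟨a, b, c, hva, hab, hbc, hcw⟩ := hmax v w hvw
  have hsum := five_mul_le_sum_card_inter_neighborFinset hd v a b c w
  rw [card_inter_neighborFinset_eq_zero fun y hy hy' => h3 _ _ _ hva hy' hy,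
    card_inter_neighborFinset_eq_zero fun y hy hy' => h3 _ _ _ hab hy' hy,
    card_inter_neighborFinset_eq_zero fun y hy hy' => h3 _ _ _ hbc hy' hy,
    card_inter_neighborFinset_eq_zero fun y hy hy' => h3 _ _ _ hcw hy' hy,
    card_inter_neighborFinset_eq_zero fun y hy hy' => h5 _ _ _ _ _ hva hab hbc hy' hy.symm,
    card_inter_neighborFinset_eq_zero fun y hy hy' => h5 _ _ _ _ _ hab hbc hcw hy' hy.symm]
    at hsum
  push_cast at hsum
  have hV : 0 < ε * Fintype.card V := mul_pos hε (by exact_mod_cast Fintype.card_pos)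
  rcases le_or_gt (ε * Fintype.card V) #(G.neighborFinset v ∩ G.neighborFinset b) with h | hvb
  · obtain ⟨j, hj, hj'⟩ := hX _ _ h
    exact h5 _ _ _ _ _ (h1 j hj) hj'.symm hbc hcw huw.symm
  rcases le_or_gt (ε * Fintype.card V) #(G.neighborFinset v ∩ G.neighborFinset w) with h | hvw'
  · obtain ⟨j, hj, hj'⟩ := hX _ _ h
    exact h3 _ _ _ (h1 j hj) hj'.symm huw
  rcases le_or_gt (ε * Fintype.card V) #(G.neighborFinset a ∩ G.neighborFinset c) with h | hac
  · obtain ⟨j, hj, hj'⟩ := hX _ _ h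
    obtain ⟨a', ha, ha'⟩ := h2 j ⟨a, hva, hj⟩
    exact h5 _ _ _ _ _ ha ha' hj'.symm hcw huw.symm
  rcases le_or_gt (ε * Fintype.card V) #(G.neighborFinset b ∩ G.neighborFinset w) with h | hbw
  · obtain ⟨j, hj, hj'⟩ := hX _ _ h
    obtain ⟨a', b', ha, hb, hb'⟩ := h3' j ⟨a, b, hva, hab, hj⟩
    exact h5 _ _ _ _ _ ha hb hb' hj'.symm huw.symm
  linarith

end

theorem two_mul_pow_lt_two_pow {k : ℕ} (hk : 350 ≤ k) : 2 * k ^ 64 < 2 ^ k * 30000 ^ 16 := by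
  induction k, hk using Nat.le_induction with
  | base =>
    rw [show 350 = 175 + 175 from rfl, pow_add 2]
    norm_num
  | succ k hk ih =>
    have h1 : (350 * (k + 1)) ^ 64 ≤ (351 * k) ^ 64 := Nat.pow_le_pow_left (by omega) _
    rw [mul_pow, mul_pow] at h1
    have h2 : 351 ^ 64 ≤ 2 * 350 ^ 64 := by norm_num
    have h3 : (k + 1) ^ 64 ≤ 2 * k ^ 64 := by
      have : 350 ^ 64 * (k + 1) ^ 64 ≤ 350 ^ 64 * (2 * k ^ 64) := by
        calc _ ≤ 351 ^ 64 * k ^ 64 := h1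
          _ ≤ 2 * 350 ^ 64 * k ^ 64 := Nat.mul_le_mul_right _ h2
          _ = _ := by ring
      exact Nat.le_of_mul_le_mul_left this (by positivity)
    rw [pow_succ 2 k]
    linarith

theorem exists_block_parameters {ε : ℝ} (hε : 0 < ε) (hε1 : ε ≤ 1) :
    ∃ k r : ℕ, 2 * k ≤ r * ε ∧ 2 * ((k * (2 * r) + 1) ^ 8) ^ 2 < 2 ^ k ∧
      3 * (k * r : ℝ) ≤ (1000 / ε) ^ 2 := by
  set s := Real.sqrt (1 / ε) with hs
  have hs2 : s ^ 2 = 1 / ε := Real.sq_sqrt (by positivity)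
  have hs1 : 1 ≤ s := by
    rw [hs, Real.one_le_sqrt, le_div_iff₀ hε]
    linarith
  obtain ⟨k, hk, hk'⟩ : ∃ k : ℕ, 350 * s ≤ k ∧ (k : ℝ) ≤ 351 * s :=
    ⟨_, Nat.le_ceil _, by linarith [Nat.ceil_lt_add_one (by positivity : 0 ≤ 350 * s)]⟩
  obtain ⟨r, hr, hr'⟩ : ∃ r : ℕ, 2 * k * s ^ 2 ≤ r ∧ (r : ℝ) ≤ 2 * k * s ^ 2 + 1 :=
    ⟨_, Nat.le_ceil _, (Nat.ceil_lt_add_one (by positivity)).le⟩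
  have hkR : (350 : ℝ) ≤ k := by linarith
  refine ⟨k, r, ?_, ?_, ?_⟩
  · rw [hs2, mul_one_div, div_le_iff₀ hε] at hr
    exact hr
  · have hsk : s ^ 2 ≤ (k : ℝ) ^ 2 / 122500 := by
      have := pow_le_pow_left₀ (by positivity) hk 2
      linarith
    have hrk : (r : ℝ) ≤ k ^ 3 / 61250 + 1 := by
      have := mul_le_mul_of_nonneg_left hsk (by positivity : 0 ≤ 2 * (k : ℝ))
      linarith
    have hM : (k * (2 * r) + 1 : ℝ) ≤ k ^ 4 / 30000 := by
      have h1 := mul_le_mul_of_nonneg_left hrk (by positivity : 0 ≤ 2 * (k : ℝ))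
      have h2 : (350 : ℝ) ^ 3 * k ≤ k ^ 3 * k := by gcongr
      linarith
    have hM' : (k * (2 * r) + 1) * 30000 ≤ k ^ 4 := by
      rw [le_div_iff₀ (by norm_num)] at hM
      exact_mod_cast hM
    have hpow := Nat.pow_le_pow_left hM' 16
    have hlt := two_mul_pow_lt_two_pow (k := k) (by exact_mod_cast hkR)
    rw [mul_pow, ← pow_mul] at hpow
    rw [← pow_mul]
    refine Nat.lt_of_mul_lt_mul_right (a := 30000 ^ 16) ?_
    calc _ ≤ 2 * k ^ 64 := by
          rw [mul_assoc]
          exact Nat.mul_le_mul_left 2 hpow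
      _ < _ := hlt
  · have h1 : (r : ℝ) ≤ 703 * s ^ 3 := by
      have := mul_le_mul_of_nonneg_right hk' (by positivity : 0 ≤ 2 * s ^ 2)
      have := one_le_pow₀ hs1 (n := 3)
      linarith
    calc 3 * (k * r : ℝ) ≤ 3 * (351 * s * (703 * s ^ 3)) := by gcongr
      _ = 740259 * (s ^ 2) ^ 2 := by ring
      _ ≤ 1000000 * (s ^ 2) ^ 2 := by gcongr; norm_num
      _ = _ := by rw [hs2]; ring

/-- If vertices with equal labels are twins, the graph is a blowup of a graph on the labels. -/
theorem isBlowupOf_range {V L : Type*} {G : SimpleGraph V} (sig : V → L)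
    (h : ∀ u v w, sig u = sig v → G.Adj u w → G.Adj v w) :
    ∃ H : SimpleGraph (Set.range sig), IsBlowupOf G H := by
  refine ⟨⟨fun p q => ∃ u v, sig u = p ∧ sig v = q ∧ G.Adj u v, ⟨?_⟩, ⟨?_⟩⟩,
    Set.rangeFactorization sig, Set.rangeFactorization_surjective,
    fun u v _ => ⟨fun huv => ⟨u, v, rfl, rfl, huv⟩, ?_⟩⟩
  · rintro p q ⟨u, v, hu, hv, huv⟩
    exact ⟨v, u, hv, hu, huv.symm⟩
  · rintro p ⟨u, v, hu, hv, huv⟩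
    exact G.irrefl (h u v v (hu.trans hv.symm) huv)
  · rintro ⟨u', v', hu, hv, huv⟩
    exact (h v' v u hv (h u' u v' hu huv).symm).symm

/-- Theorem 4.2 (C₅ warm-up): for every `ε > 0`, every sufficiently large `n`-vertex
maximal `C₅`-free graph with minimum degree at least `(1/5 + ε)·n` is a blowup of
a graph on at most `2^{(1000/ε)²}` vertices. -/
theorem c5_blowup (ε : ℝ) (hε : 0 < ε) :
    ∃ n₀ : ℕ, ∀ (V : Type) [Fintype V], n₀ ≤ Nat.card V →
      ∀ G : SimpleGraph V, MaximalCLFree G 5 →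
        (∀ v : V, ((1 : ℝ) / 5 + ε) * (Nat.card V) ≤ (G.neighborSet v).ncard) →
        ∃ (W : Type) (_ : Finite W) (H : SimpleGraph W),
          (Nat.card W : ℝ) ≤ (2 : ℝ) ^ (((1000 : ℝ) / ε) ^ 2) ∧ IsBlowupOf G H := by
  classical
  refine ⟨⌈100 / ε⌉₊, fun V _ hn G ⟨hfree, hmax⟩ hdeg => ?_⟩
  have hn' : 100 ≤ ε * Fintype.card V := by
    rw [Nat.card_eq_fintype_card] at hn
    have := (div_le_iff₀ hε).1 (Nat.ceil_le.1 hn)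
    linarith
  have hV : 0 < (Fintype.card V : ℝ) := pos_of_mul_pos_right (by linarith) hε.le
  have : Nonempty V := Fintype.card_pos_iff.1 (by exact_mod_cast hV)
  have hd (v) : (1 / 5 + ε) * Fintype.card V ≤ (G.neighborFinset v).card := by
    have := hdeg v
    rwa [Nat.card_eq_fintype_card, ← coe_neighborFinset, Set.ncard_coe_finset] at this
  have hε1 : ε ≤ 1 := by
    obtain ⟨v⟩ := this
    have h1 : ((G.neighborFinset v).card : ℝ) ≤ Fintype.card V := by
      exact_mod_cast Finset.card_le_univ _
    have := hd v
    nlinarith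
  have hcyc : ∀ a b c d e, [a, b, c, d, e].Nodup → G.Adj a b → G.Adj b c → G.Adj c d →
      G.Adj d e → ¬ G.Adj e a := fun a b c d e hnd h1 h2 h3 h4 h5 =>
    hfree ((hasCycleOfLength_five_iff G).2 ⟨a, b, c, d, e, hnd, h1, h2, h3, h4, h5⟩)
  have h3 := triangle_free_of_five_cycle_free hcyc hd
    (by convert hn')
  have h5 := no_closed_five_walk hcyc h3
  have hwalk (u v) (huv : ¬ G.Adj u v) :
      ∃ a b c, G.Adj u a ∧ G.Adj a b ∧ G.Adj b c ∧ G.Adj c v := by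
    by_cases h : u = v
    · subst h
      have : 0 < (G.neighborFinset u).card := by
        have := (by positivity : 0 < (1 / 5 + ε) * Fintype.card V).trans_le (hd u)
        exact_mod_cast this
      obtain ⟨a, ha⟩ := Finset.card_pos.1 this
      rw [mem_neighborFinset] at ha
      exact ⟨a, u, a, ha, ha.symm, ha, ha.symm⟩
    · exact exists_four_walk hfree (hmax u v h huv)
  obtain ⟨k, r, hkr, hk, hcard⟩ := exists_block_parameters hε hε1
  obtain ⟨X, hX⟩ := exists_net_inter_neighborFinset hε hε1 hd h5 hwalk hkr hk
  let sig (v : V) (j : Fin k × Fin r) : Prop × Prop × Prop :=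
    (G.Adj v (X j), ∃ a, G.Adj v a ∧ G.Adj a (X j),
      ∃ a b, G.Adj v a ∧ G.Adj a b ∧ G.Adj b (X j))
  obtain ⟨H, hH⟩ := isBlowupOf_range (G := G) sig fun u v w huv huw => by
    have hj (j) := congrFun huv j
    simp only [sig, Prod.mk.injEq, eq_iff_iff] at hj
    exact adj_of_forall_net_iff hε hd h3 h5 hwalk hX (fun j => (hj j).1.2)
      (fun j => (hj j).2.1.2) (fun j => (hj j).2.2.2) huw
  refine ⟨Set.range sig, inferInstance, H, ?_, hH⟩
  have hW : Nat.card (Set.range sig) ≤ 2 ^ (3 * (k * r)) := by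
    refine (Finite.card_subtype_le _).trans (le_of_eq ?_)
    simp [pow_mul]
  calc (Nat.card (Set.range sig) : ℝ) ≤ (2 : ℝ) ^ (3 * (k * r)) := by exact_mod_cast hW
    _ = (2 : ℝ) ^ (3 * (k * r : ℝ)) := by rw [← Real.rpow_natCast]; push_cast; rfl
    _ ≤ _ := Real.rpow_le_rpow_of_exponent_le one_le_two hcard
end

section
/- Homomorphism consequence of Lemma 4.7, condition (1): For every integer k ≥ 3, every ε > 0 and every integer d ≥ 1, there exists a constant C = C(k,ε,d) such that the following holds. If G is a finite simple graph on n vertices containing no cycle of length 2k−1 and no cycle of length 2k−3, with VC-dimension at most d and minimum degree δ(G) ≥ (1/(2k−1) + 2kε)·n, then there exists a graph H with at most C vertices containing no cycle of length 2k−1, together with a graph homomorphism from G to H. -/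
open SimpleGraph

/-- The VC-dimension of `G` is at most `d`: every shattered set has size at most `d`. -/
def VCdimLE {V : Type*} (G : SimpleGraph V) (d : ℕ) : Prop :=
  ∀ S : Set V, Shattered G S → S.ncard ≤ d

open Finset in
open scoped Classical in
lemma card_traces_le {V : Type*} [Fintype V] {G : SimpleGraph V} {d : ℕ} (hG : VCdimLE G d)
    {m : ℕ} (f : Fin m → V) :
    #(univ.image fun v : V ↦ univ.filter fun t ↦ G.Adj v (f t)) ≤ (d + 1) * (m + 1) ^ d := by
  set A := univ.image fun v : V ↦ univ.filter fun t ↦ G.Adj v (f t) with hA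
  have hvc : A.vcDim ≤ d := by
    refine Finset.sup_le fun s hs ↦ ?_
    rw [mem_shatterer] at hs
    have htrace : ∀ t ⊆ s, ∃ v : V, ∀ x ∈ s, G.Adj v (f x) ↔ x ∈ t := by
      intro t ht
      obtain ⟨u, hu, hut⟩ := hs ht
      obtain ⟨v, -, rfl⟩ := mem_image.1 hu
      refine ⟨v, fun x hx ↦ ?_⟩
      rw [← hut]
      simp [hx]
    have hinj : Set.InjOn f s := by
      intro x hx y hy hxy
      obtain ⟨v, hv⟩ := htrace {x} (by simpa using hx)
      have h := hv y hy
      rw [← hxy, hv x hx] at h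
      simpa [eq_comm] using h
    have hsh : Shattered G (f '' s) := by
      intro S' hS'
      obtain ⟨v, hv⟩ := htrace (s.filter fun x ↦ f x ∈ S') (filter_subset _ _)
      refine ⟨v, Set.ext fun z ↦ ⟨?_, fun hz ↦ ?_⟩⟩
      · rintro ⟨hz, x, hx, rfl⟩
        exact (mem_filter.1 ((hv x hx).1 hz)).2
      · obtain ⟨x, hx, rfl⟩ := hS' hz
        exact ⟨(hv x hx).2 (mem_filter.2 ⟨hx, hz⟩), x, hx, rfl⟩
    simpa [hinj.ncard_image] using hG _ hsh
  calc #A ≤ #A.shatterer := card_le_card_shatterer A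
    _ ≤ ∑ k ∈ Iic A.vcDim, (Fintype.card (Fin m)).choose k := card_shatterer_le_sum_vcDim
    _ ≤ ∑ k ∈ Iic d, (m + 1) ^ d := by
        refine (sum_le_sum_of_subset (Iic_subset_Iic.2 hvc)).trans (sum_le_sum fun k hk ↦ ?_)
        rw [Fintype.card_fin]
        calc m.choose k ≤ m ^ k := Nat.choose_le_pow m k
          _ ≤ (m + 1) ^ k := Nat.pow_le_pow_left (by omega) k
          _ ≤ (m + 1) ^ d := Nat.pow_le_pow_right (by omega) (mem_Iic.1 hk)
    _ = (d + 1) * (m + 1) ^ d := by simp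

lemma exists_sample_size (d : ℕ) {η : ℝ} (hη : 0 < η) (hη1 : η < 1) :
    ∃ m : ℕ, (((d + 1) * (m + 1) ^ d + 1 : ℕ) : ℝ) ^ 2 * (1 - η) ^ m < 1 := by
  have h := tendsto_pow_const_mul_const_pow_of_lt_one (2 * d) (r := 1 - η)
    (by linarith) (by linarith)
  have h2 := ((h.comp (Filter.tendsto_add_atTop_nat 1)).const_mul
    (((d : ℝ) + 2) ^ 2 * (1 - η)⁻¹))
  rw [mul_zero] at h2
  obtain ⟨m, hm⟩ := (h2.eventually_lt_const one_pos).exists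
  refine ⟨m, lt_of_le_of_lt ?_ hm⟩
  have hpos : (0 : ℝ) < 1 - η := by linarith
  have h1 : (1 : ℝ) ≤ ((m : ℝ) + 1) ^ d := one_le_pow₀ (by linarith [m.cast_nonneg (α := ℝ)])
  have hle : (((d + 1) * (m + 1) ^ d + 1 : ℕ) : ℝ) ≤ ((d : ℝ) + 2) * ((m : ℝ) + 1) ^ d := by
    push_cast
    linarith
  calc (((d + 1) * (m + 1) ^ d + 1 : ℕ) : ℝ) ^ 2 * (1 - η) ^ m
      ≤ (((d : ℝ) + 2) * ((m : ℝ) + 1) ^ d) ^ 2 * (1 - η) ^ m := by gcongr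
    _ = _ := by
      simp only [Function.comp]
      push_cast
      rw [pow_succ (1 - η) m, mul_pow, ← pow_mul, mul_comm d 2]
      field_simp

open Finset in
open scoped Classical in
lemma exists_separating_sample {V : Type*} [Fintype V] [Nonempty V] {U : Finset V}
    {D : V → V → Finset V} {η : ℝ} (hη1 : η < 1) {m : ℕ}
    (hm : (#U : ℝ) ^ 2 * (1 - η) ^ m < 1)
    (hD : ∀ u ∈ U, ∀ v ∈ U, u ≠ v → η * Fintype.card V ≤ #(D u v)) :
    ∃ f : Fin m → V, ∀ u ∈ U, ∀ v ∈ U, u ≠ v → ∃ t, f t ∈ D u v := by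
  by_contra! hcon
  set n := Fintype.card V with hn
  have hn0 : (0 : ℝ) < n := by exact_mod_cast Fintype.card_pos
  have hcover : (univ : Finset (Fin m → V)) ⊆
      U.offDiag.biUnion fun p ↦ Fintype.piFinset fun _ ↦ (D p.1 p.2)ᶜ := by
    intro f _
    obtain ⟨u, hu, v, hv, huv, h⟩ := hcon f
    refine mem_biUnion.2 ⟨(u, v), by simp [hu, hv, huv], ?_⟩
    simpa using h
  have h1 : (n : ℝ) ^ m ≤ ∑ p ∈ U.offDiag, ((1 - η) * n) ^ m := by
    calc (n : ℝ) ^ m = #(univ : Finset (Fin m → V)) := by simp [hn]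
      _ ≤ ∑ p ∈ U.offDiag, (#(Fintype.piFinset fun _ : Fin m ↦ (D p.1 p.2)ᶜ) : ℝ) := by
        exact_mod_cast (card_le_card hcover).trans card_biUnion_le
      _ ≤ _ := by
        refine sum_le_sum fun p hp ↦ ?_
        rw [mem_offDiag] at hp
        have := hD p.1 hp.1 p.2 hp.2.1 hp.2.2
        have hc : (#((D p.1 p.2)ᶜ) : ℝ) = n - #(D p.1 p.2) := by
          rw [card_compl, Nat.cast_sub (card_le_univ _)]
        rw [Fintype.card_piFinset_const]
        push_cast
        gcongr
        rw [hc]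
        linarith
  have h2 : (#U.offDiag : ℝ) ≤ (#U : ℝ) ^ 2 := by
    rw [offDiag_card, sq]
    exact_mod_cast Nat.sub_le _ _
  rw [sum_const, nsmul_eq_mul, mul_pow, ← mul_assoc] at h1
  have h3 : (#U.offDiag : ℝ) * (1 - η) ^ m < 1 :=
    lt_of_le_of_lt (by gcongr) hm
  have h4 : (0 : ℝ) < (n : ℝ) ^ m := by positivity
  nlinarith

/-- A weak form of Haussler's packing lemma: in a graph of bounded VC-dimension, the vertices fall
into boundedly many groups of vertices with almost equal neighbourhoods. -/
lemma exists_coloring_neighborSet_diff_le (d : ℕ) {ε : ℝ} (hε : 0 < ε) :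
    ∃ K : ℕ, 0 < K ∧ ∀ (V : Type) [Fintype V] (G : SimpleGraph V), VCdimLE G d →
      ∃ col : V → Fin K, ∀ u v, col u = col v →
        ((G.neighborSet u \ G.neighborSet v).ncard : ℝ) ≤ ε * Fintype.card V := by
  classical
  set η := min (ε / 2) (1 / 2) with hηdef
  have hη : 0 < η := by positivity
  have hη1 : η < 1 := lt_of_le_of_lt (min_le_right _ _) (by norm_num)
  have hηε : 2 * η ≤ ε := by linarith [min_le_left (ε / 2) (1 / 2)]
  obtain ⟨m, hm⟩ := exists_sample_size d hη hη1
  set K := (d + 1) * (m + 1) ^ d + 1 with hK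
  refine ⟨K, by omega, fun V _ G hG ↦ ?_⟩
  rcases isEmpty_or_nonempty V with hV | hV
  · exact ⟨fun v ↦ (hV.false v).elim, fun v ↦ (hV.false v).elim⟩
  let D : V → V → Finset V := fun u v ↦ Finset.univ.filter fun z ↦ ¬ (G.Adj u z ↔ G.Adj v z)
  let sep : Finset V → Prop := fun U ↦
    ∀ u ∈ U, ∀ v ∈ U, u ≠ v → η * Fintype.card V ≤ (D u v).card
  have hsep : ∀ U, sep U → U.card < K := by
    intro U hU
    by_contra! hcard
    obtain ⟨U', hU'U, hU'⟩ := Finset.exists_subset_card_eq hcard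
    obtain ⟨f, hf⟩ := exists_separating_sample (U := U') (D := D) hη1 (by rw [hU']; exact hm)
      fun u hu v hv huv ↦ hU u (hU'U hu) v (hU'U hv) huv
    have h1 := card_traces_le hG f
    have h2 : U'.card ≤ (Finset.univ.image
        fun v : V ↦ Finset.univ.filter fun t ↦ G.Adj v (f t)).card := by
      refine Finset.card_le_card_of_injOn _ (fun v _ ↦ Finset.mem_image_of_mem _ (Finset.mem_univ v)) ?_
      intro u hu v hv huv
      by_contra hne
      obtain ⟨t, ht⟩ := hf u hu v hv hne
      have := congrArg (t ∈ ·) huv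
      simp [D] at this ht
      tauto
    omega
  obtain ⟨U, hU, hmax⟩ := Finset.exists_max_image
    (Finset.univ.filter sep) Finset.card ⟨∅, by simp [sep]⟩
  have hUs : sep U := (Finset.mem_filter.1 hU).2
  have hUK := hsep U hUs
  have hDcomm : ∀ u v, D u v = D v u := fun u v ↦ by
    ext z
    simp only [D, Finset.mem_filter, Finset.mem_univ, true_and]
    tauto
  have hnear : ∀ v, ∃ c : U, ((D v c).card : ℝ) ≤ η * Fintype.card V := by
    intro v
    by_contra! hfar
    have hv : v ∉ U := fun hv ↦ by
      have := hfar ⟨v, hv⟩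
      simp only [D, not_true_eq_false, Finset.filter_false, Finset.card_empty] at this
      have : 0 ≤ η * Fintype.card V := by positivity
      norm_num at *
      linarith
    have := hmax (insert v U) (Finset.mem_filter.2 ⟨Finset.mem_univ _, ?_⟩)
    · rw [Finset.card_insert_of_notMem hv] at this
      omega
    · intro u hu w hw huw
      rw [Finset.mem_insert] at hu hw
      rcases hu with rfl | hu <;> rcases hw with rfl | hw
      · exact absurd rfl huw
      · exact (hfar ⟨w, hw⟩).le
      · rw [hDcomm]
        exact (hfar ⟨u, hu⟩).le
      · exact hUs u hu w hw huw
  choose c hc using hnear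
  obtain ⟨e⟩ : Nonempty (U ↪ Fin K) := by
    rw [Function.Embedding.nonempty_iff_card_le]
    simpa using hUK.le
  refine ⟨fun v ↦ e (c v), fun u v huv ↦ ?_⟩
  have huv' : c u = c v := e.injective huv
  have hsub : G.neighborSet u \ G.neighborSet v ⊆ ((D u (c u) ∪ D v (c v) : Finset V) : Set V) := by
    rintro z ⟨hz, hz'⟩
    rw [mem_neighborSet] at hz hz'
    simp only [D, huv', Finset.coe_union, Set.mem_union, Finset.mem_coe, Finset.mem_filter,
      Finset.mem_univ, true_and]
    tauto
  have h1 := Set.ncard_le_ncard hsub (Finset.finite_toSet _)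
  rw [Set.ncard_coe_finset] at h1
  have h2 : ((G.neighborSet u \ G.neighborSet v).ncard : ℝ) ≤
      (D u (c u)).card + (D v (c v)).card := by
    exact_mod_cast h1.trans (Finset.card_union_le _ _)
  have h3 : (2 * η) * (Fintype.card V : ℝ) ≤ ε * Fintype.card V := by gcongr
  linarith [hc u, hc v]

namespace SimpleGraph

lemma Walk.IsPath.isCycle_cons {V : Type*} {G : SimpleGraph V} {u v : V} {p : G.Walk v u}
    (hp : p.IsPath) (h : G.Adj u v) (hlen : 2 ≤ p.length) : (Walk.cons h p).IsCycle := by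
  refine (Walk.cons_isCycle_iff p h).2 ⟨hp, fun hmem ↦ ?_⟩
  have := hp.length_eq_one_of_mem_edges (Sym2.eq_swap ▸ hmem)
  omega

end SimpleGraph

lemma Set.exists_mem_notMem_list {V : Type*} {s : Set V} {l : List V} (h : l.length < s.ncard) :
    ∃ x ∈ s, x ∉ l := by
  classical
  by_contra! hcon
  have h1 : s ⊆ (l.toFinset : Set V) := fun x hx ↦ by simpa using hcon x hx
  have h2 := Set.ncard_le_ncard h1 (Finset.finite_toSet _)
  rw [Set.ncard_coe_finset] at h2
  have := l.toFinset_card_le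
  omega

lemma exists_longer_path {V : Type*} {G : SimpleGraph V} {Z : Set V} {m : ℕ} (hZ : m ≤ Z.ncard)
    (hcom : ∀ z ∈ Z, ∀ z' ∈ Z, m ≤ (G.commonNeighbors z z').ncard) {b : V} (j : ℕ) :
    ∀ {z : V} (p : G.Walk z b), z ∈ Z → p.IsPath → p.length + 2 * j < m →
      ∃ z' ∈ Z, ∃ q : G.Walk z' b, q.IsPath ∧ q.length = p.length + 2 * j := by
  induction j with
  | zero => exact fun {z} p hz hp _ ↦ ⟨z, hz, p, hp, rfl⟩
  | succ j ih =>
    intro z p hz hp hm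
    obtain ⟨z', hz', hz'p⟩ := Set.exists_mem_notMem_list (s := Z) (l := p.support)
      (by rw [Walk.length_support]; omega)
    have hzz' := hcom z hz z' hz'
    obtain ⟨x, ⟨hzx, hz'x⟩, hx⟩ := Set.exists_mem_notMem_list (s := G.commonNeighbors z z')
      (l := z' :: p.support) (by rw [List.length_cons, Walk.length_support]; omega)
    rw [mem_neighborSet] at hzx hz'x
    rw [List.mem_cons, not_or] at hx
    obtain ⟨w, hw, q, hq, hlen⟩ := ih (.cons hz'x (.cons hzx.symm p)) hz'
      (by simp [Walk.cons_isPath_iff, hp, hx.2, hz'p, Ne.symm hx.1])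
      (by simp only [Walk.length_cons]; omega)
    refine ⟨w, hw, q, hq, ?_⟩
    simp only [Walk.length_cons] at hlen
    omega

/-- Two vertices with many common neighbours which are joined by a short path of odd length lie on
an odd cycle of any prescribed greater length. -/
lemma hasCycleOfLength_of_odd_path {V : Type*} [Fintype V] {G : SimpleGraph V} {k K : ℕ}
    {col : V → Fin K}
    (hcol : ∀ u v, col u = col v → K * (2 * k) ≤ (G.commonNeighbors u v).ncard)
    {a b : V} (p : G.Walk a b) (hp : p.IsPath) (hodd : Odd p.length) (hlen : p.length + 3 ≤ 2 * k)
    (hab : K * (2 * k) ≤ (G.commonNeighbors a b).ncard) :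
    HasCycleOfLength G (2 * k - 1) := by
  classical
  have hK : 0 < K := (col a).pos
  obtain ⟨c, -, hc⟩ := Finset.exists_le_card_fiber_of_mul_le_card_of_maps_to
    (s := (G.commonNeighbors a b).toFinset) (t := Finset.univ) (f := col) (n := 2 * k)
    (fun _ _ ↦ Finset.mem_univ _) ⟨col a, Finset.mem_univ _⟩
    (by rwa [Finset.card_univ, Fintype.card_fin, ← Set.ncard_eq_toFinset_card'])
  set Z : Set V := {z ∈ G.commonNeighbors a b | col z = c} with hZdef
  have hZ : 2 * k ≤ Z.ncard := by
    rw [← Set.ncard_coe_finset] at hc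
    convert hc using 2
    ext z
    simp [hZdef]
  have hcom : ∀ z ∈ Z, ∀ z' ∈ Z, 2 * k ≤ (G.commonNeighbors z z').ncard := fun z hz z' hz' ↦
    (Nat.le_mul_of_pos_left _ hK).trans (hcol z z' (hz.2.trans hz'.2.symm))
  obtain ⟨z, hz, hzp⟩ := Set.exists_mem_notMem_list (s := Z) (l := p.support)
    (by rw [Walk.length_support]; omega)
  obtain ⟨r, hr⟩ := hodd
  obtain ⟨w, hw, q, hq, hqlen⟩ := exists_longer_path hZ hcom (k - 2 - r)
    (.cons (G.adj_symm hz.1.1) p) hz (hp.cons hzp) (by rw [Walk.length_cons]; omega)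
  rw [Walk.length_cons] at hqlen
  have hbw : G.Adj b w := hw.1.2
  exact ⟨b, .cons hbw q, hq.isCycle_cons _ (by omega), by rw [Walk.length_cons]; omega⟩

lemma exists_walk_of_adj {V : Type*} {G : SimpleGraph V} (n : ℕ) :
    ∀ v : ℕ → V, (∀ t < n, G.Adj (v t) (v (t + 1))) →
      ∃ p : G.Walk (v 0) (v n), p.length = n ∧ ∀ t ≤ n, p.getVert t = v t := by
  induction n with
  | zero => exact fun v _ ↦ ⟨.nil, rfl, fun t ht ↦ by simp [Nat.le_zero.1 ht]⟩
  | succ n ih =>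
    intro v hv
    obtain ⟨p, hp, hpv⟩ := ih (fun t ↦ v (t + 1)) fun t ht ↦ hv (t + 1) (by omega)
    refine ⟨.cons (hv 0 (by omega)) p, by simp [hp], fun t ht ↦ ?_⟩
    cases t with
    | zero => simp
    | succ t => simpa using hpv t (by omega)

lemma exists_path_of_injOn {V : Type*} {G : SimpleGraph V} {n : ℕ} {v : ℕ → V}
    (hv : ∀ t < n, G.Adj (v t) (v (t + 1))) (hinj : Set.InjOn v {t | t ≤ n}) :
    ∃ p : G.Walk (v 0) (v n), p.IsPath ∧ p.length = n := by
  obtain ⟨p, hp, hpv⟩ := exists_walk_of_adj n v hv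
  refine ⟨p, (Walk.IsPath.getVert_injOn_iff p).1 fun i hi j hj hij ↦ ?_, hp⟩
  rw [Set.mem_ofPred_eq, hp] at hi hj
  rw [hpv i hi, hpv j hj] at hij
  exact hinj hi hj hij

/-- A walk of odd length either contains a path of odd length between its ends, or it visits twice
a vertex of a short odd cycle. -/
lemma exists_odd_path_or_odd_cycle {V : Type*} {G : SimpleGraph V} (n : ℕ) :
    ∀ v : ℕ → V, Odd n → (∀ t < n, G.Adj (v t) (v (t + 1))) →
      (∃ p : G.Walk (v 0) (v n), p.IsPath ∧ Odd p.length ∧ p.length ≤ n) ∨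
      ∃ s t, s < t ∧ t ≤ n ∧ v s = v t ∧
        ∃ c : G.Walk (v s) (v s), c.IsCycle ∧ Odd c.length ∧ c.length ≤ n := by
  induction n using Nat.strong_induction_on with
  | _ n ih =>
    intro v hn hv
    by_cases hrep : ∃ i j, i < j ∧ j ≤ n ∧ v i = v j ∧ j - i < n
    · obtain ⟨i, j, hij, hj, hvij, hlt⟩ := hrep
      rcases Nat.even_or_odd (j - i) with hpar | hpar
      · set r : ℕ → V := fun t ↦ if t ≤ i then v t else v (t + (j - i)) with hr
        have hr0 : r 0 = v 0 := by simp [hr]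
        have hrn : r (n - (j - i)) = v n := by
          simp only [hr]
          split_ifs with h
          · rw [show n - (j - i) = i by omega, hvij, show j = n by omega]
          · rw [Nat.sub_add_cancel (by omega)]
        have hadj : ∀ t < n - (j - i), G.Adj (r t) (r (t + 1)) := by
          intro t ht
          simp only [hr]
          rcases lt_trichotomy t i with h | rfl | h
          · simpa [h.le, Nat.succ_le_of_lt h] using hv t (by omega)
          · have := hv j (by omega)
            simpa [hvij, show t + 1 + (j - t) = j + 1 by omega] using this
          · have := hv (t + (j - i)) (by omega)
            rw [if_neg (by omega), if_neg (by omega)]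
            rwa [show t + 1 + (j - i) = t + (j - i) + 1 by omega]
        have hodd : Odd (n - (j - i)) := by
          rw [Nat.odd_iff] at hn ⊢
          rw [Nat.even_iff] at hpar
          omega
        rcases ih _ (by omega) r hodd hadj with ⟨p, hp, hpo, hpl⟩ | ⟨s, t, hst, ht, hrst, c, hc, hco, hcl⟩
        · exact .inl ⟨p.copy hr0 hrn, by simpa using hp, by simpa using hpo,
            by rw [Walk.length_copy]; omega⟩
        · have hpos : ∀ t, r t = v (if t ≤ i then t else t + (j - i)) := fun t ↦ by
            simp only [hr]; split_ifs <;> rfl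
          refine .inr ⟨_, _, ?_, ?_, (hpos s).symm.trans (hrst.trans (hpos t)),
            c.copy (hpos s) (hpos s), by simpa using hc, by simpa using hco,
            by rw [Walk.length_copy]; omega⟩
          · split_ifs <;> omega
          · split_ifs <;> omega
      · rcases ih (j - i) hlt (fun t ↦ v (i + t)) hpar (fun t ht ↦ hv (i + t) (by omega)) with
          ⟨p, hp, hpo, -⟩ | ⟨s, t, hst, ht, hvst, c, hc, hco, hcl⟩
        · have heq : v (i + (j - i)) = v (i + 0) := by
            rw [show i + (j - i) = j by omega, Nat.add_zero, hvij]
          have hnil : (p.copy rfl heq).length = 0 :=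
            Walk.length_eq_zero_iff.2 (Walk.isPath_iff_nil.1 (by rwa [Walk.isPath_copy]))
          rw [Walk.length_copy] at hnil
          simp [hnil] at hpo
        · exact .inr ⟨i + s, i + t, by omega, by omega, hvst, c, hc, hco, by omega⟩
    · push Not at hrep
      by_cases hends : v 0 = v n
      · right
        refine ⟨0, n, hn.pos, le_rfl, hends, ?_⟩
        obtain ⟨m, rfl⟩ : ∃ m, n = m + 1 := ⟨n - 1, by have := hn.pos; omega⟩
        obtain ⟨p, hp, hpl⟩ := exists_path_of_injOn (n := m) (v := fun t ↦ v (t + 1))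
          (fun t ht ↦ hv (t + 1) (by omega)) (by
            intro i hi j hj hij
            rw [Set.mem_ofPred_eq] at hi hj
            by_contra hne
            rcases Nat.lt_or_gt_of_ne hne with h | h
            · have := hrep (i + 1) (j + 1) (by omega) (by omega) hij
              omega
            · have := hrep (j + 1) (i + 1) (by omega) (by omega) hij.symm
              omega)
        have hm : 2 ≤ m := by
          rcases Nat.lt_or_ge m 2 with h | h
          · interval_cases m
            · exact absurd hends (hv 0 (by omega)).ne
            · exact absurd hn (by decide)
          · exact h
        have hp' : (p.copy rfl hends.symm).IsPath := by simpa using hp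
        refine ⟨.cons (hv 0 (by omega)) (p.copy rfl hends.symm), hp'.isCycle_cons _ ?_, ?_, ?_⟩
        · rw [Walk.length_copy]; omega
        · simpa [hpl] using hn
        · simp [hpl]
      · left
        obtain ⟨p, hp, hpl⟩ := exists_path_of_injOn hv (by
          intro i hi j hj hij
          rw [Set.mem_ofPred_eq] at hi hj
          by_contra hne
          rcases Nat.lt_or_gt_of_ne hne with h | h
          · have := hrep i j h hj hij
            obtain ⟨rfl, rfl⟩ : i = 0 ∧ j = n := by omega
            exact hends hij
          · have := hrep j i h hi hij.symm
            obtain ⟨rfl, rfl⟩ : j = 0 ∧ i = n := by omega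
            exact hends hij.symm)
        exact ⟨p, hp, hpl.symm ▸ hn, hpl.le⟩

section ShortOddCycle

variable {V : Type*} [Fintype V] {G : SimpleGraph V} {k K : ℕ} {col : V → Fin K}

lemma color_ne_of_odd_path (hfree : ¬ HasCycleOfLength G (2 * k - 1))
    (hcol : ∀ u v, col u = col v → K * (2 * k) ≤ (G.commonNeighbors u v).ncard)
    {a b : V} (p : G.Walk a b) (hp : p.IsPath) (hodd : Odd p.length) (hlen : p.length + 3 ≤ 2 * k) :
    col a ≠ col b :=
  fun h ↦ hfree (hasCycleOfLength_of_odd_path hcol p hp hodd hlen (hcol a b h))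

lemma color_ne_of_mem_short_odd_cycle (hfree : ¬ HasCycleOfLength G (2 * k - 1))
    (hcol : ∀ u v, col u = col v → K * (2 * k) ≤ (G.commonNeighbors u v).ncard)
    {a b : V} (hab : G.Adj a b) (p : G.Walk b a) (hp : p.IsPath) (heven : Even p.length)
    (hlen : p.length + 4 ≤ 2 * k) {x : V} (hx : x ∈ p.support) (hxa : x ≠ a) :
    col x ≠ col a := by
  classical
  have hsum : (p.takeUntil x hx).length + (p.dropUntil x hx).length = p.length := by
    rw [← Walk.length_append, Walk.take_spec]
  rcases Nat.even_or_odd (p.dropUntil x hx).length with hpar | hpar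
  · have ha : a ∉ (p.takeUntil x hx).support :=
      Walk.endpoint_notMem_support_takeUntil hp hx hxa.symm
    refine (color_ne_of_odd_path hfree hcol _ ((hp.takeUntil hx).cons (h := hab) ha) ?_ ?_).symm
    · rw [Walk.length_cons, Nat.odd_iff]
      rw [Nat.even_iff] at hpar heven
      omega
    · rw [Walk.length_cons]
      omega
  · exact color_ne_of_odd_path hfree hcol _ (hp.dropUntil hx) hpar (by omega)

/-- An edge of a short odd cycle is determined by the colors of its ends. -/
lemma eq_of_color_eq_of_short_odd_cycle (hfree : ¬ HasCycleOfLength G (2 * k - 1))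
    (hcol : ∀ u v, col u = col v → K * (2 * k) ≤ (G.commonNeighbors u v).ncard)
    {a b : V} (hab : G.Adj a b) (p : G.Walk b a) (hp : p.IsPath) (heven : Even p.length)
    (hlen : p.length + 6 ≤ 2 * k) {a' b' : V} (hab' : G.Adj a' b') (ha : col a' = col a)
    (hb : col b' = col b) : a' = a := by
  by_contra hne
  have ha' : a' ∉ p.support := fun h ↦
    color_ne_of_mem_short_odd_cycle hfree hcol hab p hp heven (by omega) h hne ha
  rcases eq_or_ne b' b with rfl | hbne
  · refine color_ne_of_odd_path hfree hcol _ (hp.cons (h := hab') ha') ?_ ?_ ha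
    · simpa using heven.add_one
    · rw [Walk.length_cons]
      omega
  · have hb' : b' ∉ p.support := fun h ↦
      color_ne_of_mem_short_odd_cycle hfree hcol hab.symm p.reverse hp.reverse (by simpa using heven)
        (by rw [Walk.length_reverse]; omega) (by simpa using h) hbne hb
    have hK : 0 < K := (col a).pos
    have hcom := (Nat.le_mul_of_pos_left (2 * k) hK).trans (hcol a' a ha)
    obtain ⟨w, ⟨hw, hwa⟩, hwp⟩ := Set.exists_mem_notMem_list (s := G.commonNeighbors a' a)
      (l := a' :: b' :: p.support) (by simp only [List.length_cons, Walk.length_support]; omega)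
    rw [mem_neighborSet] at hw hwa
    simp only [List.mem_cons, not_or] at hwp
    refine color_ne_of_odd_path hfree hcol
      (.cons hab'.symm (.cons hw (.cons hwa.symm p.reverse))) ?_ ?_ ?_ hb
    · simp [Walk.cons_isPath_iff, hp, ha', hb', hwp.2.2, hw.ne, hab'.ne', Ne.symm hwp.2.1]
    · simp only [Walk.length_cons, Walk.length_reverse]
      rw [Nat.odd_iff]
      rw [Nat.even_iff] at heven
      omega
    · simp only [Walk.length_cons, Walk.length_reverse]
      omega

end ShortOddCycle

/-- The type of colors after `n` rounds of color refinement. -/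
def RefinedColor (α : Type) : ℕ → Type
  | 0 => α
  | n + 1 => RefinedColor α n × Set (RefinedColor α n)

instance RefinedColor.finite (α : Type) [Finite α] : ∀ n, Finite (RefinedColor α n)
  | 0 => inferInstanceAs (Finite α)
  | n + 1 =>
    have := RefinedColor.finite α n
    inferInstanceAs (Finite (RefinedColor α n × Set (RefinedColor α n)))

/-- Color refinement: in every round a vertex also records the set of colors of its neighbours. -/
def refinedColoring {V : Type*} {α : Type} (G : SimpleGraph V) (c : V → α) :
    ∀ n, V → RefinedColor α n
  | 0 => c
  | n + 1 => fun v ↦ (refinedColoring G c n v, refinedColoring G c n '' G.neighborSet v)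

/-- The quotient of a graph by a coloring of its vertices, without loops. -/
def colorQuotient {V W : Type*} (G : SimpleGraph V) (c : V → W) : SimpleGraph W where
  Adj X Y := X ≠ Y ∧ ∃ u v, c u = X ∧ c v = Y ∧ G.Adj u v
  symm := ⟨fun _ _ ⟨hne, u, v, hu, hv, huv⟩ ↦ ⟨hne.symm, v, u, hv, hu, huv.symm⟩⟩
  loopless := ⟨fun _ h ↦ h.1 rfl⟩

section Refinement

variable {V : Type*} {α : Type} {G : SimpleGraph V} {c : V → α}

lemma refinedColoring_eq_of_le {i j : ℕ} (hij : i ≤ j) {u v : V}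
    (h : refinedColoring G c j u = refinedColoring G c j v) :
    refinedColoring G c i u = refinedColoring G c i v := by
  induction j, hij using Nat.le_induction with
  | base => exact h
  | succ j _ ih => exact ih (congrArg Prod.fst h)

lemma exists_adj_refinedColoring_eq {n : ℕ} {u u' v : V}
    (h : refinedColoring G c (n + 1) u = refinedColoring G c (n + 1) u') (huv : G.Adj u v) :
    ∃ v', G.Adj u' v' ∧ refinedColoring G c n v' = refinedColoring G c n v := by
  have hmem : refinedColoring G c n v ∈ refinedColoring G c n '' G.neighborSet u' := by
    rw [← show _ = refinedColoring G c n '' G.neighborSet u' from congrArg Prod.snd h]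
    exact ⟨v, huv, rfl⟩
  exact hmem

lemma exists_lift_of_colorQuotient_walk {m : ℕ} {x : ℕ → V}
    (hx : ∀ i, (colorQuotient G (refinedColoring G c m)).Adj
      (refinedColoring G c m (x i)) (refinedColoring G c m (x (i + 1)))) :
    ∃ v : ℕ → V,
      (∀ i ≤ m, refinedColoring G c (m - i) (v i) = refinedColoring G c (m - i) (x i)) ∧
      ∀ i < m, G.Adj (v i) (v (i + 1)) := by
  have hstep : ∀ i a, i < m ∧ refinedColoring G c (m - i) a = refinedColoring G c (m - i) (x i) →
      ∃ b, G.Adj a b ∧ refinedColoring G c (m - (i + 1)) b =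
        refinedColoring G c (m - (i + 1)) (x (i + 1)) := by
    rintro i a ⟨hi, ha⟩
    obtain ⟨-, u, y, hu, hy, huy⟩ := hx i
    have hua : refinedColoring G c (m - (i + 1) + 1) u = refinedColoring G c (m - (i + 1) + 1) a := by
      rw [show m - (i + 1) + 1 = m - i by omega, ha]
      exact refinedColoring_eq_of_le (Nat.sub_le _ _) hu
    obtain ⟨b, hab, hb⟩ := exists_adj_refinedColoring_eq hua huy
    exact ⟨b, hab, hb.trans (refinedColoring_eq_of_le (Nat.sub_le _ _) hy)⟩
  choose! f hf using hstep
  let v : ℕ → V := fun i ↦ Nat.rec (x 0) f i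
  have hv : ∀ i ≤ m, refinedColoring G c (m - i) (v i) = refinedColoring G c (m - i) (x i) := by
    intro i
    induction i with
    | zero => exact fun _ ↦ rfl
    | succ i ih => exact fun hi ↦ (hf i (v i) ⟨by omega, ih (by omega)⟩).2
  exact ⟨v, hv, fun i hi ↦ (hf i (v i) ⟨hi, hv i hi.le⟩).1⟩

end Refinement

lemma exists_periodic_of_hasCycleOfLength {W : Type*} {H : SimpleGraph W} {ℓ : ℕ}
    (h : HasCycleOfLength H ℓ) :
    ∃ X : ℕ → W, (∀ i, H.Adj (X i) (X (i + 1))) ∧ (∀ i, X (i + ℓ) = X i) ∧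
      ∀ s t, s < t → t < s + ℓ → X s ≠ X t := by
  obtain ⟨a, w, hw, rfl⟩ := h
  have hpos : 0 < w.length := by have := hw.three_le_length; omega
  refine ⟨fun i ↦ w.getVert (i % w.length), fun i ↦ ?_, fun i ↦ by simp, fun s t hst hts heq ↦ ?_⟩
  · have hi := Nat.mod_lt i hpos
    have hadj := w.adj_getVert_succ hi
    rcases Nat.lt_or_ge (i % w.length + 1) w.length with hlt | hge
    · simpa [Nat.add_mod, Nat.mod_eq_of_lt hlt, show 1 % w.length = 1 from
        Nat.mod_eq_of_lt (by have := hw.three_le_length; omega)] using hadj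
    · have h0 : (i + 1) % w.length = 0 := by
        rw [← Nat.mod_add_mod, show i % w.length + 1 = w.length by omega, Nat.mod_self]
      simpa [h0, show i % w.length + 1 = w.length by omega] using hadj
  · have hs := Nat.mod_lt s hpos
    have ht := Nat.mod_lt t hpos
    have hmod : s % w.length = t % w.length :=
      hw.getVert_injOn' (by rw [Set.mem_ofPred_eq]; omega) (by rw [Set.mem_ofPred_eq]; omega) heq
    have hdvd : w.length ∣ t - s := (Nat.modEq_iff_dvd' hst.le).1 hmod
    have := Nat.le_of_dvd (by omega) hdvd
    omega

section Quotient

variable {V : Type*} [Fintype V] {G : SimpleGraph V} {k K : ℕ} {col : V → Fin K}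

lemma eq_of_refinedColoring_one_eq (hfree : ¬ HasCycleOfLength G (2 * k - 1))
    (hfree' : ¬ HasCycleOfLength G (2 * k - 3))
    (hcol : ∀ u v, col u = col v → K * (2 * k) ≤ (G.commonNeighbors u v).ncard)
    {a a' : V} (w : G.Walk a a) (hw : w.IsCycle) (hodd : Odd w.length) (hlen : w.length + 3 ≤ 2 * k)
    (h : refinedColoring G col 1 a = refinedColoring G col 1 a') : a' = a := by
  have hne : w.length ≠ 2 * k - 3 := fun hl ↦ hfree' ⟨a, w, hw, hl⟩
  cases w with
  | nil => simp at hodd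
  | cons hab p =>
    rw [Walk.length_cons] at hodd hlen hne
    obtain ⟨b', hab', hb'⟩ := exists_adj_refinedColoring_eq h hab
    rw [Walk.cons_isCycle_iff] at hw
    have heven : Even p.length := by
      rw [Nat.odd_iff] at hodd
      rw [Nat.even_iff]
      omega
    have hlen' : p.length + 6 ≤ 2 * k := by
      rw [Nat.even_iff] at heven
      omega
    exact eq_of_color_eq_of_short_odd_cycle hfree hcol hab p hw.1 heven hlen' hab'
      (refinedColoring_eq_of_le (Nat.zero_le 1) h).symm hb'

lemma not_hasCycleOfLength_colorQuotient (hfree : ¬ HasCycleOfLength G (2 * k - 1))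
    (hfree' : ¬ HasCycleOfLength G (2 * k - 3))
    (hcol : ∀ u v, col u = col v → K * (2 * k) ≤ (G.commonNeighbors u v).ncard)
    (hover : ∀ v : ℕ → V, ∃ i j, i < j ∧ j < 2 * k - 1 ∧
      ∀ u, col u = col (v i) → K * (2 * k) ≤ (G.commonNeighbors u (v j)).ncard) :
    ¬ HasCycleOfLength (colorQuotient G (refinedColoring G col (4 * k))) (2 * k - 1) := by
  intro hcyc
  obtain ⟨X, hX, hper, hinj⟩ := exists_periodic_of_hasCycleOfLength hcyc
  have hrep : ∀ i, ∃ x, refinedColoring G col (4 * k) x = X i := fun i ↦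
    let ⟨_, u, _, hu, _⟩ := hX i
    ⟨u, hu⟩
  choose x hx using hrep
  obtain ⟨v, hvx, hadj⟩ := exists_lift_of_colorQuotient_walk (G := G) (c := col) (m := 4 * k)
    (x := x) (by simpa only [hx] using hX)
  have hshort : ∀ p n, Odd n → n + 3 ≤ 2 * k → p + n < 4 * k →
      ¬ K * (2 * k) ≤ (G.commonNeighbors (v p) (v (p + n))).ncard := by
    intro p n hn hnk hpn hcom
    rcases exists_odd_path_or_odd_cycle n (fun t ↦ v (p + t)) hn
      (fun t ht ↦ hadj (p + t) (by omega)) with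
      ⟨q, hq, hqo, hql⟩ | ⟨s, t, hst, ht, hvst, w, hw, hwo, hwl⟩
    · exact hfree (hasCycleOfLength_of_odd_path hcol q hq hqo (by omega) hcom)
    · have huniq : ∀ i, p + i < 4 * k → v (p + i) = v (p + s) → x (p + i) = v (p + s) := by
        intro i hi hvi
        have h1 : refinedColoring G col 1 (v (p + i)) = refinedColoring G col 1 (x (p + i)) :=
          refinedColoring_eq_of_le (by omega) (hvx (p + i) hi.le)
        rw [hvi] at h1
        exact eq_of_refinedColoring_one_eq hfree hfree' hcol w hw hwo (by omega) h1
      refine hinj (p + s) (p + t) (by omega) (by omega) ?_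
      rw [← hx, ← hx, huniq s (by omega) rfl, huniq t (by omega) hvst.symm]
  obtain ⟨i, j, hij, hj, hov⟩ := hover v
  rcases Nat.even_or_odd (j - i) with hpar | hpar
  · rw [Nat.even_iff] at hpar
    refine hshort j (i + (2 * k - 1) - j) (by rw [Nat.odd_iff]; omega) (by omega) (by omega) ?_
    rw [Nat.add_sub_cancel' (by omega), commonNeighbors_symm]
    refine hov _ ?_
    have hv0 : ∀ l ≤ 4 * k, col (v l) = col (x l) := fun l hl ↦
      refinedColoring_eq_of_le (Nat.zero_le _) (hvx l hl)
    rw [hv0 _ (by omega), hv0 _ (by omega)]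
    exact refinedColoring_eq_of_le (G := G) (c := col) (Nat.zero_le (4 * k)) (by rw [hx, hx, hper])
  · exact hshort i (j - i) hpar (by rw [Nat.odd_iff] at hpar; omega) (by omega)
      (by rw [Nat.add_sub_cancel' hij.le]; exact hov _ rfl)

lemma nonempty_hom_colorQuotient (hk : 2 ≤ k) (hfree : ¬ HasCycleOfLength G (2 * k - 1))
    (hcol : ∀ u v, col u = col v → K * (2 * k) ≤ (G.commonNeighbors u v).ncard) (m : ℕ) :
    Nonempty (G →g colorQuotient G (refinedColoring G col m)) := by
  refine ⟨⟨refinedColoring G col m, fun {u v} huv ↦ ⟨fun heq ↦ ?_, u, v, rfl, rfl, huv⟩⟩⟩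
  refine color_ne_of_odd_path hfree hcol huv.toWalk (by simp [Walk.cons_isPath_iff, huv.ne])
    (by simp) (by simp; omega) (refinedColoring_eq_of_le (Nat.zero_le m) heq)

end Quotient

lemma exists_large_inter {V : Type*} [Fintype V] {A : ℕ → Set V} {D γ : ℝ}
    (hA : ∀ i, D ≤ (A i).ncard) {t : ℕ} (ht : Fintype.card V < t * D - t * (t - 1) / 2 * γ) :
    ∃ i j, i < j ∧ j < t ∧ γ < (A i ∩ A j).ncard := by
  by_contra! hcon
  have key : ∀ s ≤ t, s * D - s * (s - 1) / 2 * γ ≤ (⋃ i ∈ Finset.range s, A i).ncard := by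
    intro s
    induction s with
    | zero => simp
    | succ s ih =>
      intro hs
      have h1 := ih (by omega)
      set U := ⋃ i ∈ Finset.range s, A i with hU
      have h2 : (⋃ i ∈ Finset.range (s + 1), A i) = U ∪ A s := by
        rw [Finset.range_add_one, Finset.set_biUnion_insert, Set.union_comm]
      have h3 := Set.ncard_union_add_ncard_inter U (A s)
      have h4 : ((U ∩ A s).ncard : ℝ) ≤ s * γ := by
        calc ((U ∩ A s).ncard : ℝ) ≤ ∑ i ∈ Finset.range s, ((A i ∩ A s).ncard : ℝ) := by
              rw [hU, Set.iUnion₂_inter]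
              exact_mod_cast Finset.set_ncard_biUnion_le _ _
          _ ≤ ∑ i ∈ Finset.range s, γ := Finset.sum_le_sum fun i hi ↦
              hcon i s (Finset.mem_range.1 hi) (by omega)
          _ = s * γ := by simp
      rw [h2]
      have h5 : ((U ∪ A s).ncard : ℝ) + (U ∩ A s).ncard = U.ncard + (A s).ncard := by
        exact_mod_cast h3
      push_cast
      linarith [hA s]
  have h := key t le_rfl
  have h' : ((⋃ i ∈ Finset.range t, A i).ncard : ℝ) ≤ Fintype.card V := by
    rw [← Nat.card_eq_fintype_card]
    exact_mod_cast Set.ncard_le_card _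
  linarith

/-- Homomorphism consequence of Lemma 4.7, condition (1): for `k ≥ 3`, `ε > 0` and
`d ≥ 1` there is a constant `C` such that every `{C_{2k−1}, C_{2k−3}}`-free graph
with VC-dimension at most `d` and minimum degree at least `(1/(2k−1) + 2kε)·n`
admits a homomorphism to a `C_{2k−1}`-free graph on at most `C` vertices. -/
theorem hom_from_main_lemma_cond1 (k : ℕ) (hk : 3 ≤ k) (ε : ℝ) (hε : 0 < ε)
    (d : ℕ) (hd : 1 ≤ d) :
    ∃ C : ℕ, ∀ (V : Type) [Fintype V] (G : SimpleGraph V),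
      ¬ HasCycleOfLength G (2 * k - 1) →
      ¬ HasCycleOfLength G (2 * k - 3) →
      VCdimLE G d →
      (∀ v : V,
        ((1 : ℝ) / (2 * (k : ℝ) - 1) + 2 * (k : ℝ) * ε) * (Nat.card V) ≤
          (G.neighborSet v).ncard) →
      ∃ (W : Type) (_ : Finite W) (H : SimpleGraph W),
        Nat.card W ≤ C ∧ ¬ HasCycleOfLength H (2 * k - 1) ∧ Nonempty (G →g H) := by
  obtain ⟨K, hK, hpack⟩ := exists_coloring_neighborSet_diff_le d hε
  set M := K * (2 * k) with hM
  refine ⟨max (Nat.card (RefinedColor (Fin K) (4 * k))) ⌈M / ε⌉₊,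
    fun V _ G hfree hfree' hvc hdeg ↦ ?_⟩
  rcases le_or_gt (Nat.card V) ⌈M / ε⌉₊ with hsmall | hlarge
  · exact ⟨V, inferInstance, G, hsmall.trans (le_max_right _ _), hfree, ⟨Hom.id⟩⟩
  obtain ⟨col, hdiff⟩ := hpack V G hvc
  rw [Nat.card_eq_fintype_card] at hlarge hdeg
  set n := Fintype.card V
  have hn : (0 : ℝ) < n := by exact_mod_cast (Nat.zero_le _).trans_lt hlarge
  have hMn : (M : ℝ) ≤ ε * n := by
    rw [← div_le_iff₀' hε]
    exact (Nat.le_ceil _).trans (by exact_mod_cast hlarge.le)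
  have hk' : (3 : ℝ) ≤ k := by exact_mod_cast hk
  have hεn : 0 < ε * n := mul_pos hε hn
  have hshift : ∀ (u v : V) (S : Set V), col u = col v →
      ((G.neighborSet u ∩ S).ncard : ℝ) ≤ (G.neighborSet v ∩ S).ncard + ε * n := by
    intro u v S huv
    have hsub : G.neighborSet u ∩ S ⊆
        (G.neighborSet v ∩ S) ∪ (G.neighborSet u \ G.neighborSet v) := by
      intro z hz
      by_cases h : z ∈ G.neighborSet v
      · exact .inl ⟨h, hz.2⟩
      · exact .inr ⟨hz.1, h⟩
    have h1 : ((G.neighborSet u ∩ S).ncard : ℝ) ≤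
        (G.neighborSet v ∩ S).ncard + (G.neighborSet u \ G.neighborSet v).ncard := by
      exact_mod_cast (Set.ncard_le_ncard hsub).trans (Set.ncard_union_le _ _)
    linarith [hdiff u v huv]
  have hcol : ∀ u v, col u = col v → M ≤ (G.commonNeighbors u v).ncard := by
    intro u v huv
    have h1 := hshift u v (G.neighborSet u) huv
    rw [Set.inter_self, Set.inter_comm] at h1
    have h2 := hdeg u
    have h3 : 2 * (ε * n) ≤ (1 / (2 * (k : ℝ) - 1) + 2 * k * ε) * n := by
      have : 0 ≤ 1 / (2 * (k : ℝ) - 1) := by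
        apply div_nonneg <;> linarith
      nlinarith [mul_nonneg this hn.le]
    have h4 : (M : ℝ) ≤ (G.neighborSet u ∩ G.neighborSet v).ncard := by linarith
    exact_mod_cast h4
  have hover : ∀ v : ℕ → V, ∃ i j, i < j ∧ j < 2 * k - 1 ∧
      ∀ u, col u = col (v i) → M ≤ (G.commonNeighbors u (v j)).ncard := by
    intro v
    obtain ⟨i, j, hij, hj, h⟩ := exists_large_inter (A := fun i ↦ G.neighborSet (v i))
      (γ := 2 * (ε * n)) (t := 2 * k - 1) (fun i ↦ hdeg (v i)) (by
        rw [Nat.cast_sub (by omega)]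
        push_cast
        have : (2 * (k : ℝ) - 1) * (1 / (2 * (k : ℝ) - 1)) = 1 :=
          mul_one_div_cancel (by linarith)
        have h1 : (2 * (k : ℝ) - 1) * ((1 / (2 * (k : ℝ) - 1) + 2 * k * ε) * n) -
            (2 * (k : ℝ) - 1) * (2 * k - 1 - 1) / 2 * (2 * (ε * n)) =
            n + 2 * (2 * k - 1) * (ε * n) := by
          linear_combination (n : ℝ) * this
        rw [h1]
        nlinarith)
    refine ⟨i, j, hij, hj, fun u hu ↦ ?_⟩
    have h1 := hshift (v i) u (G.neighborSet (v j)) hu.symm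
    have h2 : (M : ℝ) ≤ (G.neighborSet u ∩ G.neighborSet (v j)).ncard := by linarith
    exact_mod_cast h2
  exact ⟨RefinedColor (Fin K) (4 * k), inferInstance, colorQuotient G (refinedColoring G col (4 * k)),
    le_max_left _ _, not_hasCycleOfLength_colorQuotient hfree hfree' hcol hover,
    nonempty_hom_colorQuotient (by omega) hfree hcol _⟩
end

section
/- Theorem 5.1: For every integer k ≥ 3 and every ε > 0, there exist a constant C = C(k,ε) and n_0 such that the following holds for all n ≥ n_0. If G is an n-vertex maximal C_{2k−1}-free graph with minimum degree δ(G) ≥ (1/(2k−1) + ε)·n, then there exists a set T of at most C vertices such that the induced subgraph G − T contains no cycle of any odd length ℓ with 3 ≤ ℓ ≤ 2k−1. -/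
open SimpleGraph

/-- There is a path of length `m` from `u` to `v` in `G` all of whose vertices lie in `S`. -/
def HasPathIn {V : Type*} (G : SimpleGraph V) (S : Set V) (m : ℕ) (u v : V) : Prop :=
  ∃ p : G.Walk u v, p.IsPath ∧ p.length = m ∧ ∀ x ∈ p.support, x ∈ S

namespace HasPathIn

variable {V : Type*} {G : SimpleGraph V} {S S' : Set V} {m m' : ℕ} {u v w z : V}

theorem single (v : V) : HasPathIn G {v} 0 v v :=
  ⟨Walk.nil, by simp, by simp, by simp⟩

theorem symm (h : HasPathIn G S m u v) : HasPathIn G S m v u := by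
  obtain ⟨p, hp, hl, hs⟩ := h
  exact ⟨p.reverse, hp.reverse, by simpa using hl, by simpa using hs⟩

theorem trans (h : HasPathIn G S m u v) (hvw : G.Adj v w) (h' : HasPathIn G S' m' w z)
    (hd : Disjoint S S') : HasPathIn G (S ∪ S') (m + 1 + m') u z := by
  obtain ⟨p, hp, hl, hs⟩ := h
  obtain ⟨q, hq, hl', hs'⟩ := h'
  refine ⟨p.append (Walk.cons hvw q), ?_, ?_, ?_⟩
  · rw [Walk.isPath_def, Walk.support_append, Walk.support_cons, List.tail_cons]
    refine List.Nodup.append hp.support_nodup hq.support_nodup ?_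
    intro x hx hx'
    exact Set.disjoint_left.mp hd (hs x hx) (hs' x hx')
  · simp [hl, hl']
    omega
  · intro x hx
    rw [Walk.support_append, Walk.support_cons, List.tail_cons, List.mem_append] at hx
    exact hx.imp (hs x) (hs' x)

theorem concat (h : HasPathIn G S m u v) (hvw : G.Adj v w) (hw : w ∉ S) :
    HasPathIn G (S ∪ {w}) (m + 1) u w :=
  h.trans hvw (single w) (by simpa using hw)

end HasPathIn

/-- A path joining the two sides of a large complete bipartite subgraph closes up to a cycle of
every length of the right parity. -/
theorem hasCycleOfLength_of_path_of_bipartite {V : Type*} {G : SimpleGraph V} {A Y : Finset V}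
    {L : ℕ} (hAY : ∀ a ∈ A, ∀ y ∈ Y, G.Adj a y) (hA : L ≤ A.card) (hY : L ≤ Y.card)
    (t : ℕ) {m : ℕ} {S : Set V} {a y : V} (ha : a ∈ A) (hy : y ∈ Y) (hm : 2 ≤ m)
    (h : HasPathIn G S m a y) (hL : L = m + 1 + 2 * t) : HasCycleOfLength G L := by
  classical
  induction t generalizing m S y with
  | zero =>
    obtain ⟨p, hp, hl, -⟩ := h
    refine ⟨y, Walk.cons (hAY a ha y hy).symm p, ?_, by simp [hl, hL]⟩
    rw [Walk.isCycle_iff_isPath_tail_and_le_length]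
    refine ⟨by simpa using hp, by simp; omega⟩
  | succ t ih =>
    obtain ⟨p, hp, hl, -⟩ := h
    have hc : p.support.toFinset.card = m + 1 := by
      rw [List.toFinset_card_of_nodup hp.support_nodup, Walk.length_support, hl]
    obtain ⟨b, hb, hbp⟩ : ∃ b ∈ A, b ∉ p.support.toFinset :=
      Finset.exists_mem_notMem_of_card_lt_card (by omega)
    obtain ⟨x, hx, hxp⟩ : ∃ x ∈ Y, x ∉ p.support.toFinset :=
      Finset.exists_mem_notMem_of_card_lt_card (by omega)
    have h1 : HasPathIn G {v | v ∈ p.support} m a y := ⟨p, hp, hl, fun _ h ↦ h⟩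
    have h2 := h1.concat (hAY b hb y hy).symm (by simpa using hbp)
    have h3 := h2.concat (hAY b hb x hx) (by
      have := (hAY b hb x hx).ne
      simp_all [eq_comm])
    exact ih hx (by omega) h3 (by omega)

/-- The map `c` enumerates distinct vertices, any two of which are joined within the range of `c`
by an odd path and an even path of total length `ℓ`, as on an odd cycle of length `ℓ`. -/
structure IsOddCycleLike {V : Type*} (G : SimpleGraph V) {ℓ : ℕ} (c : Fin ℓ → V) : Prop where
  injective : Function.Injective c
  paths : ∀ i j, i ≠ j → ∃ p q, HasPathIn G (Set.range c) p (c i) (c j) ∧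
    HasPathIn G (Set.range c) q (c i) (c j) ∧ Odd p ∧ Even q ∧ 2 ≤ q ∧ p + q = ℓ

theorem exists_paths_of_isCycle {V : Type*} {G : SimpleGraph V} {u x : V} {w : G.Walk u u}
    (hw : w.IsCycle) (hx : x ∈ w.support) (hux : u ≠ x) :
    ∃ p q, HasPathIn G {y | y ∈ w.support} p u x ∧ HasPathIn G {y | y ∈ w.support} q u x ∧
      1 ≤ p ∧ 1 ≤ q ∧ p + q = w.length := by
  classical
  have hspec := w.take_spec hx
  have hlen := congrArg Walk.length hspec
  rw [Walk.length_append] at hlen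
  have h1 : (w.takeUntil x hx).length ≠ 0 := fun h ↦ hux (Walk.eq_of_length_eq_zero h)
  have h2 : (w.dropUntil x hx).length ≠ 0 := fun h ↦ hux (Walk.eq_of_length_eq_zero h).symm
  refine ⟨_, _, ⟨w.takeUntil x hx, hw.isPath_takeUntil hx, rfl,
    fun y hy ↦ w.support_takeUntil_subset_support hx hy⟩,
    HasPathIn.symm ⟨w.dropUntil x hx, ?_, rfl,
      fun y hy ↦ w.support_dropUntil_subset_support hx hy⟩, by omega, by omega, hlen⟩
  have hn := hw.support_nodup
  rw [← hspec, Walk.tail_support_append, List.nodup_append] at hn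
  rw [Walk.isPath_def, ← Walk.cons_tail_support, List.nodup_cons]
  refine ⟨fun hmem ↦ hn.2.2 x ?_ x hmem rfl, hn.2.1⟩
  have hend := (w.takeUntil x hx).end_mem_support
  rw [← Walk.cons_tail_support, List.mem_cons] at hend
  exact hend.resolve_left (Ne.symm hux)

theorem isOddCycleLike_getVert {V : Type*} {G : SimpleGraph V} {u : V} {w : G.Walk u u}
    (hw : w.IsCycle) (hodd : Odd w.length) :
    IsOddCycleLike G (fun i : Fin w.length ↦ w.getVert i) := by
  classical
  have hinj : Function.Injective (fun i : Fin w.length ↦ w.getVert i) := by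
    intro i j hij
    exact Fin.ext (hw.getVert_injOn' (by simp; omega) (by simp; omega) hij)
  refine ⟨hinj, fun i j hij ↦ ?_⟩
  have hne : w.getVert i ≠ w.getVert j := fun h ↦ hij (hinj h)
  have hi := w.getVert_mem_support i
  have hsup : ∀ y, y ∈ (w.rotate _ hi).support →
      y ∈ Set.range (fun i : Fin w.length ↦ w.getVert i) := by
    intro y hy
    rw [Walk.mem_support_rotate_iff, Walk.mem_support_iff_exists_getVert] at hy
    obtain ⟨n, rfl, hn⟩ := hy
    have h3 := hw.three_le_length
    rcases hn.lt_or_eq with h | rfl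
    · exact ⟨⟨n, h⟩, rfl⟩
    · exact ⟨⟨0, by omega⟩, by simp⟩
  obtain ⟨p, q, ⟨P, hP, hPl, hPs⟩, ⟨Q, hQ, hQl, hQs⟩, hp1, hq1, hpq⟩ :=
    exists_paths_of_isCycle (hw.rotate hi)
      ((Walk.mem_support_rotate_iff ..).2 (w.getVert_mem_support j)) hne
  rw [Walk.length_rotate] at hpq
  have hP' : HasPathIn G (Set.range (fun i : Fin w.length ↦ w.getVert i)) p _ _ :=
    ⟨P, hP, hPl, fun y hy ↦ hsup y (hPs y hy)⟩
  have hQ' : HasPathIn G (Set.range (fun i : Fin w.length ↦ w.getVert i)) q _ _ :=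
    ⟨Q, hQ, hQl, fun y hy ↦ hsup y (hQs y hy)⟩
  rcases Nat.even_or_odd p with he | ho
  · have : Odd q := by grind
    exact ⟨q, p, hQ', hP', this, he, by grind, by omega⟩
  · have : Even q := by grind
    exact ⟨p, q, hP', hQ', ho, this, by grind, hpq⟩

/-- Either there are `M` vertex-disjoint copies, or boundedly many vertices meet all copies. -/
theorem exists_disjoint_or_exists_hitting {V : Type*} {ℓ : ℕ} (Q : (Fin ℓ → V) → Prop)
    (hQ : ∀ c, Q c → Function.Injective c) (M : ℕ) :
    (∃ f : Fin M → Fin ℓ → V, (∀ a, Q (f a)) ∧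
      Function.Injective (fun x : Fin M × Fin ℓ ↦ f x.1 x.2)) ∨
      ∃ T : Finset V, T.card ≤ M * ℓ ∧ ∀ c, Q c → ∃ i, c i ∈ T := by
  classical
  induction M with
  | zero => exact Or.inl ⟨fun a ↦ a.elim0, fun a ↦ a.elim0, fun x ↦ x.1.elim0⟩
  | succ M ih =>
    rcases ih with ⟨f, hf, hinj⟩ | ⟨T, hT, h⟩
    · by_cases hex : ∃ c, Q c ∧ ∀ a i j, c i ≠ f a j
      · obtain ⟨c, hc, hcf⟩ := hex
        refine Or.inl ⟨Fin.cons c f, fun a ↦ ?_, ?_⟩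
        · induction a using Fin.cases <;> simp [*]
        · rintro ⟨a, i⟩ ⟨b, j⟩ h
          induction a using Fin.cases with
          | zero =>
            induction b using Fin.cases with
            | zero => simpa using hQ c hc (by simpa using h)
            | succ b => exact absurd (by simpa using h) (hcf b i j)
          | succ a =>
            induction b using Fin.cases with
            | zero => exact absurd (by simpa using h.symm) (hcf a j i)
            | succ b => simpa using @hinj (a, i) (b, j) (by simpa using h)
      · push Not at hex
        refine Or.inr ⟨Finset.univ.image (fun x : Fin M × Fin ℓ ↦ f x.1 x.2), ?_, fun c hc ↦ ?_⟩
        · refine Finset.card_image_le.trans ?_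
          simp [add_mul]
        · obtain ⟨a, i, j, h⟩ := hex c hc
          exact ⟨i, by simpa using ⟨a, j, h.symm⟩⟩
    · exact Or.inr ⟨T, by rw [add_mul]; omega, h⟩

/-- Among sufficiently many subsets of positive density, `s` of them share at least `K` elements. -/
theorem exists_common_neighbors (c : ℝ) (hc : 0 < c) (s K : ℕ) :
    ∃ M N : ℕ, ∀ (V : Type) [Fintype V], N ≤ Nat.card V → ∀ {ι : Type} (I : Finset ι)
      (R : ι → Finset V), M ≤ I.card → (∀ a ∈ I, c * Nat.card V ≤ (R a).card) →
      ∃ S ⊆ I, S.card = s ∧ ∃ Y : Finset V, K ≤ Y.card ∧ ∀ a ∈ S, Y ⊆ R a := by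
  obtain ⟨M, hM'⟩ := exists_nat_gt (2 * s / c + s)
  have hM : 2 * s / c < (M : ℝ) := lt_of_le_of_lt (by simp) hM'
  have hsM : s ≤ M := by
    have : (s : ℝ) ≤ M := le_trans (le_add_of_nonneg_left (by positivity)) hM'.le
    exact_mod_cast this
  obtain ⟨N, hN⟩ := exists_nat_gt (2 * (2 ^ M * K) / c)
  refine ⟨M, N, fun V _ hV ι I R hI hR ↦ ?_⟩
  classical
  obtain ⟨J, hJI, hJ⟩ := Finset.exists_subset_card_eq hI
  set n := Nat.card V with hn
  have hcard : Fintype.card V = n := by simp [hn]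
  have hM0 : 0 < M := by
    have : (0 : ℝ) < M := lt_of_le_of_lt (by positivity) hM
    exact_mod_cast this
  let D : V → Finset ι := fun v ↦ J.filter (fun a ↦ v ∈ R a)
  let W : Finset V := Finset.univ.filter (fun v ↦ s ≤ (D v).card)
  have hsum : ∑ a ∈ J, (R a).card = ∑ v : V, (D v).card := by
    have := Finset.sum_card_bipartiteAbove_eq_sum_card_bipartiteBelow (s := J)
      (t := (Finset.univ : Finset V)) (fun a v ↦ v ∈ R a)
    simpa [Finset.bipartiteAbove, Finset.bipartiteBelow] using this
  have hlow : (M : ℝ) * (c * n) ≤ ∑ a ∈ J, ((R a).card : ℝ) := by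
    have := Finset.card_nsmul_le_sum J (fun a ↦ ((R a).card : ℝ)) (c * n)
      (fun a ha ↦ hR a (hJI ha))
    simpa [hJ] using this
  have hup : ∑ v : V, (D v).card ≤ W.card * M + n * s := by
    have : ∀ v ∈ (Finset.univ : Finset V), (D v).card ≤ (if v ∈ W then M else 0) + s := by
      intro v _
      by_cases h : s ≤ (D v).card
      · have h1 : (D v).card ≤ M := hJ ▸ Finset.card_filter_le _ _
        simp [W, h]; omega
      · simp [W, h]; omega
    refine (Finset.sum_le_sum this).trans ?_
    rw [Finset.sum_add_distrib, ← Finset.sum_filter]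
    simp [hcard]
  have hWcard : ((Finset.powersetCard s J).card * K : ℕ) ≤ W.card := by
    have h1 : (Finset.powersetCard s J).card ≤ 2 ^ M := by
      rw [← hJ, ← Finset.card_powerset]
      exact Finset.card_le_card (fun x hx ↦ Finset.mem_powerset.2 (Finset.mem_powersetCard.1 hx).1)
    have h2 : ((2 ^ M * K : ℕ) : ℝ) ≤ W.card := by
      have h3 : (M : ℝ) * (c * n) ≤ W.card * M + n * s := by
        refine hlow.trans ?_
        exact_mod_cast hsum ▸ hup
      have h4 : 2 * s < M * c := by rwa [div_lt_iff₀ hc] at hM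
      have h5 : 2 * (2 ^ M * K : ℝ) < n * c := by
        rw [div_lt_iff₀ hc] at hN
        exact hN.trans_le (mul_le_mul_of_nonneg_right (by exact_mod_cast hV) hc.le)
      have hM0' : (0 : ℝ) < M := by exact_mod_cast hM0
      have hn0 : (0 : ℝ) ≤ n := by positivity
      push_cast
      have h6 : (M : ℝ) * (c * n) ≤ M * (2 * W.card) := by nlinarith
      have h7 := le_of_mul_le_mul_left h6 hM0'
      linarith
    have h3 : 2 ^ M * K ≤ W.card := by exact_mod_cast h2
    exact (Nat.mul_le_mul_right K h1).trans h3
  have hsub : ∀ v ∈ W, ∃ S ∈ Finset.powersetCard s J, S ⊆ D v := by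
    intro v hv
    obtain ⟨S, hS, hSc⟩ := Finset.exists_subset_card_eq (Finset.mem_filter.1 hv).2
    exact ⟨S, Finset.mem_powersetCard.2 ⟨hS.trans (Finset.filter_subset _ _), hSc⟩, hS⟩
  choose! g hg hgD using hsub
  have hne : (Finset.powersetCard s J).Nonempty := by
    rwa [Finset.powersetCard_nonempty, hJ]
  obtain ⟨S, hS, hSc⟩ := Finset.exists_le_card_fiber_of_mul_le_card_of_maps_to hg hne hWcard
  rw [Finset.mem_powersetCard] at hS
  refine ⟨S, hS.1.trans hJI, hS.2, W.filter (fun v ↦ g v = S), hSc, fun a ha v hv ↦ ?_⟩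
  rw [Finset.mem_filter] at hv
  exact (Finset.mem_filter.1 (hgD v hv.1 (hv.2 ▸ ha))).2

/-- Iterated form of `exists_common_neighbors` for `m` families of subsets at once. -/
theorem exists_common_neighbors_forall (c : ℝ) (hc : 0 < c) (K m s : ℕ) :
    ∃ M N : ℕ, ∀ (V : Type) [Fintype V], N ≤ Nat.card V → ∀ {ι : Type} (I : Finset ι)
      (R : ℕ → ι → Finset V), M ≤ I.card →
      (∀ i < m, ∀ a ∈ I, c * Nat.card V ≤ (R i a).card) →
      ∃ S ⊆ I, S.card = s ∧ ∀ i < m, ∃ Y : Finset V, K ≤ Y.card ∧ ∀ a ∈ S, Y ⊆ R i a := by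
  induction m generalizing s with
  | zero =>
    refine ⟨s, 0, fun V _ _ ι I R hI _ ↦ ?_⟩
    obtain ⟨S, hS, hSc⟩ := Finset.exists_subset_card_eq hI
    exact ⟨S, hS, hSc, by simp⟩
  | succ m ih =>
    obtain ⟨M₁, N₁, h₁⟩ := exists_common_neighbors c hc s K
    obtain ⟨M₂, N₂, h₂⟩ := ih M₁
    refine ⟨M₂, max N₁ N₂, fun V _ hV ι I R hI hR ↦ ?_⟩
    obtain ⟨S₂, hS₂, hc₂, hY₂⟩ := h₂ V (le_trans (le_max_right _ _) hV) I R hI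
      (fun i hi ↦ hR i (by omega))
    obtain ⟨S₁, hS₁, hc₁, Y, hY, hYS⟩ := h₁ V (le_trans (le_max_left _ _) hV) S₂ (R m) hc₂.ge
      (fun a ha ↦ hR m (by omega) a (hS₂ ha))
    refine ⟨S₁, hS₁.trans hS₂, hc₁, fun i hi ↦ ?_⟩
    rcases Nat.lt_succ_iff_lt_or_eq.1 hi with h | rfl
    · obtain ⟨Z, hZ, hZS⟩ := hY₂ i h
      exact ⟨Z, hZ, fun a ha ↦ hZS a (hS₁ ha)⟩
    · exact ⟨Y, hY, hYS⟩

/-- Many disjoint odd cycles `f a` of length `ℓ` such that, for each position `i`, the vertices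
`f a i` have a large common neighborhood `Y i`. -/
structure IsCycleSystem {V : Type*} (G : SimpleGraph V) (L : ℕ) {ℓ : ℕ} {α : Type*} [Fintype α]
    (f : α → Fin ℓ → V) (Y : Fin ℓ → Finset V) : Prop where
  cycleLike : ∀ a, IsOddCycleLike G (f a)
  injective : Function.Injective (fun x : α × Fin ℓ ↦ f x.1 x.2)
  adj : ∀ a i, ∀ y ∈ Y i, G.Adj (f a i) y
  ne : ∀ a i j, ∀ y ∈ Y i, f a j ≠ y
  le_card : L ≤ Fintype.card α
  le_card_common : ∀ i, L ≤ (Y i).card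

namespace IsCycleSystem

variable {V : Type*} {G : SimpleGraph V} {L ℓ : ℕ} {α : Type*} [Fintype α] {f : α → Fin ℓ → V}
  {Y : Fin ℓ → Finset V}

theorem eq_of_eq (h : IsCycleSystem G L f Y) {a b : α} {i j : Fin ℓ} (he : f a i = f b j) :
    a = b ∧ i = j := by
  simpa using @h.injective (a, i) (b, j) he

theorem not_hasPathIn (h : IsCycleSystem G L f Y) (hG : ¬ HasCycleOfLength G L) (hL : Odd L)
    {S : Set V} {m : ℕ} {a : α} {i : Fin ℓ} {y : V} (hy : y ∈ Y i) (hm : 2 ≤ m) (hmL : m + 1 ≤ L)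
    (hme : Even m) : ¬ HasPathIn G S m (f a i) y := by
  classical
  intro hp
  obtain ⟨r, rfl⟩ := hL
  obtain ⟨q, rfl⟩ := hme
  refine hG (hasCycleOfLength_of_path_of_bipartite (A := Finset.univ.image (fun a ↦ f a i))
    (Y := Y i) ?_ ?_ (h.le_card_common i) (r - q) (by simp) hy hm hp (by omega))
  · intro x hx y hy
    obtain ⟨b, -, rfl⟩ := Finset.mem_image.1 hx
    exact h.adj b i y hy
  · rw [Finset.card_image_of_injective _ (fun b c hbc ↦ (h.eq_of_eq hbc).1)]
    exact h.le_card

theorem exists_mem_ne (h : IsCycleSystem G L f Y) (hL : 2 ≤ L) (i : Fin ℓ) (w : V) :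
    ∃ y ∈ Y i, y ≠ w :=
  Finset.exists_mem_ne (lt_of_lt_of_le (by omega) (h.le_card_common i)) w

theorem lt_add_four (h : IsCycleSystem G L f Y) (hG : ¬ HasCycleOfLength G L) (hL : Odd L)
    (hl : 3 ≤ ℓ) : L < ℓ + 4 := by
  by_contra! hlt
  obtain ⟨a, b, hab⟩ := Fintype.exists_pair_of_one_lt_card (α := α)
    (lt_of_lt_of_le (by omega) h.le_card)
  let i : Fin ℓ := ⟨0, by omega⟩
  let j : Fin ℓ := ⟨1, by omega⟩
  have hij : i ≠ j := by simp [i, j]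
  have key : ∀ a b, a ≠ b → ∀ p q, HasPathIn G (Set.range (f a)) p (f a i) (f a j) →
      HasPathIn G (Set.range (f b)) q (f b i) (f b j) → Odd p → Even q → ℓ < p + q := by
    intro a b hab p q hp hq hpo hqe
    by_contra! hle
    obtain ⟨y, hy, -⟩ := h.exists_mem_ne (by omega) j (f a j)
    obtain ⟨z, hz, hzy⟩ := h.exists_mem_ne (by omega) i y
    have e1 := hp.concat (h.adj a j y hy) (by
      have := fun k ↦ h.ne a j k y hy
      simpa using this)
    have e2 := e1.trans (h.adj b j y hy).symm hq.symm (by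
      rw [Set.disjoint_right]
      rintro _ ⟨k, rfl⟩ (⟨l, hl⟩ | hk)
      · exact hab (h.eq_of_eq hl).1
      · exact h.ne b j k y hy hk)
    have e3 := e2.concat (h.adj b i z hz) (by
      have h1 := fun k ↦ h.ne a i k z hz
      have h2 := fun k ↦ h.ne b i k z hz
      simp_all)
    exact h.not_hasPathIn hG hL hz (by omega) (by omega) (by grind) e3
  obtain ⟨p, q, hp, hq, hpo, hqe, -, hpq⟩ := (h.cycleLike a).paths i j hij
  obtain ⟨p', q', hp', hq', hpo', hqe', -, hpq'⟩ := (h.cycleLike b).paths i j hij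
  have h1 := key a b hab p q' hp hq' hpo hqe'
  have h2 := key b a hab.symm p' q hp' hq hpo' hqe
  omega

theorem not_adj_of_adj (h : IsCycleSystem G L f Y) (hG : ¬ HasCycleOfLength G L) (hL : Odd L)
    (hlL : ℓ + 2 ≤ L) {a b : α} (hab : a ≠ b) {i j : Fin ℓ} (hij : i ≠ j) {w : V}
    (hw : ∀ a i, f a i ≠ w) (h1 : G.Adj (f a i) w) : ¬ G.Adj (f b j) w := by
  intro h2
  obtain ⟨y, hy, hyw⟩ := h.exists_mem_ne (by omega) i w
  obtain ⟨p, q, hp, -, hpo, -, hq2, hpq⟩ := (h.cycleLike b).paths i j hij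
  have e1 := hp.concat h2 (by simpa using hw b)
  have e2 := e1.concat h1.symm (by
    have := hw a i
    have : ∀ k, f b k ≠ f a i := fun k hk ↦ hab (h.eq_of_eq hk).1.symm
    simp_all)
  have e3 := e2.concat (h.adj a i y hy) (by
    have := fun b j ↦ h.ne b i j y hy
    have h' := (this a i).symm
    simp_all)
  exact h.not_hasPathIn hG hL hy (by omega) (by omega) (by grind) e3

theorem not_adj_common_of_adj (h : IsCycleSystem G L f Y) (hG : ¬ HasCycleOfLength G L)
    (hL : Odd L) (hlL : ℓ + 2 ≤ L) {a : α} {i j : Fin ℓ} {y z : V}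
    (hy : y ∈ Y i) (hz : ∀ a i, f a i ≠ z) (h1 : G.Adj (f a j) z) : ¬ G.Adj z y := by
  intro h2
  obtain ⟨q, hq, hqe, hql⟩ : ∃ q, HasPathIn G (Set.range (f a)) q (f a i) (f a j) ∧ Even q ∧
      q + 1 ≤ ℓ := by
    by_cases hij : i = j
    · subst hij
      obtain ⟨p, hp, hl, hs⟩ := HasPathIn.single (G := G) (f a i)
      exact ⟨0, ⟨p, hp, hl, fun x hx ↦ ⟨i, (hs x hx).symm⟩⟩, by simp, by have := i.2; omega⟩
    · obtain ⟨p, q, -, hq, hpo, hqe, -, hpq⟩ := (h.cycleLike a).paths i j hij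
      exact ⟨q, hq, hqe, by have := hpo.pos; omega⟩
  have e1 := hq.concat h1 (by simpa using hz a)
  have e2 := e1.concat h2 (by
    have := fun j ↦ h.ne a i j y hy
    have h' := h2.ne.symm
    simp_all)
  exact h.not_hasPathIn hG hL hy (by omega) (by omega) (by grind) e2

theorem not_adj_common_of_adj_common (h : IsCycleSystem G L f Y) (hG : ¬ HasCycleOfLength G L)
    (hL : Odd L) (hlL : ℓ + 2 ≤ L) {i j : Fin ℓ} (hij : i ≠ j) {y z w : V}
    (hy : y ∈ Y i) (hz : z ∈ Y j) (hw : ∀ a i, f a i ≠ w) (h1 : G.Adj y w) : ¬ G.Adj z w := by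
  intro h2
  obtain ⟨a, b, hab⟩ := Fintype.exists_pair_of_one_lt_card (α := α)
    (lt_of_lt_of_le (by omega) h.le_card)
  have hyz : y ≠ z := by
    rintro rfl
    exact h.not_adj_of_adj hG hL hlL hab hij (fun a k ↦ h.ne a i k y hy) (h.adj a i y hy)
      (h.adj b j y hz)
  obtain ⟨p, q, hp, -, hpo, -, hq2, hpq⟩ := (h.cycleLike a).paths i j hij
  have e1 := hp.concat (h.adj a j z hz) (by
    have := fun k ↦ h.ne a j k z hz
    simpa using this)
  have e2 := e1.concat h2 (by
    have := h2.ne.symm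
    simp_all)
  have e3 := e2.concat h1.symm (by
    have := fun k ↦ h.ne a i k y hy
    have := h1.ne
    simp_all)
  exact h.not_hasPathIn hG hL hy (by omega) (by omega) (by grind) e3

theorem degree_le (h : IsCycleSystem G L f Y) [Fintype V] (hG : ¬ HasCycleOfLength G L)
    (hL : Odd L) (hlL : ℓ + 2 ≤ L) {d : ℕ} (hd : ∀ v, d ≤ (G.neighborSet v).ncard) :
    2 * ℓ * d ≤ Fintype.card V + 2 * ℓ * (Fintype.card α * ℓ) := by
  classical
  obtain ⟨g⟩ : Nonempty (Fin ℓ ↪ α) :=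
    Function.Embedding.nonempty_of_card_le (by have := h.le_card; simp; omega)
  have hne : ∀ i, ∃ y, y ∈ Y i := fun i ↦
    Finset.card_pos.1 (lt_of_lt_of_le (by omega) (h.le_card_common i))
  choose y hy using hne
  let X : Finset V := Finset.univ.image (fun x : α × Fin ℓ ↦ f x.1 x.2)
  have hX : X.card ≤ Fintype.card α * ℓ := by
    refine Finset.card_image_le.trans (by simp)
  have hXn : ∀ w, w ∉ X → ∀ a i, f a i ≠ w := fun w hw a i he ↦
    hw (Finset.mem_image.2 ⟨(a, i), Finset.mem_univ _, he⟩)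
  let u : Fin ℓ ⊕ Fin ℓ → V := Sum.elim y (fun i ↦ f (g i) i)
  let B : Fin ℓ ⊕ Fin ℓ → Finset V := fun x ↦ G.neighborFinset (u x) \ X
  have hB : ∀ x, d ≤ (B x).card + Fintype.card α * ℓ := by
    intro x
    have h1 := Finset.le_card_sdiff X (G.neighborFinset (u x))
    have h2 := hd (u x)
    rw [Set.ncard_eq_toFinset_card', ← SimpleGraph.neighborFinset_def] at h2
    simp only [B]
    omega
  have hdisj : (↑(Finset.univ : Finset (Fin ℓ ⊕ Fin ℓ)) : Set _).PairwiseDisjoint B := by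
    intro x _ x' _ hxx
    refine Finset.disjoint_left.2 fun w hw hw' ↦ ?_
    simp only [B, Finset.mem_sdiff, SimpleGraph.mem_neighborFinset] at hw hw'
    have hn := hXn w hw.2
    rcases x with i | i <;> rcases x' with j | j
    · exact h.not_adj_common_of_adj_common hG hL hlL (by simpa using hxx) (hy i) (hy j) hn
        hw.1 hw'.1
    · exact h.not_adj_common_of_adj hG hL hlL (hy i) hn hw'.1 hw.1.symm
    · exact h.not_adj_common_of_adj hG hL hlL (hy j) hn hw.1 hw'.1.symm
    · have hij : i ≠ j := by simpa using hxx
      exact h.not_adj_of_adj hG hL hlL (g.injective.ne hij) hij hn hw.1 hw'.1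
  have hcard := Finset.card_le_univ (Finset.univ.biUnion B)
  rw [Finset.card_biUnion hdisj] at hcard
  have hsum := Finset.sum_le_sum (s := Finset.univ) (fun x _ ↦ hB x)
  rw [Finset.sum_add_distrib] at hsum
  simp only [Finset.sum_const, Finset.card_univ, Fintype.card_sum, Fintype.card_fin,
    smul_eq_mul, ← two_mul] at hsum
  omega

end IsCycleSystem

/-- Boundedly many vertices meet all odd cycles of a fixed length `ℓ < L`. -/
theorem exists_hitting_set_of_odd_length (L ℓ : ℕ) (hL : Odd L) (hl : 3 ≤ ℓ)
    (hlL : ℓ + 2 ≤ L) (ε : ℝ) (hε : 0 < ε) :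
    ∃ C n₀ : ℕ, ∀ (V : Type) [Fintype V], n₀ ≤ Nat.card V →
      ∀ G : SimpleGraph V, ¬ HasCycleOfLength G L →
        (∀ v : V, ((1 : ℝ) / L + ε) * (Nat.card V) ≤ (G.neighborSet v).ncard) →
        ∃ T : Finset V, T.card ≤ C ∧
          ∀ c : Fin ℓ → V, IsOddCycleLike G c → ∃ i, c i ∈ T := by
  obtain ⟨M, N, hMN⟩ := exists_common_neighbors_forall ε hε (L + L * ℓ) ℓ L
  obtain ⟨N', hN'⟩ := exists_nat_gt ((L * ℓ : ℝ) / ε)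
  refine ⟨M * ℓ, max N N', fun V _ hV G hG hdeg ↦ ?_⟩
  classical
  refine (exists_disjoint_or_exists_hitting (IsOddCycleLike G) (fun c hc ↦ hc.injective)
    M).resolve_left ?_
  rintro ⟨f, hf, hinj⟩
  let R : ℕ → Fin M → Finset V := fun i a ↦
    if hi : i < ℓ then G.neighborFinset (f a ⟨i, hi⟩) else ∅
  obtain ⟨S, -, hSc, hSY⟩ := hMN V (le_trans (le_max_left _ _) hV) Finset.univ R (by simp) (by
    intro i hi a _
    have h1 := hdeg (f a ⟨i, hi⟩)
    rw [Set.ncard_eq_toFinset_card', ← SimpleGraph.neighborFinset_def] at h1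
    simp only [R, hi, dif_pos]
    refine le_trans (mul_le_mul_of_nonneg_right ?_ (by positivity)) h1
    exact le_add_of_nonneg_left (by positivity))
  choose! Y hYc hY using hSY
  let X : Finset V := Finset.univ.image (fun x : S × Fin ℓ ↦ f x.1 x.2)
  have hX : X.card ≤ L * ℓ := Finset.card_image_le.trans (by simp [hSc])
  have hsys : IsCycleSystem G L (fun a : S ↦ f a) (fun i : Fin ℓ ↦ Y i \ X) := by
    refine ⟨fun a ↦ hf a, ?_, ?_, ?_, by simp [hSc], ?_⟩
    · rintro ⟨a, i⟩ ⟨b, j⟩ h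
      have := @hinj (a, i) (b, j) h
      obtain ⟨hab, hij⟩ := Prod.mk.inj this
      exact Prod.ext (Subtype.ext hab) hij
    · intro a i y hy
      have := hY i i.2 a a.2 (Finset.mem_sdiff.1 hy).1
      simpa [R] using this
    · intro a i j y hy he
      exact (Finset.mem_sdiff.1 hy).2 (Finset.mem_image.2 ⟨(a, j), Finset.mem_univ _, he⟩)
    · intro i
      have h1 := Finset.le_card_sdiff X (Y i)
      have h2 := hYc i i.2
      omega
  have hLl := hsys.lt_add_four hG hL hl
  have hbound := hsys.degree_le hG hL hlL (d := ⌈((1 : ℝ) / L + ε) * (Nat.card V)⌉₊)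
    (fun v ↦ Nat.ceil_le.2 (hdeg v))
  have hS : Fintype.card S = L := by simp [hSc]
  rw [hS, ← Nat.card_eq_fintype_card] at hbound
  set n := Nat.card V
  have hceil := Nat.le_ceil (((1 : ℝ) / L + ε) * n)
  set d := ⌈((1 : ℝ) / L + ε) * n⌉₊
  have hb : 2 * (ℓ : ℝ) * d ≤ n + 2 * ℓ * (L * ℓ) := by exact_mod_cast hbound
  have hn : (L * ℓ : ℝ) < n * ε := by
    rw [div_lt_iff₀ hε] at hN'
    exact hN'.trans_le (mul_le_mul_of_nonneg_right
      (by exact_mod_cast (le_max_right _ _).trans hV) hε.le)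
  have hL0 : (0 : ℝ) < L := by
    have : 0 < L := by omega
    exact_mod_cast this
  have hl0 : (0 : ℝ) < ℓ := by
    have : 0 < ℓ := by omega
    exact_mod_cast this
  have hL2 : (L : ℝ) ≤ 2 * ℓ := by
    have : L ≤ 2 * ℓ := by grind
    exact_mod_cast this
  have h1 : (n : ℝ) ≤ 2 * ℓ * (1 / L * n) := by
    have : 1 ≤ 2 * ℓ * (1 / (L : ℝ)) := by
      rw [mul_one_div, le_div_iff₀ hL0]; linarith
    have := mul_le_mul_of_nonneg_right this (Nat.cast_nonneg (α := ℝ) n)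
    linarith
  nlinarith

theorem HasCycleOfLength.exists_isOddCycleLike_of_induce {V : Type*} {G : SimpleGraph V}
    {s : Set V} {ℓ : ℕ} (hodd : Odd ℓ) (h : HasCycleOfLength (G.induce s) ℓ) :
    ∃ c : Fin ℓ → V, IsOddCycleLike G c ∧ ∀ i, c i ∈ s := by
  obtain ⟨v, w, hw, rfl⟩ := h
  let φ := SimpleGraph.Embedding.induce (G := G) s
  have hc := hw.map (f := φ.toHom) φ.injective
  have hlen : (w.map φ.toHom).length = w.length := by simp
  have := isOddCycleLike_getVert hc (by rwa [hlen])
  rw [← hlen]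
  refine ⟨_, this, fun i ↦ ?_⟩
  rw [Walk.getVert_map]
  exact (w.getVert i).2

theorem HasCycleOfLength.of_induce {V : Type*} {G : SimpleGraph V} {s : Set V} {ℓ : ℕ}
    (h : HasCycleOfLength (G.induce s) ℓ) : HasCycleOfLength G ℓ := by
  obtain ⟨v, w, hw, rfl⟩ := h
  let φ := SimpleGraph.Embedding.induce (G := G) s
  exact ⟨_, w.map φ.toHom, hw.map φ.injective, by simp⟩

/-- Theorem 5.1: for `k ≥ 3` and `ε > 0` there are `C` and `n₀` such that every
`n`-vertex (`n ≥ n₀`) maximal `C_{2k−1}`-free graph with minimum degree at least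
`(1/(2k−1) + ε)·n` contains a set `T` of at most `C` vertices whose removal leaves
a graph with no odd cycle of length between `3` and `2k−1`. -/
theorem remove_few_vertices (k : ℕ) (hk : 3 ≤ k) (ε : ℝ) (hε : 0 < ε) :
    ∃ C n₀ : ℕ, ∀ (V : Type) [Fintype V], n₀ ≤ Nat.card V →
      ∀ G : SimpleGraph V, MaximalCLFree G (2 * k - 1) →
        (∀ v : V,
          ((1 : ℝ) / (2 * (k : ℝ) - 1) + ε) * (Nat.card V) ≤ (G.neighborSet v).ncard) →
        ∃ T : Finset V, T.card ≤ C ∧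
          ∀ ℓ : ℕ, 3 ≤ ℓ → ℓ ≤ 2 * k - 1 → Odd ℓ →
            ¬ HasCycleOfLength (G.induce ((↑T : Set V)ᶜ)) ℓ := by
  classical
  have hodd : Odd (2 * k - 1) := ⟨k - 1, by omega⟩
  have hcast : ((2 * k - 1 : ℕ) : ℝ) = 2 * (k : ℝ) - 1 := by
    rw [Nat.cast_sub (by omega)]
    push_cast
    ring
  have key := fun (ℓ : ℕ) (hl : 3 ≤ ℓ ∧ ℓ + 2 ≤ 2 * k - 1) ↦
    exists_hitting_set_of_odd_length (2 * k - 1) ℓ hodd hl.1 hl.2 ε hε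
  choose! C N hCN using key
  let I := Finset.Icc 3 (2 * k - 3)
  refine ⟨∑ ℓ ∈ I, C ℓ, I.sup N, fun V _ hV G hG hdeg ↦ ?_⟩
  have hI : ∀ ℓ ∈ I, 3 ≤ ℓ ∧ ℓ + 2 ≤ 2 * k - 1 := by
    intro ℓ hℓ
    have := Finset.mem_Icc.1 hℓ
    omega
  have key := fun ℓ (hℓ : ℓ ∈ I) ↦ hCN ℓ (hI ℓ hℓ) V ((Finset.le_sup hℓ).trans hV) G hG.1
    (by rwa [hcast])
  choose! T hTC hT using key
  refine ⟨I.biUnion T, Finset.card_biUnion_le.trans (Finset.sum_le_sum hTC), ?_⟩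
  intro ℓ h3 hℓ hℓo hcyc
  by_cases he : ℓ = 2 * k - 1
  · subst he
    exact hG.1 hcyc.of_induce
  have hmem : ℓ ∈ I := Finset.mem_Icc.2 ⟨h3, by grind⟩
  obtain ⟨c, hc, hcT⟩ := hcyc.exists_isOddCycleLike_of_induce hℓo
  obtain ⟨i, hi⟩ := hT ℓ hmem c hc
  exact hcT i (Finset.mem_biUnion.2 ⟨ℓ, hmem, hi⟩)
end
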